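/- There exist universal constants c, C > 0 and c₂ ∈ (0,1) such that the following holds. Let X be an isotropic random vector in ℝⁿ with log-concave density which is ψ_α (α ∈ [1,2]) with constant b_α, let A be an n×n real matrix with ‖A‖_HS² = n, let G_n be a standard Gaussian random vector in ℝⁿ independent of X, and set Y = (AX + G_n)/√2 and ñ := n/(‖A‖_op²·b_α²). Then P(|Y| ≥ (1+t)√n) ≤ exp(−c·ñ^{α/2}·min(t^{2+α}, t)) for all t ≥ 0, and P(|Y| ≤ (1−t)√n) ≤ C·exp(−c·ñ^{α/2}·max(t^{2+α}, log(c₂/(1−t)))) for all t ∈ [0,1). -/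

import Mathlib

open MeasureTheory ProbabilityTheory Real
open scoped ENNReal RealInnerProductSpace Pointwise NNReal

noncomputable section

/-- A nonnegative function is log-concave if `f(λx+(1-λ)y) ≥ f(x)^λ f(y)^{1-λ}`. -/
def IsLogConcaveFn {E : Type*} [AddCommGroup E] [Module ℝ E] (f : E → ℝ) : Prop :=
  (∀ x, 0 ≤ f x) ∧
  ∀ x y : E, ∀ l : ℝ, 0 ≤ l → l ≤ 1 →
    f x ^ l * f y ^ (1 - l) ≤ f (l • x + (1 - l) • y)

/-- Hilbert-Schmidt (Frobenius) norm of a matrix. -/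
def hsNorm {n : ℕ} (A : Matrix (Fin n) (Fin n) ℝ) : ℝ :=
  Real.sqrt (∑ i, ∑ j, (A i j) ^ 2)

/-- Operator norm of a matrix acting on Euclidean space. -/
def opNorm {n : ℕ} (A : Matrix (Fin n) (Fin n) ℝ) : ℝ :=
  ‖LinearMap.toContinuousLinearMap (Matrix.toEuclideanLin A)‖

/-- Application of a matrix to a Euclidean vector. -/
def mApp {n : ℕ} (A : Matrix (Fin n) (Fin n) ℝ) (x : EuclideanSpace ℝ (Fin n)) :
    EuclideanSpace ℝ (Fin n) := Matrix.toEuclideanLin A x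

/-- The random vector `X` has density `f` with respect to Lebesgue measure. -/
def HasDensityFn {Ω : Type*} [MeasurableSpace Ω] (P : Measure Ω) {n : ℕ}
    (X : Ω → EuclideanSpace ℝ (Fin n)) (f : EuclideanSpace ℝ (Fin n) → ℝ) : Prop :=
  Measurable X ∧ Measure.map X P = volume.withDensity fun x => ENNReal.ofReal (f x)

/-- `X` is isotropic: centered with identity covariance. -/
def Isotropic {Ω : Type*} [MeasurableSpace Ω] (P : Measure Ω) {n : ℕ}
    (X : Ω → EuclideanSpace ℝ (Fin n)) : Prop :=
  (∫ ω, X ω ∂P) = 0 ∧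
  ∀ θ η : EuclideanSpace ℝ (Fin n), (∫ ω, ⟪X ω, θ⟫ * ⟪X ω, η⟫ ∂P) = ⟪θ, η⟫

/-- `X` is ψ_α with constant `b`. -/
def IsPsiAlpha {Ω : Type*} [MeasurableSpace Ω] (P : Measure Ω) {n : ℕ}
    (X : Ω → EuclideanSpace ℝ (Fin n)) (α b : ℝ) : Prop :=
  ∀ p : ℝ, 2 ≤ p → ∀ y : EuclideanSpace ℝ (Fin n),
    (∫ ω, |⟪X ω, y⟫| ^ p ∂P) ^ (1/p) ≤ b * p ^ (1/α) * (∫ ω, ⟪X ω, y⟫ ^ 2 ∂P) ^ ((1:ℝ)/2)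

/-- `G` is a standard Gaussian random vector in `ℝⁿ`. -/
def IsStdGaussian {Ω : Type*} [MeasurableSpace Ω] (P : Measure Ω) {n : ℕ}
    (G : Ω → EuclideanSpace ℝ (Fin n)) : Prop :=
  Measurable G ∧
  Measure.map G P = volume.withDensity fun x =>
    ENNReal.ofReal ((2 * π) ^ (-(n:ℝ)/2) * Real.exp (-‖x‖ ^ 2 / 2))

/-- Surface area of the unit sphere `S^{k-1}` in `ℝᵏ`. -/
def sphereVol (k : ℕ) : ℝ := 2 * π ^ ((k : ℝ)/2) / Real.Gamma ((k : ℝ)/2)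

/-- The marginal density `π_F g(x) = ∫_{F^⊥} g(x+y) dy`. -/
def marginalDensity {n : ℕ} (g : EuclideanSpace ℝ (Fin n) → ℝ)
    (F : Submodule ℝ (EuclideanSpace ℝ (Fin n))) (x : EuclideanSpace ℝ (Fin n)) : ℝ :=
  ∫ y : Fᗮ, g (x + y)

/-- `h_{k,p}(u) = vol(S^{k-1}) ∫₀^∞ t^{p+k-1} π_{u(E₀)} g(t u(θ₀)) dt`. -/
def hkp {n : ℕ} (g : EuclideanSpace ℝ (Fin n) → ℝ)
    (E₀ : Submodule ℝ (EuclideanSpace ℝ (Fin n))) (θ₀ : EuclideanSpace ℝ (Fin n))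
    (k : ℕ) (p : ℝ) (u : Matrix (Fin n) (Fin n) ℝ) : ℝ :=
  sphereVol k * ∫ t in Set.Ioi (0:ℝ), t ^ (p + (k:ℝ) - 1) *
    marginalDensity g (Submodule.map (Matrix.toEuclideanLin u) E₀) (t • mApp u θ₀)

/-- Support functional of the one-sided L_q-centroid body `Z⁺_q(w)`. -/
def suppZplus {m : ℕ} (w : EuclideanSpace ℝ (Fin m) → ℝ) (q : ℝ)
    (y : EuclideanSpace ℝ (Fin m)) : ℝ :=
  (2 * ∫ x, (max ⟪x, y⟫ 0) ^ q * w x) ^ (1/q)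

/-- Ball's body `K_q(w) = {x : q ∫₀^∞ t^{q-1} w(tx) dt ≥ 1}`. -/
def ballBody {m : ℕ} (w : EuclideanSpace ℝ (Fin m) → ℝ) (q : ℝ) :
    Set (EuclideanSpace ℝ (Fin m)) :=
  {x | 1 ≤ q * ∫ t in Set.Ioi (0:ℝ), t ^ (q-1) * w (t • x)}

/-- The one-sided L_q-centroid body `Z⁺_q(w)`, as the convex set with support
functional `suppZplus w q`. -/
def ZplusBody {m : ℕ} (w : EuclideanSpace ℝ (Fin m) → ℝ) (q : ℝ) :
    Set (EuclideanSpace ℝ (Fin m)) :=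
  {x | ∀ y, ⟪x, y⟫ ≤ suppZplus w q y}



/-! ### Prekopa-Leindler inequality -/

lemma pl_bm_compact (l : ℝ) (h0 : 0 < l) (h1 : l < 1) (A B S : Set ℝ) (hA : IsCompact A)
    (hB : IsCompact B) (hAn : A.Nonempty) (hBn : B.Nonempty)
    (h : ∀ a ∈ A, ∀ b ∈ B, (1 - l) * a + l * b ∈ S) :
    ENNReal.ofReal (1 - l) * volume A + ENNReal.ofReal l * volume B ≤ volume S := by
  obtain ⟨a, haA, ha⟩ := hA.exists_isMaxOn hAn continuousOn_id
  obtain ⟨b, hbB, hb⟩ := hB.exists_isMinOn hBn continuousOn_id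
  have hl1 : (1 - l) ≠ 0 := by linarith
  have e1 : volume ((fun z : ℝ => z + -(l * b)) ⁻¹' ((1 - l) • A)) = ENNReal.ofReal (1 - l) * volume A := by
    rw [measure_preimage_add_right, Measure.addHaar_smul]
    simp [abs_of_pos (by linarith : (0:ℝ) < 1 - l)]
  have e2 : volume ((fun z : ℝ => z + -((1 - l) * a)) ⁻¹' (l • B)) = ENNReal.ofReal l * volume B := by
    rw [measure_preimage_add_right, Measure.addHaar_smul]
    simp [abs_of_pos h0]
  rw [← e1, ← e2, ← measure_union₀]
  · apply measure_mono
    rintro z (hz | hz)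
    · obtain ⟨x, hx, hxz⟩ := hz
      have := h x hx b hbB
      simp only [smul_eq_mul] at hxz
      rw [show z = (1 - l) * x + l * b by linarith]; exact this
    · obtain ⟨x, hx, hxz⟩ := hz
      have := h a haA x hx
      simp only [smul_eq_mul] at hxz
      rw [show z = (1 - l) * a + l * x by linarith]; exact this
  · apply MeasurableSet.nullMeasurableSet
    exact (hB.smul l).isClosed.measurableSet.preimage (by fun_prop)
  · have : (fun z : ℝ => z + -(l * b)) ⁻¹' ((1 - l) • A) ∩ (fun z : ℝ => z + -((1 - l) * a)) ⁻¹' (l • B)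
        ⊆ {(1 - l) * a + l * b} := by
      rintro z ⟨⟨x, hx, hxz⟩, ⟨y, hy, hyz⟩⟩
      simp only [smul_eq_mul] at hxz hyz
      have hxa : x ≤ a := ha hx
      have hyb : b ≤ y := hb hy
      have : (1 - l) * x ≤ (1 - l) * a := by gcongr
      have : l * b ≤ l * y := by gcongr
      simp only [Set.mem_singleton_iff]
      linarith
    exact measure_mono_null this (by simp)

lemma pl_bm (l : ℝ) (h0 : 0 < l) (h1 : l < 1) (A B S : Set ℝ) (hA : MeasurableSet A)
    (hB : MeasurableSet B) (hAn : A.Nonempty) (hBn : B.Nonempty)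
    (h : ∀ a ∈ A, ∀ b ∈ B, (1 - l) * a + l * b ∈ S) :
    ENNReal.ofReal (1 - l) * volume A + ENNReal.ofReal l * volume B ≤ volume S := by
  have key : ∀ A : Set ℝ, MeasurableSet A → volume A = ⨆ K : {K : Set ℝ // K ⊆ A ∧ IsCompact K}, volume K.1 := by
    intro A hA
    rw [hA.measure_eq_iSup_isCompact, iSup_subtype]
    simp only [iSup_and]
  rw [key A hA, key B hB, ENNReal.mul_iSup, ENNReal.mul_iSup]
  have : Nonempty {K : Set ℝ // K ⊆ A ∧ IsCompact K} := ⟨⟨∅, by simp⟩⟩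
  have : Nonempty {K : Set ℝ // K ⊆ B ∧ IsCompact K} := ⟨⟨∅, by simp⟩⟩
  apply ENNReal.iSup_add_iSup_le
  rintro ⟨K, hK, hKc⟩ ⟨M, hM, hMc⟩
  obtain ⟨a, ha⟩ := hAn
  obtain ⟨b, hb⟩ := hBn
  have := pl_bm_compact l h0 h1 (insert a K) (insert b M) S (hKc.insert a) (hMc.insert b) (by simp) (by simp)
    (fun x hx y hy => h x (Set.insert_subset ha hK hx) y (Set.insert_subset hb hM hy))
  refine le_trans ?_ this
  gcongr <;> simp

lemma pl_amgm (l : ℝ) (h0 : 0 < l) (h1 : l < 1) (a b : ℝ≥0∞) :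
    a ^ (1 - l) * b ^ l ≤ ENNReal.ofReal (1 - l) * a + ENNReal.ofReal l * b := by
  have hl : ENNReal.ofReal l ≠ 0 := by simp [h0]
  have hl' : ENNReal.ofReal (1 - l) ≠ 0 := by simp [h1]
  rcases eq_or_ne a ⊤ with rfl | ha
  · rw [ENNReal.mul_top hl']; simp
  rcases eq_or_ne b ⊤ with rfl | hb
  · rw [ENNReal.mul_top hl]; simp
  lift a to ℝ≥0 using ha
  lift b to ℝ≥0 using hb
  have := NNReal.geom_mean_le_arith_mean2_weighted ⟨1 - l, by linarith⟩ ⟨l, h0.le⟩ a b (NNReal.eq (show (1 - l) + l = 1 by ring))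
  rw [← ENNReal.coe_rpow_of_nonneg _ (by linarith), ← ENNReal.coe_rpow_of_nonneg _ h0.le,
    ENNReal.ofReal, ENNReal.ofReal, Real.toNNReal_of_nonneg (by linarith), Real.toNNReal_of_nonneg h0.le]
  exact_mod_cast this

lemma pl_unit (l : ℝ) (h0 : 0 < l) (h1 : l < 1) (f g h : ℝ → ℝ) (hf : Measurable f) (hg : Measurable g)
    (hh : Measurable h) (f0 : ∀ x, 0 ≤ f x) (g0 : ∀ x, 0 ≤ g x) (hh0 : ∀ x, 0 ≤ h x)
    (f1 : ∀ x, f x ≤ 1) (g1 : ∀ x, g x ≤ 1) (fs : ∀ s < 1, ∃ x, s < f x) (gs : ∀ s < 1, ∃ x, s < g x)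
    (H : ∀ x y, f x ^ (1 - l) * g y ^ l ≤ h ((1 - l) * x + l * y)) :
    ENNReal.ofReal (1 - l) * (∫⁻ x, ENNReal.ofReal (f x)) + ENNReal.ofReal l * (∫⁻ x, ENNReal.ofReal (g x))
      ≤ ∫⁻ x, ENNReal.ofReal (h x) := by
  rw [lintegral_eq_lintegral_meas_lt _ (ae_of_all _ f0) hf.aemeasurable,
    lintegral_eq_lintegral_meas_lt _ (ae_of_all _ g0) hg.aemeasurable,
    lintegral_eq_lintegral_meas_lt _ (ae_of_all _ hh0) hh.aemeasurable]
  have m1 : ∀ f : ℝ → ℝ, Measurable (fun t : ℝ => volume {a | t < f a}) := by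
    intro f
    apply Antitone.measurable
    intro s t hst
    apply measure_mono
    intro x hx
    exact lt_of_le_of_lt hst hx
  rw [← lintegral_const_mul _ (m1 f), ← lintegral_const_mul _ (m1 g),
    ← lintegral_add_left ((m1 f).const_mul _)]
  apply setLIntegral_mono (m1 h)
  intro t ht
  rw [Set.mem_Ioi] at ht
  by_cases ht1 : t < 1
  · apply pl_bm l h0 h1 _ _ _ (measurableSet_lt measurable_const hf) (measurableSet_lt measurable_const hg)
    · exact fs t ht1
    · exact gs t ht1
    · intro a ha b hb
      simp only [Set.mem_ofPred_eq] at *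
      refine lt_of_lt_of_le ?_ (H a b)
      calc t = t ^ (1 - l) * t ^ l := by rw [← Real.rpow_add ht]; simp
        _ < _ := by
          apply mul_lt_mul'' (Real.rpow_lt_rpow ht.le ha (by linarith)) (Real.rpow_lt_rpow ht.le hb h0) <;> positivity
  · have e : ∀ f : ℝ → ℝ, (∀ x, f x ≤ 1) → {a | t < f a} = ∅ := by
      intro f hf
      ext x
      simp only [Set.mem_ofPred_eq, Set.mem_empty_iff_false, iff_false, not_lt]
      linarith [hf x]
    rw [e f f1, e g g1]; simp

/-- The Prekopa-Leindler property of a measure space. -/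
def PLprop (V : Type*) [AddCommGroup V] [Module ℝ V] [MeasureSpace V] : Prop :=
  ∀ l : ℝ, 0 < l → l < 1 → ∀ F G H : V → ℝ≥0∞, Measurable F → Measurable G → Measurable H →
    (∀ x y, F x ^ (1 - l) * G y ^ l ≤ H ((1 - l) • x + l • y)) →
    (∫⁻ x, F x) ^ (1 - l) * (∫⁻ x, G x) ^ l ≤ ∫⁻ x, H x

lemma pl_sup (F : ℝ → ℝ≥0∞) (hz : (⨆ x, F x) ≠ 0) (ht : (⨆ x, F x) ≠ ⊤) (s : ℝ) (hs : s < 1) :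
    ∃ x, s < (F x / ⨆ x, F x).toReal := by
  have : ENNReal.ofReal s * (⨆ x, F x) < (⨆ x, F x) := by
    calc ENNReal.ofReal s * (⨆ x, F x) < 1 * (⨆ x, F x) := by
          rw [ENNReal.mul_lt_mul_iff_left hz ht]
          simpa using hs
      _ = (⨆ x, F x) := one_mul _
  obtain ⟨x, hx⟩ := lt_iSup_iff.1 this
  refine ⟨x, ?_⟩
  have h1 : ENNReal.ofReal s < F x / (⨆ x, F x) := by
    rw [ENNReal.lt_div_iff_mul_lt (Or.inl hz) (Or.inl ht)]; exact hx
  have h2 : F x / (⨆ x, F x) ≠ ⊤ := ENNReal.div_ne_top (ne_top_of_le_ne_top ht (le_iSup F x)) hz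
  exact lt_of_le_of_lt (Real.le_coe_toNNReal s) ((ENNReal.toReal_lt_toReal ENNReal.ofReal_ne_top h2).2 h1)

lemma pl_real_bdd (l : ℝ) (h0 : 0 < l) (h1 : l < 1) (F G H : ℝ → ℝ≥0∞) (hF : Measurable F)
    (hG : Measurable G) (hH : Measurable H) (Fb : (⨆ x, F x) ≠ ⊤) (Gb : (⨆ x, G x) ≠ ⊤)
    (h : ∀ x y, F x ^ (1 - l) * G y ^ l ≤ H ((1 - l) • x + l • y)) :
    (∫⁻ x, F x) ^ (1 - l) * (∫⁻ x, G x) ^ l ≤ ∫⁻ x, H x := by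
  have hl' : 0 < 1 - l := by linarith
  set f0 := ⨆ x, F x with hf0
  set g0 := ⨆ x, G x with hg0
  have Fle : ∀ x, F x ≤ f0 := fun x => le_iSup F x
  have Gle : ∀ x, G x ≤ g0 := fun x => le_iSup G x
  rcases eq_or_ne f0 0 with hz | hfz
  · have : ∀ x, F x = 0 := fun x => le_antisymm (hz ▸ Fle x) bot_le
    simp [this, hl']
  rcases eq_or_ne g0 0 with hz | hgz
  · have : ∀ x, G x = 0 := fun x => le_antisymm (hz ▸ Gle x) bot_le
    simp [this, h0]
  set c := f0 ^ (1 - l) * g0 ^ l with hc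
  have cz : c ≠ 0 := by
    simp [hc, hfz, hgz, Fb, Gb]
  have ct : c ≠ ⊤ := ENNReal.mul_ne_top (ENNReal.rpow_ne_top_of_nonneg hl'.le Fb) (ENNReal.rpow_ne_top_of_nonneg h0.le Gb)
  have key := pl_unit l h0 h1 (fun x => (F x / f0).toReal) (fun x => (G x / g0).toReal)
    (fun x => (min 1 (H x / c)).toReal) (by fun_prop) (by fun_prop) (by fun_prop) (fun x => ENNReal.toReal_nonneg) (fun x => ENNReal.toReal_nonneg) (fun x => ENNReal.toReal_nonneg)
    (fun x => by have := ENNReal.toReal_mono ENNReal.one_ne_top (ENNReal.div_le_of_le_mul (by simpa using Fle x) : F x / f0 ≤ 1); simpa using this)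
    (fun x => by have := ENNReal.toReal_mono ENNReal.one_ne_top (ENNReal.div_le_of_le_mul (by simpa using Gle x) : G x / g0 ≤ 1); simpa using this)
    ?_ ?_ ?_
  · have fin1 : ∀ x, ENNReal.ofReal ((F x / f0).toReal) = F x / f0 := fun x =>
      ENNReal.ofReal_toReal (ENNReal.div_ne_top (ne_top_of_le_ne_top Fb (Fle x)) hfz)
    have fin2 : ∀ x, ENNReal.ofReal ((G x / g0).toReal) = G x / g0 := fun x =>
      ENNReal.ofReal_toReal (ENNReal.div_ne_top (ne_top_of_le_ne_top Gb (Gle x)) hgz)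
    have fin3 : ∀ x, ENNReal.ofReal ((min 1 (H x / c)).toReal) = min 1 (H x / c) := fun x =>
      ENNReal.ofReal_toReal (by simp)
    simp only [fin1, fin2, fin3] at key
    have k2 := (pl_amgm l h0 h1 _ _).trans key
    have k3 : ∫⁻ x, min 1 (H x / c) ≤ (∫⁻ x, H x) / c := by
      rw [div_eq_mul_inv, ← lintegral_mul_const _ hH]
      exact lintegral_mono fun x => min_le_right _ _
    have k4 := k2.trans k3
    simp only [div_eq_mul_inv] at k4
    rw [lintegral_mul_const _ hF, lintegral_mul_const _ hG, ENNReal.mul_rpow_of_nonneg _ _ hl'.le,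
      ENNReal.mul_rpow_of_nonneg _ _ h0.le] at k4
    rw [ENNReal.inv_rpow, ENNReal.inv_rpow] at k4
    have e : c⁻¹ = (f0 ^ (1 - l))⁻¹ * (g0 ^ l)⁻¹ := by
      rw [hc, ENNReal.mul_inv (Or.inr (ENNReal.rpow_ne_top_of_nonneg h0.le Gb)) (Or.inl (ENNReal.rpow_ne_top_of_nonneg hl'.le Fb))]
    have e2 : (∫⁻ x, F x) ^ (1 - l) * (∫⁻ x, G x) ^ l * c⁻¹ ≤ (∫⁻ x, H x) * c⁻¹ := by
      refine le_trans (le_of_eq ?_) k4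
      rw [e]; ring
    calc _ = (∫⁻ x, F x) ^ (1 - l) * (∫⁻ x, G x) ^ l * c⁻¹ * c := by
            rw [mul_assoc, ENNReal.inv_mul_cancel cz ct, mul_one]
      _ ≤ (∫⁻ x, H x) * c⁻¹ * c := by gcongr
      _ = _ := by rw [mul_assoc, ENNReal.inv_mul_cancel cz ct, mul_one]
  · exact pl_sup F hfz Fb
  · exact pl_sup G hgz Gb
  · intro x y
    rw [ENNReal.toReal_rpow, ENNReal.toReal_rpow, ← ENNReal.toReal_mul]
    apply ENNReal.toReal_mono (by simp)
    rw [div_eq_mul_inv, div_eq_mul_inv, ENNReal.mul_rpow_of_nonneg _ _ hl'.le,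
      ENNReal.mul_rpow_of_nonneg _ _ h0.le, ENNReal.inv_rpow, ENNReal.inv_rpow]
    have e : c⁻¹ = (f0 ^ (1 - l))⁻¹ * (g0 ^ l)⁻¹ := by
      rw [hc, ENNReal.mul_inv (Or.inr (ENNReal.rpow_ne_top_of_nonneg h0.le Gb)) (Or.inl (ENNReal.rpow_ne_top_of_nonneg hl'.le Fb))]
    have e' : F x ^ (1 - l) * (f0 ^ (1 - l))⁻¹ * (G y ^ l * (g0 ^ l)⁻¹) = F x ^ (1 - l) * G y ^ l * c⁻¹ := by
      rw [e]; ring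
    rw [e']
    apply le_min
    · rw [← ENNReal.mul_inv_cancel cz ct]
      gcongr
      rw [hc]
      gcongr
      · exact Fle x
      · exact Gle y
    · rw [div_eq_mul_inv]
      gcongr
      simpa using h x y

open Filter Topology in
lemma pl_trunc_tendsto (F : ℝ → ℝ≥0∞) (hF : Measurable F) :
    Tendsto (fun N : ℕ => ∫⁻ x, min (F x) N) atTop (𝓝 (∫⁻ x, F x)) := by
  apply lintegral_tendsto_of_tendsto_of_monotone
  · intro N; fun_prop
  · refine ae_of_all _ fun x => ?_
    intro N M h
    dsimp only
    gcongr
  · refine ae_of_all _ fun x => ?_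
    have := (tendsto_const_nhds (x := F x)).min ENNReal.tendsto_nat_nhds_top
    simpa using this

open Filter Topology in
lemma plprop_real : PLprop ℝ := by
  intro l h0 h1 F G H hF hG hH h
  have hl' : 0 < 1 - l := by linarith
  rcases eq_or_ne (∫⁻ x, F x) 0 with hz | hfz
  · simp [hz, hl']
  rcases eq_or_ne (∫⁻ x, G x) 0 with hz | hgz
  · simp [hz, h0]
  have t1 := ((ENNReal.continuous_rpow_const (y := 1 - l)).tendsto _).comp (pl_trunc_tendsto F hF)
  have t2 := ((ENNReal.continuous_rpow_const (y := l)).tendsto _).comp (pl_trunc_tendsto G hG)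
  have t3 := ENNReal.Tendsto.mul t1 (Or.inl (by simp [hfz, h1.le])) t2 (Or.inl (by simp [hgz, h0.le]))
  refine le_of_tendsto t3 (Eventually.of_forall fun N => ?_)
  refine pl_real_bdd l h0 h1 _ _ H (by fun_prop) (by fun_prop) hH ?_ ?_ ?_
  · exact ne_top_of_le_ne_top (ENNReal.natCast_ne_top N) (iSup_le fun x => min_le_right _ _)
  · exact ne_top_of_le_ne_top (ENNReal.natCast_ne_top N) (iSup_le fun x => min_le_right _ _)
  · intro x y
    refine le_trans ?_ (h x y)
    gcongr <;> exact min_le_left _ _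

lemma PLprop.prod {V W : Type*} [AddCommGroup V] [Module ℝ V] [MeasureSpace V] [AddCommGroup W]
    [Module ℝ W] [MeasureSpace W] [SFinite (volume : Measure W)]
    (hV : PLprop V) (hW : PLprop W) : PLprop (V × W) := by
  intro l h0 h1 F G H hF hG hH h
  rw [Measure.volume_eq_prod, lintegral_prod _ hF.aemeasurable, lintegral_prod _ hG.aemeasurable,
    lintegral_prod _ hH.aemeasurable]
  refine hV l h0 h1 _ _ _ hF.lintegral_prod_right' hG.lintegral_prod_right' hH.lintegral_prod_right' ?_
  intro x y
  refine hW l h0 h1 _ _ _ (by fun_prop) (by fun_prop) (by fun_prop) ?_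
  intro a b
  exact h (x, a) (y, b)

lemma PLprop.map {V W : Type*} [AddCommGroup V] [Module ℝ V] [MeasureSpace V] [AddCommGroup W]
    [Module ℝ W] [MeasureSpace W] (hV : PLprop V) (e : V → W)
    (he : MeasurePreserving e) (hadd : ∀ l : ℝ, ∀ x y, e ((1 - l) • x + l • y) = (1 - l) • e x + l • e y) :
    PLprop W := by
  intro l h0 h1 F G H hF hG hH h
  rw [← he.lintegral_comp hF, ← he.lintegral_comp hG, ← he.lintegral_comp hH]
  refine hV l h0 h1 _ _ _ (hF.comp he.measurable) (hG.comp he.measurable) (hH.comp he.measurable) ?_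
  intro x y
  rw [hadd]
  exact h _ _

lemma PLprop.pi {V : Type*} [AddCommGroup V] [Module ℝ V] [MeasureSpace V]
    [SigmaFinite (volume : Measure V)] (hV : PLprop V) (k : ℕ) : PLprop (Fin k → V) := by
  induction k with
  | zero =>
    intro l h0 h1 F G H hF hG hH h
    rw [volume_pi, Measure.pi_of_empty, lintegral_dirac' _ hF, lintegral_dirac' _ hG, lintegral_dirac' _ hH]
    refine (h _ _).trans (le_of_eq ?_)
    congr 1
    exact Subsingleton.elim _ _
  | succ k ih =>
    have hp := volume_preserving_piFinSuccAbove (fun _ : Fin (k + 1) => V) 0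
    refine (hV.prod ih).map _ hp.symm ?_
    intro l x y
    ext i
    refine Fin.cases ?_ (fun j => ?_) i <;> simp [MeasurableEquiv.piFinSuccAbove]

lemma plprop_euclidean (n : ℕ) : PLprop (EuclideanSpace ℝ (Fin n)) :=
  (plprop_real.pi n).map _ (PiLp.volume_preserving_toLp (Fin n)) (by intros; rfl)

lemma PLprop.ae {V : Type*} [AddCommGroup V] [Module ℝ V] [MeasureSpace V] (hV : PLprop V)
    (l : ℝ) (h0 : 0 < l) (h1 : l < 1) (F G H : V → ℝ≥0∞) (hH : AEMeasurable H)
    (h : ∀ x y, F x ^ (1 - l) * G y ^ l ≤ H ((1 - l) • x + l • y)) :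
    (∫⁻ x, F x) ^ (1 - l) * (∫⁻ x, G x) ^ l ≤ ∫⁻ x, H x := by
  obtain ⟨F', mF, lF, eF⟩ := exists_measurable_le_lintegral_eq (volume : Measure V) F
  obtain ⟨G', mG, lG, eG⟩ := exists_measurable_le_lintegral_eq (volume : Measure V) G
  set s := toMeasurable volume {x | ¬ (H x = hH.mk H x)} with hs
  have hs0 : volume s = 0 := by
    rw [hs, measure_toMeasurable]; exact ae_iff.1 hH.ae_eq_mk
  set H' : V → ℝ≥0∞ := s.indicator (fun _ => ⊤) + hH.mk H with hH'
  have mH' : Measurable H' := (measurable_const.indicator (measurableSet_toMeasurable _ _)).add hH.measurable_mk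
  have le : ∀ x, H x ≤ H' x := by
    intro x
    by_cases hx : x ∈ s
    · simp [hH', hx]
    · have : H x = hH.mk H x := by
        by_contra hc
        exact hx (subset_toMeasurable _ _ hc)
      simp [hH', hx, ← this]
  have e : ∫⁻ x, H' x = ∫⁻ x, H x := by
    apply lintegral_congr_ae
    have : ∀ᵐ x, x ∉ s := measure_eq_zero_iff_ae_notMem.1 hs0
    filter_upwards [this, hH.ae_eq_mk] with x hx hx2
    simp [hH', hx, ← hx2]
  rw [eF, eG, ← e]
  have hl' : 0 < 1 - l := by linarith
  refine hV l h0 h1 F' G' H' mF mG mH' fun x y => ?_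
  refine le_trans ?_ ((h x y).trans (le _))
  gcongr
  · exact lF x
  · exact lG y

lemma IsLogConcaveFn.convex_lt {E : Type*} [AddCommGroup E] [Module ℝ E] {f : E → ℝ}
    (hf : IsLogConcaveFn f) (a : ℝ) : Convex ℝ {x | a < f x} := by
  rcases lt_or_ge a 0 with ha | ha
  · convert convex_univ
    ext x; simp; linarith [hf.1 x]
  intro x hx y hy s t hs ht hst
  simp only [Set.mem_ofPred_eq] at *
  have ht' : t = 1 - s := by linarith
  subst ht'
  refine lt_of_lt_of_le ?_ (hf.2 x y s hs (by linarith))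
  set m := min (f x) (f y)
  have hm : a < m := lt_min hx hy
  have hm0 : 0 < m := by linarith
  calc a < m := hm
    _ = m ^ s * m ^ (1 - s) := by rw [← Real.rpow_add hm0]; simp
    _ ≤ _ := by
      gcongr
      · exact Real.rpow_nonneg (hf.1 x) _
      · exact min_le_left _ _
      · exact min_le_right _ _

lemma IsLogConcaveFn.aemeasurable {n : ℕ} {f : EuclideanSpace ℝ (Fin n) → ℝ}
    (hf : IsLogConcaveFn f) : AEMeasurable f := by
  apply NullMeasurable.aemeasurable
  have : Measurable (fun x : NullMeasurableSpace (EuclideanSpace ℝ (Fin n)) volume => f x) := by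
    apply measurable_of_Ioi
    intro a
    exact (hf.convex_lt a).nullMeasurableSet volume
  exact this


/-! ### Log-concave measures: shell estimates and exponential tails -/

/-- The Prekopa-Leindler property of a measure. -/
def PLmeas {V : Type*} [AddCommGroup V] [Module ℝ V] [MeasurableSpace V] (μ : Measure V) : Prop :=
  ∀ l : ℝ, 0 < l → l < 1 → ∀ F G H : V → ℝ≥0∞, Measurable F → Measurable G → Measurable H →
    (∀ x y, F x ^ (1 - l) * G y ^ l ≤ H ((1 - l) • x + l • y)) →
    (∫⁻ x, F x ∂μ) ^ (1 - l) * (∫⁻ x, G x ∂μ) ^ l ≤ ∫⁻ x, H x ∂μ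

lemma plmeas_of_logconcave {n : ℕ} {f : EuclideanSpace ℝ (Fin n) → ℝ} (hf : IsLogConcaveFn f) :
    PLmeas ((volume : Measure (EuclideanSpace ℝ (Fin n))).withDensity fun x => ENNReal.ofReal (f x)) := by
  intro l h0 h1 F G H hF hG hH h
  have mf : AEMeasurable (fun x => ENNReal.ofReal (f x)) := hf.aemeasurable.ennreal_ofReal
  have hl' : 0 < 1 - l := by linarith
  rw [lintegral_withDensity_eq_lintegral_mul₀ mf hF.aemeasurable,
    lintegral_withDensity_eq_lintegral_mul₀ mf hG.aemeasurable,
    lintegral_withDensity_eq_lintegral_mul₀ mf hH.aemeasurable]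
  refine (plprop_euclidean n).ae l h0 h1 _ _ _ (mf.mul hH.aemeasurable) ?_
  intro x y
  simp only [Pi.mul_apply]
  rw [ENNReal.mul_rpow_of_nonneg _ _ hl'.le, ENNReal.mul_rpow_of_nonneg _ _ h0.le]
  have e : ENNReal.ofReal (f x) ^ (1 - l) * ENNReal.ofReal (f y) ^ l
      ≤ ENNReal.ofReal (f ((1 - l) • x + l • y)) := by
    rw [ENNReal.ofReal_rpow_of_nonneg (hf.1 x) hl'.le, ENNReal.ofReal_rpow_of_nonneg (hf.1 y) h0.le,
      ← ENNReal.ofReal_mul (Real.rpow_nonneg (hf.1 x) _)]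
    apply ENNReal.ofReal_le_ofReal
    have := hf.2 x y (1 - l) hl'.le (by linarith)
    simpa using this
  calc _ = (ENNReal.ofReal (f x) ^ (1 - l) * ENNReal.ofReal (f y) ^ l) * (F x ^ (1 - l) * G y ^ l) := by ring
    _ ≤ _ := by gcongr; exact h x y

lemma PLmeas.set {V : Type*} [AddCommGroup V] [Module ℝ V] [MeasurableSpace V] {μ : Measure V}
    (hμ : PLmeas μ) (l : ℝ) (h0 : 0 < l) (h1 : l < 1) (A B S : Set V) (hA : MeasurableSet A)
    (hB : MeasurableSet B) (hS : MeasurableSet S) (h : ∀ x ∈ A, ∀ y ∈ B, (1 - l) • x + l • y ∈ S) :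
    μ A ^ (1 - l) * μ B ^ l ≤ μ S := by
  have hl' : 0 < 1 - l := by linarith
  have := hμ l h0 h1 (A.indicator 1) (B.indicator 1) (S.indicator 1) (measurable_one.indicator hA)
    (measurable_one.indicator hB) (measurable_one.indicator hS) ?_
  · simpa [lintegral_indicator_one hA, lintegral_indicator_one hB, lintegral_indicator_one hS] using this
  intro x y
  by_cases hx : x ∈ A
  · by_cases hy : y ∈ B
    · simp [hx, hy, h x hx y hy]
    · simp [hy, h0]
  · simp [hx, hl']

section shell
variable {V : Type*} [AddCommGroup V] [Module ℝ V] [MeasurableSpace V] {μ : Measure V}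

lemma shell [IsProbabilityMeasure μ] (hμ : PLmeas μ) (N : Seminorm ℝ V) (hN : Measurable N)
    (r a b u : ℝ) (hu : 1 ≤ u) (hr : 1 / 2 ≤ μ {x | N x ≤ r}) :
    μ {x | u * (a + r) ≤ N x ∧ N x ≤ u * (b - r)} ≤ (2 * μ {x | a ≤ N x ∧ N x ≤ b}) ^ u := by
  have hr0 : 0 ≤ r := by
    by_contra hc
    have : {x | N x ≤ r} = ∅ := by
      ext x; simp; linarith [apply_nonneg N x]
    rw [this] at hr; simp at hr
  rcases eq_or_lt_of_le hu with rfl | hu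
  · rw [ENNReal.rpow_one]
    calc _ ≤ μ {x | a ≤ N x ∧ N x ≤ b} := by
          apply measure_mono
          intro x hx
          simp only [Set.mem_ofPred_eq] at *
          constructor <;> linarith
      _ ≤ _ := by rw [two_mul]; exact le_self_add
  have hu0 : 0 < u := by linarith
  have hiu : 0 < 1 / u := by positivity
  have hiu1 : 1 / u < 1 := by rw [div_lt_one hu0]; exact hu
  have key := hμ.set (1 / u) hiu hiu1 {x | N x ≤ r}
    {x | u * (a + r) ≤ N x ∧ N x ≤ u * (b - r)} {x | a ≤ N x ∧ N x ≤ b}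
    (measurableSet_le hN measurable_const)
    ((measurableSet_le measurable_const hN).inter (measurableSet_le hN measurable_const))
    ((measurableSet_le measurable_const hN).inter (measurableSet_le hN measurable_const)) ?_
  · set m := μ {x | u * (a + r) ≤ N x ∧ N x ≤ u * (b - r)}
    set e := μ {x | a ≤ N x ∧ N x ≤ b}
    have k1 : (1 / 2 : ℝ≥0∞) * m ^ (1 / u) ≤ e := by
      refine le_trans ?_ key
      gcongr
      calc (1 / 2 : ℝ≥0∞) = (1 / 2) ^ (1:ℝ) := by simp
        _ ≤ (1 / 2) ^ (1 - 1 / u) := by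
          apply ENNReal.rpow_le_rpow_of_exponent_ge
          · norm_num
          · linarith
        _ ≤ _ := by apply ENNReal.rpow_le_rpow hr; linarith
    have k2 : m ^ (1 / u) ≤ 2 * e := by
      calc m ^ (1 / u) = 2 * (1 / 2 * m ^ (1 / u)) := by
            rw [← mul_assoc, one_div (2:ℝ≥0∞), ENNReal.mul_inv_cancel (by norm_num) (by norm_num), one_mul]
        _ ≤ _ := by gcongr
    calc m = (m ^ (1 / u)) ^ u := by rw [← ENNReal.rpow_mul]; field_simp; simp
      _ ≤ _ := by gcongr
  · intro x hx y hy
    simp only [Set.mem_ofPred_eq] at *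
    have e1 : N ((1 - 1 / u) • x) = (1 - 1 / u) * N x := by
      rw [map_smul_eq_mul, Real.norm_of_nonneg (by linarith)]
    have e2 : N ((1 / u) • y) = (1 / u) * N y := by
      rw [map_smul_eq_mul, Real.norm_of_nonneg (by linarith)]
    have l1 : N ((1 - 1 / u) • x) ≤ r := by
      rw [e1]; nlinarith [apply_nonneg N x]
    have l2 : N ((1 / u) • y) ≤ b - r := by
      rw [e2, one_div, inv_mul_le_iff₀ hu0]; exact hy.2
    have l3 : a + r ≤ N ((1 / u) • y) := by
      rw [e2, one_div, le_inv_mul_iff₀ hu0]; exact hy.1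
    have t1 := map_add_le_add N ((1 - 1 / u) • x) ((1 / u) • y)
    have t2 := map_sub_le_add N ((1 - 1 / u) • x + (1 / u) • y) ((1 - 1 / u) • x)
    rw [add_sub_cancel_left] at t2
    constructor <;> linarith

lemma markov_sq (N : V → ℝ) (hN : Measurable N) 
    (h2 : ∫⁻ x, ENNReal.ofReal (N x ^ 2) ∂μ ≤ 1) (a : ℝ) (ha : 0 < a) :
    μ {x | a ≤ N x} ≤ ENNReal.ofReal (1 / a ^ 2) := by
  have := mul_meas_ge_le_lintegral (μ := μ) (f := fun x => ENNReal.ofReal (N x ^ 2)) (by fun_prop)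
    (ENNReal.ofReal (a ^ 2))
  rw [one_div, ENNReal.ofReal_inv_of_pos (by positivity), ← one_div,
    ENNReal.le_div_iff_mul_le (Or.inl (by simp; positivity)) (Or.inl (by simp)), mul_comm]
  refine le_trans ?_ (this.trans h2)
  gcongr
  rename_i x
  intro hx
  gcongr

lemma seminorm_tail [IsProbabilityMeasure μ] (hμ : PLmeas μ) (N : Seminorm ℝ V) (hN : Measurable N)
    (h2 : ∫⁻ x, ENNReal.ofReal (N x ^ 2) ∂μ ≤ 1) (u : ℝ) (hu : 1 ≤ u) :
    μ {x | 9 * u ≤ N x} ≤ 2 * (2 * μ {x | 7 ≤ N x ∧ N x ≤ 20}) ^ u := by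
  have hr : 1 / 2 ≤ μ {x | N x ≤ 2} := by
    have h := markov_sq N hN h2 2 (by norm_num)
    have h3 : μ {x | N x ≤ 2}ᶜ ≤ ENNReal.ofReal (1 / 2 ^ 2) := by
      refine le_trans (measure_mono ?_) h
      intro x hx
      simp only [Set.mem_compl_iff, Set.mem_ofPred_eq, not_le] at *
      exact hx.le
    have h4 := prob_add_prob_compl (μ := μ) (s := {x | N x ≤ 2}) (measurableSet_le hN measurable_const)
    by_contra hc
    push Not at hc
    have : μ {x | N x ≤ 2} + μ {x | N x ≤ 2}ᶜ < 1 := by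
      calc _ < 1 / 2 + ENNReal.ofReal (1 / 2 ^ 2) := by
            apply ENNReal.add_lt_add_of_lt_of_le _ hc h3
            exact ne_top_of_le_ne_top ENNReal.ofReal_ne_top h3
        _ ≤ 1 / 2 + 1 / 2 := by
            gcongr
            rw [show (1 / 2:ℝ≥0∞) = ENNReal.ofReal (1 / 2) by
              rw [one_div, one_div, ENNReal.ofReal_inv_of_pos (by norm_num)]; simp]
            apply ENNReal.ofReal_le_ofReal; norm_num
        _ = 1 := by rw [one_div]; exact ENNReal.inv_two_add_inv_two
    rw [h4] at this
    exact lt_irrefl _ this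
  set e := 2 * μ {x | 7 ≤ N x ∧ N x ≤ 20} with he
  have he2 : e ≤ 1 / 2 := by
    have h := markov_sq N hN h2 7 (by norm_num)
    calc e ≤ 2 * ENNReal.ofReal (1 / 7 ^ 2) := by
          rw [he]; gcongr
          refine le_trans (measure_mono ?_) h
          intro x hx
          exact hx.1
      _ = ENNReal.ofReal (2 / 49) := by
          rw [show (2:ℝ≥0∞) = ENNReal.ofReal 2 by simp, ← ENNReal.ofReal_mul (by norm_num)]; norm_num
      _ ≤ ENNReal.ofReal (1 / 2) := by apply ENNReal.ofReal_le_ofReal; norm_num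
      _ = 1 / 2 := by rw [one_div, ENNReal.ofReal_inv_of_pos (by norm_num)]; simp
  have hsub : {x | 9 * u ≤ N x} ⊆ ⋃ j : ℕ, {x | (u * 2 ^ j) * (7 + 2) ≤ N x ∧ N x ≤ (u * 2 ^ j) * (20 - 2)} := by
    intro x hx
    simp only [Set.mem_ofPred_eq, Set.mem_iUnion] at *
    obtain ⟨j, hj1, hj2⟩ := exists_nat_pow_near (x := N x / (9 * u)) (y := 2)
      (by rw [le_div_iff₀ (by positivity)]; linarith) (by norm_num)
    rw [le_div_iff₀ (by positivity)] at hj1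
    rw [div_lt_iff₀ (by positivity), pow_succ] at hj2
    exact ⟨j, by linarith, by linarith⟩
  set x := e ^ u with hx
  have hx2 : x ≤ 1 / 2 := by
    calc e ^ u ≤ e ^ (1:ℝ) := by
          apply ENNReal.rpow_le_rpow_of_exponent_ge _ hu
          exact he2.trans (by norm_num)
      _ ≤ _ := by simpa using he2
  calc μ {x | 9 * u ≤ N x} ≤ μ (⋃ j : ℕ, {x | (u * 2 ^ j) * (7 + 2) ≤ N x ∧ N x ≤ (u * 2 ^ j) * (20 - 2)}) :=
        measure_mono hsub
    _ ≤ ∑' j : ℕ, μ {x | (u * 2 ^ j) * (7 + 2) ≤ N x ∧ N x ≤ (u * 2 ^ j) * (20 - 2)} := measure_iUnion_le _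
    _ ≤ ∑' j : ℕ, x * (1 / 2) ^ j := by
        apply ENNReal.tsum_le_tsum
        intro j
        have h1j : (1:ℝ) ≤ 2 ^ j := one_le_pow₀ (by norm_num)
        have hj : (1:ℝ) + j ≤ 2 ^ j := by
          have := one_add_mul_le_pow (R := ℝ) (a := 1) (by norm_num) j
          norm_num at this; linarith
        refine (shell hμ N hN 2 7 20 (u * 2 ^ j) (by nlinarith) hr).trans ?_
        rw [← he]
        calc e ^ (u * 2 ^ j) = x ^ ((2:ℝ) ^ j) := by rw [hx, ENNReal.rpow_mul]
          _ ≤ x ^ ((1:ℝ) + j) := by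
              apply ENNReal.rpow_le_rpow_of_exponent_ge _ hj
              exact hx2.trans (by norm_num)
          _ = x * x ^ j := by
              rw [ENNReal.rpow_add_of_nonneg _ _ (by norm_num) (by positivity)]; simp
          _ ≤ _ := by gcongr
    _ = 2 * x := by
        rw [ENNReal.tsum_mul_left, ENNReal.tsum_geometric, one_div, ENNReal.one_sub_inv_two, inv_inv, mul_comm]

lemma seminorm_tail' [IsProbabilityMeasure μ] (hμ : PLmeas μ) (N : Seminorm ℝ V) (hN : Measurable N)
    (h2 : ∫⁻ x, ENNReal.ofReal (N x ^ 2) ∂μ ≤ 1) (u : ℝ) (hu : 1 ≤ u) :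
    μ {x | 9 * u ≤ N x} ≤ ENNReal.ofReal (2 * (2 / 49) ^ u) := by
  refine (seminorm_tail hμ N hN h2 u hu).trans ?_
  rw [ENNReal.ofReal_mul (by norm_num), ENNReal.ofReal_ofNat, ← ENNReal.ofReal_rpow_of_nonneg (by norm_num) (by linarith)]
  gcongr
  have h := markov_sq N hN h2 7 (by norm_num)
  calc _ ≤ 2 * ENNReal.ofReal (1 / 7 ^ 2) := by
          gcongr
          refine le_trans (measure_mono ?_) h
          intro x hx
          exact hx.1
      _ = ENNReal.ofReal (2 / 49) := by
          rw [show (2:ℝ≥0∞) = ENNReal.ofReal 2 by simp, ← ENNReal.ofReal_mul (by norm_num)]; norm_num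

lemma seminorm_exp [IsProbabilityMeasure μ] (hμ : PLmeas μ) (N : Seminorm ℝ V) (hN : Measurable N)
    (h2 : ∫⁻ x, ENNReal.ofReal (N x ^ 2) ∂μ ≤ 1) :
    ∫⁻ x, ENNReal.ofReal (Real.exp (N x / 9)) ∂μ ≤ ENNReal.ofReal 100 := by
  have pt : ∀ x, ENNReal.ofReal (Real.exp (N x / 9)) ≤
      ∑' j : ℕ, ENNReal.ofReal (Real.exp (j + 1)) * {x | 9 * (j:ℝ) ≤ N x}.indicator 1 x := by
    intro x
    refine le_trans ?_ (ENNReal.le_tsum ⌊N x / 9⌋₊)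
    have h1 : (⌊N x / 9⌋₊ : ℝ) ≤ N x / 9 := Nat.floor_le (by have := apply_nonneg N x; positivity)
    have h3 := (Nat.lt_floor_add_one (N x / 9)).le
    rw [Set.indicator_of_mem (by simp only [Set.mem_ofPred_eq]; linarith)]
    simp only [Pi.one_apply, mul_one]
    gcongr
  have tl : ∀ j : ℕ, μ {x | 9 * (j:ℝ) ≤ N x} ≤ ENNReal.ofReal (2 * (2 / 49) ^ j) := by
    intro j
    rcases Nat.eq_zero_or_pos j with rfl | hj
    · refine prob_le_one.trans ?_
      simp
    · have := seminorm_tail' hμ N hN h2 j (by exact_mod_cast hj)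
      simpa using this
  calc _ ≤ ∫⁻ x, ∑' j : ℕ, ENNReal.ofReal (Real.exp (j + 1)) * {x | 9 * (j:ℝ) ≤ N x}.indicator 1 x ∂μ :=
        lintegral_mono pt
    _ = ∑' j : ℕ, ENNReal.ofReal (Real.exp (j + 1)) * μ {x | 9 * (j:ℝ) ≤ N x} := by
        rw [lintegral_tsum]
        · congr 1; ext j
          rw [lintegral_const_mul _ (measurable_one.indicator (measurableSet_le measurable_const hN)),
            lintegral_indicator_one (measurableSet_le measurable_const hN)]
        · intro j
          exact ((measurable_one.indicator (measurableSet_le measurable_const hN)).const_mul _).aemeasurable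
    _ ≤ ∑' j : ℕ, ENNReal.ofReal (50 * (1 / 2) ^ j) := by
        apply ENNReal.tsum_le_tsum
        intro j
        calc _ ≤ ENNReal.ofReal (Real.exp (j + 1)) * ENNReal.ofReal (2 * (2 / 49) ^ j) := by
              gcongr; exact tl j
          _ = ENNReal.ofReal (Real.exp (j + 1) * (2 * (2 / 49) ^ j)) := by
              rw [← ENNReal.ofReal_mul (by positivity)]
          _ ≤ _ := by
              apply ENNReal.ofReal_le_ofReal
              have e3 : Real.exp 1 ≤ 3 := by linarith [Real.exp_one_lt_d9]
              have : Real.exp (j + 1) ≤ 3 * 3 ^ j := by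
                rw [Real.exp_add, mul_comm, ← Real.exp_one_pow]; gcongr
              calc Real.exp (j + 1) * (2 * (2 / 49) ^ j) ≤ (3 * 3 ^ j) * (2 * (2 / 49) ^ j) := by gcongr
                _ = 6 * (6 / 49) ^ j := by rw [mul_mul_mul_comm, ← mul_pow]; norm_num
                _ ≤ _ := mul_le_mul (by norm_num) (pow_le_pow_left₀ (by norm_num) (by norm_num) j) (by positivity) (by norm_num)
    _ = ENNReal.ofReal 100 := by
        rw [← ENNReal.ofReal_tsum_of_nonneg (by intro; positivity)]
        · rw [tsum_mul_left, tsum_geometric_two]; norm_num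
        · exact (summable_geometric_two).mul_left _

end shell


/-! ### Gaussian facts -/

/-- standard Gaussian measure with explicit density -/
def gam (n : ℕ) : Measure (EuclideanSpace ℝ (Fin n)) :=
  volume.withDensity fun x => ENNReal.ofReal ((2 * π) ^ (-(n:ℝ)/2) * Real.exp (-‖x‖ ^ 2 / 2))

lemma gam_dens_meas (n : ℕ) : Measurable fun x : EuclideanSpace ℝ (Fin n) =>
    ENNReal.ofReal ((2 * π) ^ (-(n:ℝ)/2) * Real.exp (-‖x‖ ^ 2 / 2)) := by fun_prop

lemma lintegral_gauss (n : ℕ) (b : ℝ) (hb : 0 < b) (v : EuclideanSpace ℝ (Fin n)) :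
    ∫⁻ x : EuclideanSpace ℝ (Fin n), ENNReal.ofReal (Real.exp (-b * ‖x - v‖ ^ 2))
      = ENNReal.ofReal ((π / b) ^ ((n:ℝ) / 2)) := by
  rw [lintegral_sub_right_eq_self (fun x : EuclideanSpace ℝ (Fin n) => ENNReal.ofReal (Real.exp (-b * ‖x‖ ^ 2))) v]
  have h := GaussianFourier.integral_rexp_neg_mul_sq_norm (V := EuclideanSpace ℝ (Fin n)) hb
  rw [finrank_euclideanSpace, Fintype.card_fin] at h
  rw [← h, ofReal_integral_eq_lintegral_ofReal]
  · by_contra hc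
    rw [integral_undef hc] at h
    have : 0 < (π / b) ^ ((n:ℝ) / 2) := by positivity
    linarith
  · exact ae_of_all _ fun x => (Real.exp_pos _).le

lemma gam_exp_sq (n : ℕ) (s : ℝ) (hs : s < 1 / 2) (w : EuclideanSpace ℝ (Fin n)) :
    ∫⁻ x, ENNReal.ofReal (Real.exp (s * ‖w + x‖ ^ 2)) ∂(gam n)
      = ENNReal.ofReal ((1 - 2 * s) ^ (-(n:ℝ) / 2) * Real.exp (s * ‖w‖ ^ 2 / (1 - 2 * s))) := by
  rw [gam, lintegral_withDensity_eq_lintegral_mul _ (gam_dens_meas n) (by fun_prop)]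
  simp only [Pi.mul_apply]
  set b := 1 / 2 - s with hb
  have hb0 : 0 < b := by linarith
  have e : ∀ x : EuclideanSpace ℝ (Fin n), ENNReal.ofReal ((2 * π) ^ (-(n:ℝ)/2) * Real.exp (-‖x‖ ^ 2 / 2)) *
      ENNReal.ofReal (Real.exp (s * ‖w + x‖ ^ 2)) =
      ENNReal.ofReal ((2 * π) ^ (-(n:ℝ)/2) * Real.exp (s * ‖w‖ ^ 2 / (1 - 2 * s))) *
      ENNReal.ofReal (Real.exp (-b * ‖x - (s / b) • w‖ ^ 2)) := by
    intro x
    rw [← ENNReal.ofReal_mul (by positivity), ← ENNReal.ofReal_mul (by positivity), mul_assoc, mul_assoc,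
      ← Real.exp_add, ← Real.exp_add]
    congr 3
    rw [norm_add_sq_real, norm_sub_sq_real, inner_smul_right, norm_smul, mul_pow, Real.norm_eq_abs, sq_abs,
      real_inner_comm w x, show 1 - 2 * s = 2 * b by rw [hb]; ring, show s = 1 / 2 - b by rw [hb]; ring]
    field_simp
    ring
  simp_rw [e]
  rw [lintegral_const_mul _ (by fun_prop), lintegral_gauss n b hb0, ← ENNReal.ofReal_mul (by positivity)]
  congr 1
  rw [show 1 - 2 * s = 2 * b by rw [hb]; ring]
  have : (2 * π) ^ (-(n:ℝ)/2) * (π / b) ^ ((n:ℝ) / 2) = (2 * b) ^ (-(n:ℝ)/2) := by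
    rw [neg_div, Real.rpow_neg (by positivity), Real.rpow_neg (by positivity), ← Real.inv_rpow (by positivity),
      ← Real.inv_rpow (by positivity), ← Real.mul_rpow (by positivity) (by positivity)]
    congr 1
    field_simp
  rw [← this]; ring

instance (n : ℕ) : IsProbabilityMeasure (gam n) := by
  constructor
  have := gam_exp_sq n 0 (by norm_num) 0
  simpa using this

lemma gam_eq_std (n : ℕ) : gam n = stdGaussian (EuclideanSpace ℝ (Fin n)) := by
  apply Measure.ext_of_charFun
  ext t
  rw [charFun_stdGaussian, charFun_apply, gam,
    integral_withDensity_eq_integral_toReal_smul (gam_dens_meas n) (by simp)]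
  have h := GaussianFourier.integral_cexp_neg_mul_sq_norm_add (V := EuclideanSpace ℝ (Fin n))
    (b := 1 / 2) (by norm_num) Complex.I t
  rw [finrank_euclideanSpace, Fintype.card_fin] at h
  have e : ∀ x : EuclideanSpace ℝ (Fin n),
      (ENNReal.ofReal ((2 * π) ^ (-(n:ℝ)/2) * Real.exp (-‖x‖ ^ 2 / 2))).toReal • Complex.exp (⟪x, t⟫ * Complex.I)
      = (((2 * π) ^ (-(n:ℝ)/2) : ℝ) : ℂ) * Complex.exp (-(1 / 2) * ‖x‖ ^ 2 + Complex.I * ⟪t, x⟫) := by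
    intro x
    rw [ENNReal.toReal_ofReal (by positivity), Complex.real_smul, Complex.ofReal_mul, mul_assoc]
    congr 1
    rw [Complex.ofReal_exp, ← Complex.exp_add, real_inner_comm]
    congr 1
    push_cast
    ring
  simp_rw [e]
  rw [integral_const_mul, h]
  rw [← mul_assoc]
  have : (((2 * π) ^ (-(n:ℝ)/2) : ℝ) : ℂ) * (π / (1 / 2)) ^ ((n:ℂ) / 2) = 1 := by
    have : ((π : ℂ) / (1 / 2)) ^ ((n:ℂ) / 2) = (((2 * π) ^ ((n:ℝ)/2) : ℝ) : ℂ) := by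
      rw [Complex.ofReal_cpow (by positivity)]
      push_cast
      congr 1
      ring
    rw [this, ← Complex.ofReal_mul, ← Real.rpow_add (by positivity)]
    simp [neg_div]
  rw [this, one_mul]
  congr 1
  simp
  ring

lemma gam_marginal (n : ℕ) (w : EuclideanSpace ℝ (Fin n)) :
    (gam n).map (fun x => ⟪w, x⟫) = (gaussianReal 0 1).map (fun x => ‖w‖ * x) := by
  rw [gam_eq_std]
  have := IsGaussian.map_eq_gaussianReal (μ := stdGaussian (EuclideanSpace ℝ (Fin n))) (innerSL ℝ w)
  rw [variance_dual_stdGaussian, integral_strongDual_stdGaussian] at this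
  simp only [innerSL_apply_norm] at this
  rw [gaussianReal_map_const_mul]
  rw [show (fun x : EuclideanSpace ℝ (Fin n) => ⟪w, x⟫) = (innerSL ℝ w : EuclideanSpace ℝ (Fin n) → ℝ) from rfl,
    this]
  congr 1
  · simp
  · ext; simp

lemma gam_lintegral_inner (n : ℕ) (w : EuclideanSpace ℝ (Fin n)) (F : ℝ → ℝ≥0∞) (hF : Measurable F) :
    ∫⁻ x, F ⟪w, x⟫ ∂(gam n) = ∫⁻ x, F (‖w‖ * x) ∂(gaussianReal 0 1) := by
  rw [← lintegral_map (f := F) (g := fun x => ⟪w, x⟫) hF (by fun_prop), gam_marginal,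
    lintegral_map hF (by fun_prop)]

lemma lintegral_gauss1 (b : ℝ) (hb : 0 < b) (v : ℝ) :
    ∫⁻ x : ℝ, ENNReal.ofReal (Real.exp (-b * (x - v) ^ 2)) = ENNReal.ofReal (√(π / b)) := by
  rw [lintegral_sub_right_eq_self (fun x : ℝ => ENNReal.ofReal (Real.exp (-b * x ^ 2))) v]
  rw [← integral_gaussian b, ofReal_integral_eq_lintegral_ofReal]
  · exact integrable_exp_neg_mul_sq hb
  · exact ae_of_all _ fun x => (Real.exp_pos _).le

lemma std_lintegral (F : ℝ → ℝ≥0∞) (hF : Measurable F) :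
    ∫⁻ x, F x ∂(gaussianReal 0 1) = ∫⁻ x : ℝ, ENNReal.ofReal ((√(2 * π))⁻¹ * Real.exp (-x ^ 2 / 2)) * F x := by
  rw [gaussianReal_of_var_ne_zero _ (by norm_num), lintegral_withDensity_eq_lintegral_mul _ (measurable_gaussianPDF 0 1) hF]
  simp [gaussianPDF, gaussianPDFReal]

lemma gam_laplace (n : ℕ) (w : EuclideanSpace ℝ (Fin n)) (y : ℝ) :
    ∫⁻ x, ENNReal.ofReal (Real.exp (-(y - ⟪w, x⟫) ^ 2 / 2)) ∂(gam n) =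
      ENNReal.ofReal ((√(1 + ‖w‖ ^ 2))⁻¹ * Real.exp (- y ^ 2 / (2 * (1 + ‖w‖ ^ 2)))) := by
  rw [gam_lintegral_inner n w (fun z => ENNReal.ofReal (Real.exp (-(y - z) ^ 2 / 2))) (by fun_prop),
    std_lintegral _ (by fun_prop)]
  set s := 1 + ‖w‖ ^ 2 with hs
  have hs0 : 0 < s := by positivity
  have e : ∀ x : ℝ, ENNReal.ofReal ((√(2 * π))⁻¹ * Real.exp (-x ^ 2 / 2)) * ENNReal.ofReal (Real.exp (-(y - ‖w‖ * x) ^ 2 / 2))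
      = ENNReal.ofReal ((√(2 * π))⁻¹ * Real.exp (- y ^ 2 / (2 * s))) * ENNReal.ofReal (Real.exp (-(s / 2) * (x - y * ‖w‖ / s) ^ 2)) := by
    intro x
    rw [← ENNReal.ofReal_mul (by positivity), ← ENNReal.ofReal_mul (by positivity), mul_assoc, mul_assoc,
      ← Real.exp_add, ← Real.exp_add]
    congr 3
    have hw : ‖w‖ ^ 2 = s - 1 := by rw [hs]; ring
    field_simp
    ring_nf
    rw [hw]
    ring
  simp_rw [e]
  rw [lintegral_const_mul _ (by fun_prop), lintegral_gauss1 _ (by positivity), ← ENNReal.ofReal_mul (by positivity)]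
  congr 1
  rw [show π / (s / 2) = 2 * π * s⁻¹ by field_simp, Real.sqrt_mul (by positivity : 0 ≤ 2 * π) s⁻¹, Real.sqrt_inv]
  field_simp

lemma gam_exp_inner_sq (n : ℕ) (w : EuclideanSpace ℝ (Fin n)) (hw : ‖w‖ ≤ 1) :
    ∫⁻ x, ENNReal.ofReal (Real.exp (⟪w, x⟫ ^ 2 / 4)) ∂(gam n) ≤ ENNReal.ofReal (√2) := by
  rw [gam_lintegral_inner n w (fun z => ENNReal.ofReal (Real.exp (z ^ 2 / 4))) (by fun_prop),
    std_lintegral _ (by fun_prop)]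
  calc _ ≤ ∫⁻ x : ℝ, ENNReal.ofReal (√(2 * π))⁻¹ * ENNReal.ofReal (Real.exp (-(1 / 4) * (x - 0) ^ 2)) := by
        apply lintegral_mono
        intro x
        dsimp only
        rw [← ENNReal.ofReal_mul (by positivity), ← ENNReal.ofReal_mul (by positivity), mul_assoc,
          ← Real.exp_add]
        gcongr
        have : ‖w‖ ^ 2 ≤ 1 := by nlinarith [norm_nonneg w]
        nlinarith [sq_nonneg x]
    _ = _ := by
        rw [lintegral_const_mul _ (by fun_prop), lintegral_gauss1 _ (by positivity), ← ENNReal.ofReal_mul (by positivity)]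
        congr 1
        rw [show π / (1 / 4) = 2 * π * 2 by field_simp; norm_num, Real.sqrt_mul (by positivity : 0 ≤ 2 * π) 2]
        field_simp

lemma lintegral_pi_prod {V : Type*} [MeasurableSpace V] (γ : Measure V) [IsProbabilityMeasure γ] (k : ℕ)
    (F : V → ℝ≥0∞) (hF : Measurable F) :
    ∫⁻ x : Fin k → V, ∏ i, F (x i) ∂(Measure.pi fun _ => γ) = (∫⁻ x, F x ∂γ) ^ k := by
  induction k with
  | zero => simp
  | succ k ih =>
    have hp := (measurePreserving_piFinSuccAbove (fun _ : Fin (k + 1) => γ) 0).symm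
    rw [← hp.lintegral_comp (by fun_prop), lintegral_prod _ ?_]
    · have e : ∀ (x : V) (y : Fin k → V), ∏ i, F ((MeasurableEquiv.piFinSuccAbove (fun _ : Fin (k + 1) => V) 0).symm (x, y) i)
          = F x * ∏ i, F (y i) := by
        intro x y
        simp [Fin.prod_univ_succ, MeasurableEquiv.piFinSuccAbove]
      simp_rw [e]
      have : ∀ x : V, ∫⁻ y : Fin k → V, F x * ∏ i, F (y i) ∂(Measure.pi fun _ => γ) = F x * (∫⁻ x, F x ∂γ) ^ k := by
        intro x
        rw [lintegral_const_mul _ (by fun_prop), ih]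
      simp_rw [this]
      rw [lintegral_mul_const _ hF, pow_succ']
    · apply Measurable.aemeasurable
      exact Measurable.comp (g := fun x : Fin (k + 1) → V => ∏ i, F (x i)) (by fun_prop) hp.measurable


/-! ### A strengthened Prekopa-Leindler inequality for Gaussian measures -/

/-- Midpoint Prekopa-Leindler inequality with a quadratic gain. -/
def GPL {V : Type*} [AddCommGroup V] [Module ℝ V] [MeasurableSpace V] (γ : Measure V) (q : V → ℝ) : Prop :=
  ∀ F G H : V → ℝ≥0∞, Measurable F → Measurable G → Measurable H →
    (∀ x y, F x ^ (1 / 2 : ℝ) * G y ^ (1 / 2 : ℝ) ≤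
      ENNReal.ofReal (Real.exp (q (x - y) / 8)) * H ((1 / 2 : ℝ) • x + (1 / 2 : ℝ) • y)) →
    (∫⁻ x, F x ∂γ) ^ (1 / 2 : ℝ) * (∫⁻ x, G x ∂γ) ^ (1 / 2 : ℝ) ≤ ∫⁻ x, H x ∂γ

lemma gpl_gam (n : ℕ) : GPL (gam n) (fun x => ‖x‖ ^ 2) := by
  intro F G H hF hG hH h
  rw [gam, lintegral_withDensity_eq_lintegral_mul _ (gam_dens_meas n) hF,
    lintegral_withDensity_eq_lintegral_mul _ (gam_dens_meas n) hG,
    lintegral_withDensity_eq_lintegral_mul _ (gam_dens_meas n) hH]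
  have key := plprop_euclidean n (1 / 2) (by norm_num) (by norm_num) _ _ _ ((gam_dens_meas n).mul hF)
    ((gam_dens_meas n).mul hG) ((gam_dens_meas n).mul hH) ?_
  · norm_num at key ⊢
    exact key
  · intro x y
    rw [show (1 - 1 / 2 : ℝ) = 1 / 2 by norm_num]
    simp only [Pi.mul_apply]
    rw [ENNReal.mul_rpow_of_nonneg _ _ (by norm_num), ENNReal.mul_rpow_of_nonneg _ _ (by norm_num)]
    set K := (2 * π) ^ (-(n:ℝ)/2) with hK
    have hK0 : 0 < K := by positivity
    have e : ENNReal.ofReal (K * Real.exp (-‖x‖ ^ 2 / 2)) ^ (1 / 2 : ℝ) *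
        ENNReal.ofReal (K * Real.exp (-‖y‖ ^ 2 / 2)) ^ (1 / 2 : ℝ) *
        ENNReal.ofReal (Real.exp (‖x - y‖ ^ 2 / 8)) =
        ENNReal.ofReal (K * Real.exp (-‖(1 / 2 : ℝ) • x + (1 / 2 : ℝ) • y‖ ^ 2 / 2)) := by
      rw [← ENNReal.mul_rpow_of_nonneg _ _ (by norm_num), ← ENNReal.ofReal_mul (by positivity),
        ENNReal.ofReal_rpow_of_nonneg (by positivity) (by norm_num), ← ENNReal.ofReal_mul (by positivity)]
      congr 1
      rw [show K * Real.exp (-‖x‖ ^ 2 / 2) * (K * Real.exp (-‖y‖ ^ 2 / 2)) = (K * Real.exp (-‖x‖ ^ 2 / 4 + -‖y‖ ^ 2 / 4)) ^ 2 by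
        rw [mul_pow, ← Real.exp_nat_mul, mul_mul_mul_comm, ← Real.exp_add, ← sq]
        congr 2; push_cast; ring]
      rw [← Real.sqrt_eq_rpow, Real.sqrt_sq (by positivity), mul_assoc, ← Real.exp_add]
      congr 2
      rw [norm_add_sq_real, norm_sub_sq_real, norm_smul, norm_smul, inner_smul_left, inner_smul_right]
      simp
      ring
    calc _ = ENNReal.ofReal (K * Real.exp (-‖x‖ ^ 2 / 2)) ^ (1 / 2 : ℝ) *
        ENNReal.ofReal (K * Real.exp (-‖y‖ ^ 2 / 2)) ^ (1 / 2 : ℝ) * (F x ^ (1 / 2 : ℝ) * G y ^ (1 / 2 : ℝ)) := by ring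
      _ ≤ ENNReal.ofReal (K * Real.exp (-‖x‖ ^ 2 / 2)) ^ (1 / 2 : ℝ) *
        ENNReal.ofReal (K * Real.exp (-‖y‖ ^ 2 / 2)) ^ (1 / 2 : ℝ) *
          (ENNReal.ofReal (Real.exp (‖x - y‖ ^ 2 / 8)) * H ((1 / 2 : ℝ) • x + (1 / 2 : ℝ) • y)) := by
          exact mul_le_mul_right (h x y) _
      _ = _ := by rw [← mul_assoc, e]

lemma GPL.prod {V W : Type*} [AddCommGroup V] [Module ℝ V] [MeasurableSpace V] [AddCommGroup W]
    [Module ℝ W] [MeasurableSpace W] {γ : Measure V} {δ : Measure W} [SFinite δ] {q : V → ℝ} {r : W → ℝ}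
    (hV : GPL γ q) (hW : GPL δ r) : GPL (γ.prod δ) (fun p => q p.1 + r p.2) := by
  intro F G H hF hG hH h
  rw [lintegral_prod _ hF.aemeasurable, lintegral_prod _ hG.aemeasurable, lintegral_prod _ hH.aemeasurable]
  refine hV _ _ _ hF.lintegral_prod_right' hG.lintegral_prod_right' hH.lintegral_prod_right' ?_
  intro x y
  rw [← lintegral_const_mul _ (by fun_prop)]
  refine hW _ _ _ (by fun_prop) (by fun_prop) (by fun_prop) ?_
  intro a b
  refine (h (x, a) (y, b)).trans (le_of_eq ?_)
  simp only [Prod.fst_sub, Prod.snd_sub]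
  rw [add_div, Real.exp_add, ENNReal.ofReal_mul (by positivity)]
  simp only [Prod.smul_mk, Prod.mk_add_mk]
  ring

lemma GPL.pi {V : Type*} [AddCommGroup V] [Module ℝ V] [MeasurableSpace V] {γ : Measure V}
    [IsProbabilityMeasure γ] {q : V → ℝ} (hV : GPL γ q) (k : ℕ) :
    GPL (Measure.pi fun _ : Fin k => γ) (fun x => ∑ i, q (x i)) := by
  induction k with
  | zero =>
    intro F G H hF hG hH h
    rw [Measure.pi_of_empty, lintegral_dirac' _ hF, lintegral_dirac' _ hG, lintegral_dirac' _ hH]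
    refine (h _ _).trans (le_of_eq ?_)
    have e2 : ∀ x y : Fin 0 → V, H x = H y := fun x y => by rw [Subsingleton.elim x y]
    simp [e2 _ default]
  | succ k ih =>
    have hp := (measurePreserving_piFinSuccAbove (fun _ : Fin (k + 1) => γ) 0).symm
    intro F G H hF hG hH h
    rw [← hp.lintegral_comp hF, ← hp.lintegral_comp hG, ← hp.lintegral_comp hH]
    refine (hV.prod ih) _ _ _ (hF.comp hp.measurable) (hG.comp hp.measurable) (hH.comp hp.measurable) ?_
    intro x y
    refine (h _ _).trans (le_of_eq ?_)
    congr 2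
    · simp [Fin.sum_univ_succ, MeasurableEquiv.piFinSuccAbove]
    · congr 1
      ext i
      refine Fin.cases ?_ (fun j => ?_) i <;> simp [MeasurableEquiv.piFinSuccAbove]

lemma adj_norm_sq {n : ℕ} (B : EuclideanSpace ℝ (Fin n) →L[ℝ] EuclideanSpace ℝ (Fin n))
    (g : EuclideanSpace ℝ (Fin n)) :
    ‖ContinuousLinearMap.adjoint B g‖ ^ 2 = ∑ j, ⟪B (EuclideanSpace.basisFun (Fin n) ℝ j), g⟫ ^ 2 := by
  rw [← (EuclideanSpace.basisFun (Fin n) ℝ).sum_sq_norm_inner_right]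
  congr 1; ext j
  rw [ContinuousLinearMap.adjoint_inner_right, Real.norm_eq_abs, sq_abs]

lemma gam_exp_adj {n : ℕ} (B : EuclideanSpace ℝ (Fin n) →L[ℝ] EuclideanSpace ℝ (Fin n))
    (hB : ∑ j, ‖B (EuclideanSpace.basisFun (Fin n) ℝ j)‖ ^ 2 = 1) :
    ∫⁻ g, ENNReal.ofReal (Real.exp (‖ContinuousLinearMap.adjoint B g‖ ^ 2 / 4)) ∂(gam n) ≤ ENNReal.ofReal (√2) := by
  set b := fun j => B (EuclideanSpace.basisFun (Fin n) ℝ j) with hb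
  have pt : ∀ g : EuclideanSpace ℝ (Fin n), Real.exp (‖ContinuousLinearMap.adjoint B g‖ ^ 2 / 4) ≤
      ∑ j, ‖b j‖ ^ 2 * Real.exp (⟪(‖b j‖)⁻¹ • b j, g⟫ ^ 2 / 4) := by
    intro g
    have h := convexOn_exp.map_sum_le (t := Finset.univ) (w := fun j => ‖b j‖ ^ 2)
      (p := fun j => ⟪(‖b j‖)⁻¹ • b j, g⟫ ^ 2 / 4) (fun j _ => by positivity) hB (fun j _ => Set.mem_univ _)
    simp only [smul_eq_mul] at h
    refine le_trans (le_of_eq ?_) h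
    rw [adj_norm_sq, Finset.sum_div]
    congr 1
    refine Finset.sum_congr rfl fun j _ => ?_
    change ⟪b j, g⟫ ^ 2 / 4 = _
    by_cases hj : ‖b j‖ = 0
    · have : b j = 0 := by simpa using hj
      rw [this]; simp
    · rw [inner_smul_left]
      generalize b j = z at *
      simp only [conj_trivial]
      field_simp
  calc _ ≤ ∫⁻ g, ∑ j, ENNReal.ofReal (‖b j‖ ^ 2) * ENNReal.ofReal (Real.exp (⟪(‖b j‖)⁻¹ • b j, g⟫ ^ 2 / 4)) ∂(gam n) := by
        apply lintegral_mono
        intro g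
        refine (ENNReal.ofReal_le_ofReal (pt g)).trans (le_of_eq ?_)
        rw [ENNReal.ofReal_sum_of_nonneg (fun _ _ => by positivity)]
        refine Finset.sum_congr rfl fun j _ => ?_
        rw [ENNReal.ofReal_mul (by positivity)]
    _ = ∑ j, ENNReal.ofReal (‖b j‖ ^ 2) * ∫⁻ g, ENNReal.ofReal (Real.exp (⟪(‖b j‖)⁻¹ • b j, g⟫ ^ 2 / 4)) ∂(gam n) := by
        rw [lintegral_finsetSum _ (fun j _ => by fun_prop)]
        refine Finset.sum_congr rfl fun j _ => ?_
        rw [lintegral_const_mul _ (by fun_prop)]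
    _ ≤ ∑ j, ENNReal.ofReal (‖b j‖ ^ 2) * ENNReal.ofReal (√2) := by
        gcongr with j
        apply gam_exp_inner_sq
        rw [norm_smul, norm_inv, norm_norm]
        exact inv_mul_le_one
    _ = _ := by
        rw [← Finset.sum_mul, ← ENNReal.ofReal_sum_of_nonneg (fun _ _ => by positivity), hB]; simp

lemma gam_pi_tail {n : ℕ} (B : EuclideanSpace ℝ (Fin n) →L[ℝ] EuclideanSpace ℝ (Fin n))
    (hB : ∑ j, ‖B (EuclideanSpace.basisFun (Fin n) ℝ j)‖ ^ 2 = 1) (k : ℕ) (R : ℝ) :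
    (Measure.pi fun _ : Fin k => gam n) {Γ | R * k < ∑ i, ‖ContinuousLinearMap.adjoint B (Γ i)‖ ^ 2} ≤
      ENNReal.ofReal (Real.exp (-(R / 4 - 1 / 2) * k)) := by
  set F : EuclideanSpace ℝ (Fin n) → ℝ≥0∞ := fun g => ENNReal.ofReal (Real.exp (‖ContinuousLinearMap.adjoint B g‖ ^ 2 / 4)) with hF
  have mF : Measurable F := by fun_prop
  have h1 := lintegral_pi_prod (gam n) k F mF
  have h2 := mul_meas_ge_le_lintegral (μ := Measure.pi fun _ : Fin k => gam n) (f := fun Γ => ∏ i, F (Γ i)) (by fun_prop)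
    (ENNReal.ofReal (Real.exp (R / 4 * k)))
  rw [h1] at h2
  have h3 : (∫⁻ x, F x ∂(gam n)) ^ k ≤ ENNReal.ofReal (Real.exp (1 / 2 * k)) := by
    calc _ ≤ ENNReal.ofReal (√2) ^ k := by gcongr; exact gam_exp_adj B hB
      _ = ENNReal.ofReal ((√2) ^ k) := by rw [ENNReal.ofReal_pow (by positivity)]
      _ ≤ _ := by
        apply ENNReal.ofReal_le_ofReal
        rw [mul_comm, Real.exp_nat_mul]
        gcongr
        rw [Real.sqrt_le_left (by positivity), ← Real.exp_nat_mul]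
        norm_num
        linarith [Real.exp_one_gt_d9]
  have h4 : ENNReal.ofReal (Real.exp (-(R / 4) * k)) * ENNReal.ofReal (Real.exp (R / 4 * k)) = 1 := by
    rw [← ENNReal.ofReal_mul (by positivity), ← Real.exp_add]
    simp
  calc _ ≤ (Measure.pi fun _ : Fin k => gam n) {Γ | ENNReal.ofReal (Real.exp (R / 4 * k)) ≤ ∏ i, F (Γ i)} := by
        apply measure_mono
        intro Γ hΓ
        simp only [Set.mem_ofPred_eq] at *
        rw [hF]
        simp only
        rw [← ENNReal.ofReal_prod_of_nonneg (fun _ _ => by positivity), ← Real.exp_sum, ← Finset.sum_div]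
        gcongr
        linarith
    _ = ENNReal.ofReal (Real.exp (-(R / 4) * k)) * (ENNReal.ofReal (Real.exp (R / 4 * k)) *
          (Measure.pi fun _ : Fin k => gam n) {Γ | ENNReal.ofReal (Real.exp (R / 4 * k)) ≤ ∏ i, F (Γ i)}) := by
        rw [← mul_assoc, h4, one_mul]
    _ ≤ ENNReal.ofReal (Real.exp (-(R / 4) * k)) * ENNReal.ofReal (Real.exp (1 / 2 * k)) := by
        gcongr; exact h2.trans h3
    _ = _ := by
        rw [← ENNReal.ofReal_mul (by positivity), ← Real.exp_add]
        congr 2; ring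


/-! ### The localized partition function -/

/-- Euclidean space. -/
abbrev EE (n : ℕ) := EuclideanSpace ℝ (Fin n)

/-- The quadratic energy. -/
def UU {n k : ℕ} (B : EE n →L[ℝ] EE n) (Γ : Fin k → EE n) (y : ℝ) (x : EE n) : ℝ :=
  ∑ i, (y - ⟪Γ i, B x⟫) ^ 2

/-- The partition function. -/
def ZZ {n k : ℕ} (μ : Measure (EE n)) (B : EE n →L[ℝ] EE n) (Γ : Fin k → EE n) (y : ℝ) : ℝ≥0∞ :=
  ∫⁻ x, ENNReal.ofReal (Real.exp (-(UU B Γ y x / 2))) ∂μ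

/-- The quadratic form on Gaussian tuples. -/
def QQ {n k : ℕ} (B : EE n →L[ℝ] EE n) (Γ : Fin k → EE n) : ℝ :=
  ∑ i, ‖ContinuousLinearMap.adjoint B (Γ i)‖ ^ 2

lemma UU_meas {n k : ℕ} (B : EE n →L[ℝ] EE n) (Γ : Fin k → EE n) (y : ℝ) :
    Measurable (UU B Γ y) := by unfold UU; fun_prop

lemma UU_nonneg {n k : ℕ} (B : EE n →L[ℝ] EE n) (Γ : Fin k → EE n) (y : ℝ) (x : EE n) :
    0 ≤ UU B Γ y x := Finset.sum_nonneg fun _ _ => sq_nonneg _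

lemma UU_meas' {n k : ℕ} (B : EE n →L[ℝ] EE n) (y : ℝ) :
    Measurable (fun p : (Fin k → EE n) × EE n => UU B p.1 y p.2) := by unfold UU; fun_prop

lemma ZZ_meas {n k : ℕ} (μ : Measure (EE n)) [SFinite μ] (B : EE n →L[ℝ] EE n) (y : ℝ) :
    Measurable (fun Γ : Fin k → EE n => ZZ μ B Γ y) := by
  unfold ZZ
  apply Measurable.lintegral_prod_right'
    (f := fun p : (Fin k → EE n) × EE n => ENNReal.ofReal (Real.exp (-(UU B p.1 y p.2 / 2))))
  have := UU_meas' (k := k) B y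
  fun_prop

lemma ZZ_le_one {n k : ℕ} (μ : Measure (EE n)) [IsProbabilityMeasure μ] (B : EE n →L[ℝ] EE n)
    (Γ : Fin k → EE n) (y : ℝ) : ZZ μ B Γ y ≤ 1 := by
  unfold ZZ
  calc _ ≤ ∫⁻ _, 1 ∂μ := by
        apply lintegral_mono
        intro x
        have := UU_nonneg B Γ y x
        simp only [ENNReal.ofReal_le_one, Real.exp_le_one_iff]
        linarith
    _ = 1 := by simp

lemma jensen_low {V : Type*} [MeasurableSpace V] (μ : Measure V) (g w : V → ℝ) (hg : Measurable g)
    (hw : Measurable w) (g0 : ∀ x, 0 ≤ g x) (w0 : ∀ x, 0 ≤ w x) (m : ℝ) (hm : 0 ≤ m)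
    (hfin : ∫⁻ x, ENNReal.ofReal (g x) ∂μ ≠ ⊤)
    (h : ∫⁻ x, ENNReal.ofReal (w x * g x) ∂μ ≤ ENNReal.ofReal m * ∫⁻ x, ENNReal.ofReal (g x) ∂μ) :
    ENNReal.ofReal (Real.exp (-m)) * ∫⁻ x, ENNReal.ofReal (g x) ∂μ ≤
      ∫⁻ x, ENNReal.ofReal (Real.exp (-w x) * g x) ∂μ := by
  set I := ∫⁻ x, ENNReal.ofReal (g x) ∂μ with hI
  have pt : ∀ x, ENNReal.ofReal (Real.exp (-m)) * ENNReal.ofReal (g x) +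
      ENNReal.ofReal (Real.exp (-m) * m) * ENNReal.ofReal (g x) ≤
      ENNReal.ofReal (Real.exp (-w x) * g x) + ENNReal.ofReal (Real.exp (-m)) * ENNReal.ofReal (w x * g x) := by
    intro x
    have := g0 x
    have := w0 x
    rw [← ENNReal.ofReal_mul (by positivity), ← ENNReal.ofReal_mul (by positivity),
      ← ENNReal.ofReal_mul (by positivity), ← ENNReal.ofReal_add (by positivity) (by positivity),
      ← ENNReal.ofReal_add (by positivity) (by positivity)]
    apply ENNReal.ofReal_le_ofReal
    have e : Real.exp (-m) * (1 + m - w x) ≤ Real.exp (-w x) := by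
      have h1 : 1 + m - w x ≤ Real.exp (m - w x) := by linarith [Real.add_one_le_exp (m - w x)]
      calc _ ≤ Real.exp (-m) * Real.exp (m - w x) := by gcongr
        _ = _ := by rw [← Real.exp_add]; congr 1; ring
    nlinarith
  have h2 := lintegral_mono (μ := μ) pt
  rw [lintegral_add_left (by fun_prop), lintegral_add_left (by fun_prop), lintegral_const_mul _ (by fun_prop),
    lintegral_const_mul _ (by fun_prop), lintegral_const_mul _ (by fun_prop), ← hI] at h2
  have h3 : ENNReal.ofReal (Real.exp (-m)) * I + ENNReal.ofReal (Real.exp (-m) * m) * I ≤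
      ∫⁻ x, ENNReal.ofReal (Real.exp (-w x) * g x) ∂μ + ENNReal.ofReal (Real.exp (-m) * m) * I := by
    refine h2.trans ?_
    refine add_le_add le_rfl ?_
    rw [ENNReal.ofReal_mul (by positivity), mul_assoc]
    exact mul_le_mul_right h _
  exact (ENNReal.add_le_add_iff_right (ENNReal.mul_ne_top (by simp) hfin)).1 h3

section Zest
variable {n k : ℕ} (μ : Measure (EE n)) [IsProbabilityMeasure μ] (B : EE n →L[ℝ] EE n)

lemma UU_mean (hiso : ∀ θ : EE n, ∫⁻ x, ENNReal.ofReal (⟪x, θ⟫ ^ 2) ∂μ = ENNReal.ofReal (‖θ‖ ^ 2))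
    (Γ : Fin k → EE n) (y : ℝ) :
    ∫⁻ x, ENNReal.ofReal (UU B Γ y x) ∂μ ≤ ENNReal.ofReal (2 * k * y ^ 2 + 2 * QQ B Γ) := by
  calc _ ≤ ∫⁻ x, (ENNReal.ofReal (2 * k * y ^ 2) + ∑ i, ENNReal.ofReal 2 *
        ENNReal.ofReal (⟪x, ContinuousLinearMap.adjoint B (Γ i)⟫ ^ 2)) ∂μ := by
        apply lintegral_mono
        intro x
        simp_rw [← ENNReal.ofReal_mul (show (0:ℝ) ≤ 2 by norm_num)]
        rw [← ENNReal.ofReal_sum_of_nonneg (fun _ _ => by positivity), ← ENNReal.ofReal_add (by positivity)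
          (Finset.sum_nonneg fun _ _ => by positivity)]
        apply ENNReal.ofReal_le_ofReal
        have : (2 * k * y ^ 2 : ℝ) = ∑ i : Fin k, 2 * y ^ 2 := by simp; ring
        rw [this, ← Finset.sum_add_distrib]
        apply Finset.sum_le_sum
        intro i _
        rw [ContinuousLinearMap.adjoint_inner_right, real_inner_comm]
        nlinarith [sq_nonneg (y + ⟪B x, Γ i⟫)]
    _ = _ := by
        rw [lintegral_add_left (by fun_prop), lintegral_finsetSum _ (fun _ _ => by fun_prop)]
        simp_rw [lintegral_const_mul' _ _ ENNReal.ofReal_ne_top, hiso]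
        simp only [lintegral_const, measure_univ, mul_one]
        simp_rw [← ENNReal.ofReal_mul (show (0:ℝ) ≤ 2 by norm_num)]
        rw [← ENNReal.ofReal_sum_of_nonneg (fun _ _ => by positivity), ← ENNReal.ofReal_add (by positivity)
          (Finset.sum_nonneg fun _ _ => by positivity), ← Finset.mul_sum, QQ]

lemma ZZ_lower (hiso : ∀ θ : EE n, ∫⁻ x, ENNReal.ofReal (⟪x, θ⟫ ^ 2) ∂μ = ENNReal.ofReal (‖θ‖ ^ 2))
    (Γ : Fin k → EE n) (y m : ℝ) (hm : k * y ^ 2 + QQ B Γ ≤ m) (hm0 : 0 ≤ m) :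
    ENNReal.ofReal (Real.exp (-m)) ≤ ZZ μ B Γ y := by
  have hU := UU_meas B Γ y
  have h := jensen_low μ (fun _ => 1) (fun x => UU B Γ y x / 2) measurable_const (by fun_prop) (by simp)
    (fun x => by have := UU_nonneg B Γ y x; positivity) m hm0 (by simp) ?_
  · simpa [ZZ] using h
  · simp only [mul_one, ENNReal.ofReal_one, lintegral_const, measure_univ]
    have e : ∀ x, ENNReal.ofReal (UU B Γ y x / 2) = ENNReal.ofReal (1 / 2) * ENNReal.ofReal (UU B Γ y x) := by
      intro x
      rw [← ENNReal.ofReal_mul (by norm_num)]; congr 1; ring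
    simp_rw [e]
    rw [lintegral_const_mul _ (by fun_prop)]
    calc _ ≤ ENNReal.ofReal (1 / 2) * ENNReal.ofReal (2 * k * y ^ 2 + 2 * QQ B Γ) := by
          gcongr; exact UU_mean μ B hiso Γ y
      _ ≤ _ := by
          rw [← ENNReal.ofReal_mul (by norm_num)]
          apply ENNReal.ofReal_le_ofReal; linarith

lemma ZZ_u (Γ : Fin k → EE n) (y m : ℝ) (hm : 1 ≤ m) (hZ : ENNReal.ofReal (Real.exp (-m)) ≤ ZZ μ B Γ y) :
    ∫⁻ x, ENNReal.ofReal (UU B Γ y x * Real.exp (-(UU B Γ y x / 2))) ∂μ ≤ ENNReal.ofReal (5 * m) * ZZ μ B Γ y := by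
  have hU := UU_meas B Γ y
  have pt : ∀ u : ℝ, 0 ≤ u → u * Real.exp (-(u / 2)) ≤ 4 * m * Real.exp (-(u / 2)) + Real.exp (-(2 * m)) := by
    intro u hu
    have h1 : (u - 4 * m) ≤ Real.exp ((u - 4 * m) / 2) := by
      have := Real.quadratic_le_exp_of_nonneg (x := (u - 4 * m) / 2)
      rcases le_total 0 ((u - 4 * m) / 2) with h | h
      · have := this h; nlinarith [sq_nonneg ((u - 4 * m) / 2 - 1)]
      · have := Real.exp_pos ((u - 4 * m) / 2); linarith
    have h2 : Real.exp (-(2 * m)) = Real.exp ((u - 4 * m) / 2) * Real.exp (-(u / 2)) := by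
      rw [← Real.exp_add]; congr 1; ring
    rw [h2]
    nlinarith [Real.exp_pos (-(u / 2))]
  calc _ ≤ ∫⁻ x, (ENNReal.ofReal (4 * m) * ENNReal.ofReal (Real.exp (-(UU B Γ y x / 2))) +
        ENNReal.ofReal (Real.exp (-(2 * m)))) ∂μ := by
        apply lintegral_mono
        intro x
        dsimp only
        rw [← ENNReal.ofReal_mul (by positivity), ← ENNReal.ofReal_add (by positivity) (by positivity)]
        exact ENNReal.ofReal_le_ofReal (pt _ (UU_nonneg B Γ y x))
    _ = ENNReal.ofReal (4 * m) * ZZ μ B Γ y + ENNReal.ofReal (Real.exp (-(2 * m))) := by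
        rw [lintegral_add_left (by fun_prop), lintegral_const_mul _ (by fun_prop)]
        simp [ZZ]
    _ ≤ ENNReal.ofReal (4 * m) * ZZ μ B Γ y + ENNReal.ofReal m * ZZ μ B Γ y := by
        gcongr
        calc ENNReal.ofReal (Real.exp (-(2 * m))) ≤ ENNReal.ofReal (Real.exp (-m)) := by
              gcongr; linarith
          _ ≤ ZZ μ B Γ y := hZ
          _ ≤ _ := by
              calc ZZ μ B Γ y = 1 * ZZ μ B Γ y := (one_mul _).symm
                _ ≤ _ := by gcongr; simpa using hm
    _ = _ := by
        rw [← add_mul, ← ENNReal.ofReal_add (by positivity) (by positivity)]; congr 2; ring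

lemma ZZ_moment {α b : ℝ} (hb : 0 < b)
    (hpsi : ∀ p : ℝ, 2 ≤ p → ∀ θ : EE n, ∫⁻ x, ENNReal.ofReal (|⟪x, θ⟫| ^ p) ∂μ ≤
      ENNReal.ofReal ((b * p ^ (1 / α) * ‖θ‖) ^ p))
    (Γ : Fin k → EE n) (y m : ℝ) (hm : 1 ≤ m) (hZ : ENNReal.ofReal (Real.exp (-m)) ≤ ZZ μ B Γ y) (θ : EE n) :
    ∫⁻ x, ENNReal.ofReal (⟪x, θ⟫ ^ 2 * Real.exp (-(UU B Γ y x / 2))) ∂μ ≤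
      ENNReal.ofReal (2 * (Real.exp 1 * (b * (2 * m) ^ (1 / α) * ‖θ‖)) ^ 2) * ZZ μ B Γ y := by
  have hU := UU_meas B Γ y
  by_cases hθ : θ = 0
  · simp [hθ]
  have hθ0 : 0 < ‖θ‖ := norm_pos_iff.2 hθ
  set κ₀ := b * (2 * m) ^ (1 / α) * ‖θ‖ with hκ₀
  have hκ₀p : 0 < κ₀ := by positivity
  set κ := Real.exp 1 * κ₀ with hκ
  have hκp : 0 < κ := by positivity
  have pt : ∀ s : ℝ, 0 ≤ s → s ^ 2 ≤ κ ^ 2 + s ^ (2 * m) * κ ^ (2 - 2 * m) := by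
    intro s hs
    rcases le_total s κ with h | h
    · have : s ^ 2 ≤ κ ^ 2 := by gcongr
      have : 0 ≤ s ^ (2 * m) * κ ^ (2 - 2 * m) := by positivity
      linarith
    · have hs0 : 0 < s := by linarith
      have h1 : s ^ (2 * m) * κ ^ (2 - 2 * m) = s ^ 2 * (s / κ) ^ (2 * m - 2) := by
        rw [Real.div_rpow hs0.le hκp.le, show (2 * m) = 2 + (2 * m - 2) by ring, Real.rpow_add hs0,
          show (2 - (2 + (2 * m - 2))) = -(2 * m - 2) by ring, Real.rpow_neg hκp.le,
          show 2 + (2 * m - 2) - 2 = 2 * m - 2 by ring]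
        rw [Real.rpow_two]
        ring
      have h2 : 1 ≤ (s / κ) ^ (2 * m - 2) := by
        apply Real.one_le_rpow
        · rw [le_div_iff₀ hκp]; linarith
        · linarith
      rw [h1]
      nlinarith [sq_nonneg s, sq_nonneg κ]
  have hp := hpsi (2 * m) (by linarith) θ
  calc _ ≤ ∫⁻ x, (ENNReal.ofReal (κ ^ 2) * ENNReal.ofReal (Real.exp (-(UU B Γ y x / 2))) +
        ENNReal.ofReal (κ ^ (2 - 2 * m)) * ENNReal.ofReal (|⟪x, θ⟫| ^ (2 * m))) ∂μ := by
        apply lintegral_mono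
        intro x
        dsimp only
        rw [← ENNReal.ofReal_mul (by positivity), ← ENNReal.ofReal_mul (by positivity),
          ← ENNReal.ofReal_add (by positivity) (by positivity)]
        apply ENNReal.ofReal_le_ofReal
        have h1 := pt |⟪x, θ⟫| (abs_nonneg _)
        rw [sq_abs] at h1
        have h2 : Real.exp (-(UU B Γ y x / 2)) ≤ 1 := by
          rw [Real.exp_le_one_iff]; linarith [UU_nonneg B Γ y x]
        have h3 := Real.exp_pos (-(UU B Γ y x / 2))
        have h4 : 0 ≤ |⟪x, θ⟫| ^ (2 * m) * κ ^ (2 - 2 * m) := by positivity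
        nlinarith
    _ = ENNReal.ofReal (κ ^ 2) * ZZ μ B Γ y + ENNReal.ofReal (κ ^ (2 - 2 * m)) *
        ∫⁻ x, ENNReal.ofReal (|⟪x, θ⟫| ^ (2 * m)) ∂μ := by
        rw [lintegral_add_left (by fun_prop), lintegral_const_mul _ (by fun_prop),
          lintegral_const_mul _ (by fun_prop), ZZ]
    _ ≤ ENNReal.ofReal (κ ^ 2) * ZZ μ B Γ y + ENNReal.ofReal (κ ^ 2) * ZZ μ B Γ y := by
        refine add_le_add le_rfl ?_
        calc _ ≤ ENNReal.ofReal (κ ^ (2 - 2 * m)) * ENNReal.ofReal (κ₀ ^ (2 * m)) := by gcongr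
          _ = ENNReal.ofReal (κ ^ 2) * ENNReal.ofReal (Real.exp (-(2 * m))) := by
              rw [← ENNReal.ofReal_mul (by positivity), ← ENNReal.ofReal_mul (by positivity)]
              congr 1
              have e1 : κ₀ = κ * Real.exp (-1) := by
                rw [hκ, mul_comm, ← mul_assoc, ← Real.exp_add]; simp
              rw [e1, Real.mul_rpow hκp.le (by positivity), ← Real.exp_mul, ← mul_assoc, ← Real.rpow_add hκp]
              norm_num
          _ ≤ _ := by
              gcongr
              refine le_trans ?_ hZ
              gcongr; linarith
    _ = _ := by
        rw [← add_mul, ← ENNReal.ofReal_add (by positivity) (by positivity)]; congr 2; ring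

end Zest


section Pert
set_option linter.unusedSectionVars false
variable {n k : ℕ} (μ : Measure (EE n)) [IsProbabilityMeasure μ] (B : EE n →L[ℝ] EE n)

lemma ZZ_perturb {α b : ℝ} (hb : 0 < b)
    (hiso : ∀ θ : EE n, ∫⁻ x, ENNReal.ofReal (⟪x, θ⟫ ^ 2) ∂μ = ENNReal.ofReal (‖θ‖ ^ 2))
    (hpsi : ∀ p : ℝ, 2 ≤ p → ∀ θ : EE n, ∫⁻ x, ENNReal.ofReal (|⟪x, θ⟫| ^ p) ∂μ ≤
      ENNReal.ofReal ((b * p ^ (1 / α) * ‖θ‖) ^ p))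
    (Γ D : Fin k → EE n) (y m ε : ℝ) (hm : 1 ≤ m) (hmZ : k * y ^ 2 + QQ B Γ ≤ m)
    (hε0 : 0 < ε) (hε1 : ε ≤ 1)
    (hL : 4 * (Real.exp 1 * (b * (2 * m) ^ (1 / α) * ‖B‖)) ^ 2 ≤ ε) :
    ZZ μ B Γ y ≤ ENNReal.ofReal (Real.exp (3 * m * ε + (∑ i, ‖D i‖ ^ 2) / 2)) *
      ZZ μ B (fun i => Γ i + D i) y := by
  have hZ := ZZ_lower μ B hiso Γ y m hmZ (by linarith)
  have hU := UU_meas B Γ y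
  set d2 := ∑ i, ‖D i‖ ^ 2 with hd2
  have hd0 : 0 ≤ d2 := by positivity
  set v : EE n → ℝ := fun x => ∑ i, ⟪D i, B x⟫ ^ 2 with hv
  have hvm : Measurable v := by rw [hv]; fun_prop
  have hv0 : ∀ x, 0 ≤ v x := fun x => Finset.sum_nonneg fun _ _ => sq_nonneg _
  set g : EE n → ℝ := fun x => Real.exp (-(UU B Γ y x / 2)) with hg
  have hgm : Measurable g := by rw [hg]; fun_prop
  have hg0 : ∀ x, 0 < g x := fun x => Real.exp_pos _
  set L0 := 2 * (Real.exp 1 * (b * (2 * m) ^ (1 / α) * ‖B‖)) ^ 2 with hL0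
  have hL00 : 0 ≤ L0 := by positivity
  have hIv : ∫⁻ x, ENNReal.ofReal (v x * g x) ∂μ ≤ ENNReal.ofReal (L0 * d2) * ZZ μ B Γ y := by
    calc _ = ∑ i, ∫⁻ x, ENNReal.ofReal (⟪x, ContinuousLinearMap.adjoint B (D i)⟫ ^ 2 * g x) ∂μ := by
          rw [← lintegral_finsetSum _ (fun _ _ => by fun_prop)]
          apply lintegral_congr
          intro x
          rw [← ENNReal.ofReal_sum_of_nonneg (fun _ _ => mul_nonneg (sq_nonneg _) (hg0 x).le), ← Finset.sum_mul]
          congr 2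
          apply Finset.sum_congr rfl
          intro i _
          rw [ContinuousLinearMap.adjoint_inner_right, real_inner_comm]
      _ ≤ ∑ i, ENNReal.ofReal (L0 * ‖D i‖ ^ 2) * ZZ μ B Γ y := by
          apply Finset.sum_le_sum
          intro i _
          refine (ZZ_moment μ B hb hpsi Γ y m hm hZ _).trans ?_
          refine mul_le_mul' (ENNReal.ofReal_le_ofReal ?_) le_rfl
          have h1 : ‖ContinuousLinearMap.adjoint B (D i)‖ ≤ ‖B‖ * ‖D i‖ := by
            have := (ContinuousLinearMap.adjoint B).le_opNorm (D i)
            rwa [LinearIsometryEquiv.norm_map] at this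
          have h2 : ‖ContinuousLinearMap.adjoint B (D i)‖ ^ 2 ≤ (‖B‖ * ‖D i‖) ^ 2 := by gcongr
          have h3 : 0 ≤ 2 * (Real.exp 1 * (b * (2 * m) ^ (1 / α))) ^ 2 := by positivity
          rw [hL0]
          nlinarith [mul_le_mul_of_nonneg_left h2 h3]
      _ = _ := by
          rw [← Finset.sum_mul, ← ENNReal.ofReal_sum_of_nonneg (fun _ _ => by positivity), ← Finset.mul_sum]
  have hj := jensen_low μ g (fun x => (ε / 2) * UU B Γ y x + ((1 + 1 / ε) / 2) * v x) hgm (by fun_prop)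
    (fun x => (hg0 x).le) (fun x => by have := UU_nonneg B Γ y x; have := hv0 x; positivity)
    (3 * m * ε + d2 / 2) (by positivity)
    (by
      have := (ZZ_le_one μ B Γ y).trans_lt ENNReal.one_lt_top
      exact this.ne) ?_
  · have hZg : ∫⁻ x, ENNReal.ofReal (g x) ∂μ = ZZ μ B Γ y := rfl
    rw [hZg] at hj
    have h1 : ∫⁻ x, ENNReal.ofReal (Real.exp (-((ε / 2) * UU B Γ y x + ((1 + 1 / ε) / 2) * v x)) * g x) ∂μ
        ≤ ZZ μ B (fun i => Γ i + D i) y := by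
      apply lintegral_mono
      intro x
      apply ENNReal.ofReal_le_ofReal
      rw [hg, ← Real.exp_add]
      apply Real.exp_le_exp.2
      have : UU B (fun i => Γ i + D i) y x ≤ (1 + ε) * UU B Γ y x + (1 + 1 / ε) * v x := by
        unfold UU
        rw [hv, Finset.mul_sum, Finset.mul_sum, ← Finset.sum_add_distrib]
        apply Finset.sum_le_sum
        intro i _
        rw [inner_add_left]
        set a := y - ⟪Γ i, B x⟫
        set c := ⟪D i, B x⟫
        have : y - (⟪Γ i, B x⟫ + c) = a - c := by ring
        rw [this]
        have h4 : (1 + ε) * a ^ 2 + (1 + 1 / ε) * c ^ 2 - (a - c) ^ 2 = (ε * a + c) ^ 2 / ε := by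
          field_simp; ring
        have h5 : 0 ≤ (ε * a + c) ^ 2 / ε := by positivity
        linarith
      linarith
    calc ZZ μ B Γ y = ENNReal.ofReal (Real.exp (3 * m * ε + d2 / 2)) *
          (ENNReal.ofReal (Real.exp (-(3 * m * ε + d2 / 2))) * ZZ μ B Γ y) := by
          rw [← mul_assoc, ← ENNReal.ofReal_mul (by positivity), ← Real.exp_add]; simp
      _ ≤ _ := mul_le_mul_right (hj.trans h1) _
  · calc _ = ENNReal.ofReal (ε / 2) * ∫⁻ x, ENNReal.ofReal (UU B Γ y x * g x) ∂μ +
          ENNReal.ofReal ((1 + 1 / ε) / 2) * ∫⁻ x, ENNReal.ofReal (v x * g x) ∂μ := by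
          rw [← lintegral_const_mul _ (by fun_prop), ← lintegral_const_mul _ (by fun_prop),
            ← lintegral_add_left (by fun_prop)]
          apply lintegral_congr
          intro x
          have := UU_nonneg B Γ y x; have := hv0 x; have := (hg0 x).le
          rw [← ENNReal.ofReal_mul (by positivity), ← ENNReal.ofReal_mul (by positivity),
            ← ENNReal.ofReal_add (by positivity) (by positivity)]
          congr 1; ring
      _ ≤ ENNReal.ofReal (ε / 2) * (ENNReal.ofReal (5 * m) * ZZ μ B Γ y) +
          ENNReal.ofReal ((1 + 1 / ε) / 2) * (ENNReal.ofReal (L0 * d2) * ZZ μ B Γ y) :=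
          add_le_add (mul_le_mul_right (ZZ_u μ B Γ y m hm hZ) _) (mul_le_mul_right hIv _)
      _ = ENNReal.ofReal (ε / 2 * (5 * m) + (1 + 1 / ε) / 2 * (L0 * d2)) * ZZ μ B Γ y := by
          rw [← mul_assoc, ← mul_assoc, ← add_mul, ← ENNReal.ofReal_mul (by positivity),
            ← ENNReal.ofReal_mul (by positivity), ← ENNReal.ofReal_add (by positivity) (by positivity)]
      _ ≤ _ := by
          refine mul_le_mul' (ENNReal.ofReal_le_ofReal ?_) le_rfl
          have h1 : 1 + 1 / ε ≤ 2 / ε := by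
            rw [le_div_iff₀ hε0]; field_simp; linarith
          have h2 : (1 + 1 / ε) / 2 * (L0 * d2) ≤ d2 / 2 := by
            calc _ ≤ (2 / ε) / 2 * ((ε / 2) * d2) := by
                  gcongr
                  linarith
              _ = _ := by field_simp
          nlinarith [mul_pos hε0 (show 0 < m by linarith)]

lemma ZZ_mid (hpl : PLmeas μ) (Γ : Fin k → EE n) (y1 y2 : ℝ) :
    (ZZ μ B Γ y1) ^ (1/2 : ℝ) * (ZZ μ B Γ y2) ^ (1/2 : ℝ) ≤ ZZ μ B Γ ((y1 + y2) / 2) := by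
  have hU := UU_meas B Γ
  have h := hpl (1/2) (by norm_num) (by norm_num)
    (fun x => ENNReal.ofReal (Real.exp (-(UU B Γ y1 x / 2))))
    (fun x => ENNReal.ofReal (Real.exp (-(UU B Γ y2 x / 2))))
    (fun x => ENNReal.ofReal (Real.exp (-(UU B Γ ((y1 + y2) / 2) x / 2))))
    (by have := hU y1; fun_prop) (by have := hU y2; fun_prop)
    (by have := hU ((y1 + y2) / 2); fun_prop) ?_
  · norm_num at h ⊢
    exact h
  · intro x y
    rw [ENNReal.ofReal_rpow_of_pos (Real.exp_pos _), ENNReal.ofReal_rpow_of_pos (Real.exp_pos _),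
      ← ENNReal.ofReal_mul (by positivity), ← Real.exp_mul, ← Real.exp_mul, ← Real.exp_add]
    apply ENNReal.ofReal_le_ofReal
    apply Real.exp_le_exp.2
    have : UU B Γ ((y1 + y2) / 2) ((1 - 1 / 2 : ℝ) • x + (1 / 2 : ℝ) • y) ≤
        (UU B Γ y1 x + UU B Γ y2 y) / 2 := by
      unfold UU
      rw [← Finset.sum_add_distrib, Finset.sum_div]
      apply Finset.sum_le_sum
      intro i _
      rw [map_add, map_smul, map_smul, inner_add_right, inner_smul_right, inner_smul_right]
      nlinarith [sq_nonneg ((y1 - ⟪Γ i, B x⟫) - (y2 - ⟪Γ i, B y⟫))]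
    linarith

end Pert


/-- averaged partition function -/
def rho {n : ℕ} (k : ℕ) (μ : Measure (EE n)) (B : EE n →L[ℝ] EE n) (y : ℝ) : ℝ≥0∞ :=
  ∫⁻ Γ, ZZ μ B Γ y ∂(Measure.pi fun _ : Fin k => gam n)

section Rho
set_option linter.unusedSectionVars false
variable {n k : ℕ} (μ : Measure (EE n)) [IsProbabilityMeasure μ] (B : EE n →L[ℝ] EE n)

lemma rho_eq (y : ℝ) : rho k μ B y =
    ∫⁻ x, ENNReal.ofReal (((√(1+‖B x‖^2))⁻¹*Real.exp (-y^2/(2*(1+‖B x‖^2)))) ^ k) ∂μ := by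
  unfold rho ZZ
  have hm := UU_meas' (k := k) B y
  rw [lintegral_lintegral_swap (by
    have : Measurable fun p : (Fin k → EE n) × EE n => ENNReal.ofReal (Real.exp (-(UU B p.1 y p.2 / 2))) := by
      fun_prop
    exact this.aemeasurable)]
  apply lintegral_congr
  intro x
  have h1 : ∀ Γ : Fin k → EE n, ENNReal.ofReal (Real.exp (-(UU B Γ y x / 2))) =
      ∏ i, (fun g => ENNReal.ofReal (Real.exp (-(y - ⟪B x, g⟫)^2/2))) (Γ i) := by
    intro Γ
    dsimp only
    rw [← ENNReal.ofReal_prod_of_nonneg (fun _ _ => (Real.exp_pos _).le), ← Real.exp_sum]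
    congr 2
    rw [UU, Finset.sum_div, ← Finset.sum_neg_distrib]
    apply Finset.sum_congr rfl
    intro i _
    rw [real_inner_comm]; ring
  rw [lintegral_congr h1]
  refine (lintegral_pi_prod (gam n) k (fun g => ENNReal.ofReal (Real.exp (-(y - ⟪B x, g⟫)^2/2)))
    (by fun_prop)).trans ?_
  rw [gam_laplace, ENNReal.ofReal_pow (by positivity)]

lemma S3 {α b : ℝ} (hb : 0 < b) (hpl : PLmeas μ)
    (hiso : ∀ θ : EE n, ∫⁻ x, ENNReal.ofReal (⟪x, θ⟫ ^ 2) ∂μ = ENNReal.ofReal (‖θ‖ ^ 2))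
    (hpsi : ∀ p : ℝ, 2 ≤ p → ∀ θ : EE n, ∫⁻ x, ENNReal.ofReal (|⟪x, θ⟫| ^ p) ∂μ ≤
      ENNReal.ofReal ((b * p ^ (1 / α) * ‖θ‖) ^ p))
    (y1 y2 m ε R : ℝ) (hm : 1 ≤ m) (hm1 : k * y1 ^ 2 + R ≤ m) (hm2 : k * y2 ^ 2 + R ≤ m)
    (hε0 : 0 < ε) (hε1 : ε ≤ 1)
    (hL : 4 * (Real.exp 1 * (b * (2 * m) ^ (1 / α) * ‖B‖)) ^ 2 ≤ ε) :
    (∫⁻ Γ in {Γ | QQ B Γ ≤ R}, ZZ μ B Γ y1 ∂(Measure.pi fun _ : Fin k => gam n)) ^ (1/2 : ℝ) *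
    (∫⁻ Γ in {Γ | QQ B Γ ≤ R}, ZZ μ B Γ y2 ∂(Measure.pi fun _ : Fin k => gam n)) ^ (1/2 : ℝ) ≤
      ENNReal.ofReal (Real.exp (3 * m * ε)) * rho k μ B ((y1 + y2) / 2) := by
  have hZm := fun y => ZZ_meas (k := k) μ B y
  have hK : MeasurableSet {Γ : Fin k → EE n | QQ B Γ ≤ R} := by
    apply measurableSet_le _ measurable_const
    unfold QQ
    fun_prop
  rw [← lintegral_indicator hK, ← lintegral_indicator hK, rho, ← lintegral_const_mul _ (hZm _)]
  apply (gpl_gam n).pi k _ _ _ ((hZm _).indicator hK) ((hZm _).indicator hK) ((hZm _).const_mul _)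
  intro Γ₁ Γ₂
  by_cases h1 : Γ₁ ∈ {Γ : Fin k → EE n | QQ B Γ ≤ R}
  swap
  · rw [Set.indicator_of_notMem h1, ENNReal.zero_rpow_of_pos (by norm_num), zero_mul]; exact bot_le
  by_cases h2 : Γ₂ ∈ {Γ : Fin k → EE n | QQ B Γ ≤ R}
  swap
  · rw [Set.indicator_of_notMem h2, ENNReal.zero_rpow_of_pos (by norm_num), mul_zero]; exact bot_le
  rw [Set.indicator_of_mem h1, Set.indicator_of_mem h2]
  simp only [Set.mem_ofPred_eq] at h1 h2
  set Γm : Fin k → EE n := (1/2 : ℝ) • Γ₁ + (1/2 : ℝ) • Γ₂ with hΓm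
  set s := ∑ i, ‖(Γ₁ - Γ₂) i‖ ^ 2 with hs
  have key : ∀ (Γ D : Fin k → EE n) (y : ℝ), QQ B Γ ≤ R → k * y ^ 2 + R ≤ m →
      (fun i => Γ i + D i) = Γm → (∑ i, ‖D i‖ ^ 2) = s / 4 →
      (ZZ μ B Γ y) ^ (1/2 : ℝ) ≤ ENNReal.ofReal (Real.exp (3 * m * ε / 2 + s / 16)) * (ZZ μ B Γm y) ^ (1/2 : ℝ) := by
    intro Γ D y hQ hy hD hd
    have := ZZ_perturb μ B hb hiso hpsi Γ D y m ε hm (by linarith) hε0 hε1 hL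
    rw [hD, hd] at this
    calc _ ≤ (ENNReal.ofReal (Real.exp (3 * m * ε + s / 4 / 2)) * ZZ μ B Γm y) ^ (1/2 : ℝ) :=
          ENNReal.rpow_le_rpow this (by norm_num)
      _ = _ := by
          rw [ENNReal.mul_rpow_of_nonneg _ _ (by norm_num), ENNReal.ofReal_rpow_of_pos (Real.exp_pos _),
            ← Real.exp_mul]
          congr 3; ring
  have k1 := key Γ₁ (fun i => (1/2 : ℝ) • (Γ₂ i - Γ₁ i)) y1 h1 hm1
    (by
      funext i
      simp only [hΓm, Pi.add_apply, Pi.smul_apply, smul_sub]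
      module)
    (by
      rw [hs, Finset.sum_div]
      apply Finset.sum_congr rfl
      intro i _
      rw [norm_smul, Pi.sub_apply, norm_sub_rev, mul_pow]; norm_num; ring)
  have k2 := key Γ₂ (fun i => (1/2 : ℝ) • (Γ₁ i - Γ₂ i)) y2 h2 hm2
    (by
      funext i
      simp only [hΓm, Pi.add_apply, Pi.smul_apply, smul_sub]
      module)
    (by
      rw [hs, Finset.sum_div]
      apply Finset.sum_congr rfl
      intro i _
      rw [norm_smul, Pi.sub_apply, mul_pow]; norm_num; ring)
  refine (mul_le_mul' k1 k2).trans ?_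
  calc _ = (ENNReal.ofReal (Real.exp (s / 8)) * ENNReal.ofReal (Real.exp (3 * m * ε))) *
        ((ZZ μ B Γm y1) ^ (1/2 : ℝ) * (ZZ μ B Γm y2) ^ (1/2 : ℝ)) := by
        rw [mul_mul_mul_comm, ← ENNReal.ofReal_mul (by positivity), ← ENNReal.ofReal_mul (by positivity),
          ← Real.exp_add, ← Real.exp_add]
        congr 3; ring
    _ ≤ (ENNReal.ofReal (Real.exp (s / 8)) * ENNReal.ofReal (Real.exp (3 * m * ε))) *
        ZZ μ B Γm ((y1 + y2) / 2) := mul_le_mul_right (ZZ_mid μ B hpl Γm y1 y2) _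
    _ = _ := by rw [mul_assoc]

end Rho


/-- The constant `M`. -/
def MM : ℝ := 10 + 3 * Real.exp 8

lemma MM_ge : 10 ≤ MM := by unfold MM; linarith [Real.exp_pos 8]

section S8
set_option linter.unusedSectionVars false
variable {n k : ℕ} (μ : Measure (EE n)) [IsProbabilityMeasure μ] (B : EE n →L[ℝ] EE n)

lemma rho_lower (hN2 : ∫⁻ x, ENNReal.ofReal (‖B x‖ ^ 2) ∂μ ≤ 1) (y : ℝ) :
    ENNReal.ofReal (1 / 2 * Real.exp (-(k * (0.55 + y ^ 2 / 2)))) ≤ rho k μ B y := by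
  have hS : MeasurableSet {x : EE n | ‖B x‖ ^ 2 < 2} := measurableSet_lt (by fun_prop) measurable_const
  have h1 : μ {x : EE n | ‖B x‖ ^ 2 < 2}ᶜ ≤ ENNReal.ofReal (1/2) := by
    have := mul_meas_ge_le_lintegral (μ := μ) (f := fun x : EE n => ENNReal.ofReal (‖B x‖ ^ 2)) (by fun_prop)
      (ENNReal.ofReal 2)
    have e : {x : EE n | ENNReal.ofReal 2 ≤ ENNReal.ofReal (‖B x‖ ^ 2)} = {x : EE n | ‖B x‖ ^ 2 < 2}ᶜ := by
      ext x
      simp only [Set.mem_ofPred_eq, Set.mem_compl_iff, not_lt]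
      rw [ENNReal.ofReal_le_ofReal_iff (by positivity)]
    rw [e] at this
    have h2 := this.trans hN2
    calc _ = ENNReal.ofReal (1/2) * (ENNReal.ofReal 2 * μ {x : EE n | ‖B x‖ ^ 2 < 2}ᶜ) := by
          rw [← mul_assoc, ← ENNReal.ofReal_mul (by norm_num)]; norm_num
      _ ≤ ENNReal.ofReal (1/2) * 1 := mul_le_mul_right h2 _
      _ = _ := by simp
  have h2 : ENNReal.ofReal (1/2) ≤ μ {x : EE n | ‖B x‖ ^ 2 < 2} := by
    rw [prob_compl_eq_one_sub hS] at h1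
    have h3 : (1:ℝ≥0∞) ≤ ENNReal.ofReal (1/2) + μ {x : EE n | ‖B x‖ ^ 2 < 2} := tsub_le_iff_right.1 h1
    have h4 : (1:ℝ≥0∞) = ENNReal.ofReal (1/2) + ENNReal.ofReal (1/2) := by
      rw [← ENNReal.ofReal_add (by norm_num) (by norm_num)]; norm_num
    rw [h4] at h3
    exact (ENNReal.add_le_add_iff_left ENNReal.ofReal_ne_top).1 h3
  rw [rho_eq]
  calc _ = ENNReal.ofReal (Real.exp (-(k * (0.55 + y ^ 2 / 2)))) * ENNReal.ofReal (1/2) := by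
        rw [← ENNReal.ofReal_mul (by positivity), mul_comm]
    _ ≤ ENNReal.ofReal (Real.exp (-(k * (0.55 + y ^ 2 / 2)))) * μ {x : EE n | ‖B x‖ ^ 2 < 2} :=
        mul_le_mul_right h2 _
    _ = ∫⁻ x in {x : EE n | ‖B x‖ ^ 2 < 2}, ENNReal.ofReal (Real.exp (-(k * (0.55 + y ^ 2 / 2)))) ∂μ := by
        rw [setLIntegral_const]
    _ ≤ ∫⁻ x in {x : EE n | ‖B x‖ ^ 2 < 2}, ENNReal.ofReal (((√(1+‖B x‖^2))⁻¹*Real.exp (-y^2/(2*(1+‖B x‖^2)))) ^ k) ∂μ := by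
        apply setLIntegral_mono' hS
        intro x hx
        simp only [Set.mem_ofPred_eq] at hx
        apply ENNReal.ofReal_le_ofReal
        rw [show -((k:ℝ) * (0.55 + y ^ 2 / 2)) = k * (-0.55 + (- (y ^ 2 / 2))) by ring, Real.exp_nat_mul, Real.exp_add]
        gcongr
        · have e3 : √(1+‖B x‖^2) ≤ Real.exp 0.55 := by
            rw [Real.sqrt_le_left (by positivity), ← Real.exp_nat_mul]
            have := Real.quadratic_le_exp_of_nonneg (x := (2:ℕ) * 0.55) (by norm_num)
            have h6 := Real.exp_one_gt_d9
            have h7 : Real.exp ((2:ℕ) * 0.55) = Real.exp 1 * Real.exp 0.1 := by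
              rw [← Real.exp_add]; norm_num
            have h8 := Real.add_one_le_exp 0.1
            have h9 := Real.quadratic_le_exp_of_nonneg (x := 0.1) (by norm_num)
            rw [h7]
            nlinarith
          rw [Real.exp_neg]
          have : 0 < √(1+‖B x‖^2) := by positivity
          gcongr
        · rw [neg_div, neg_le_neg_iff]
          gcongr
          nlinarith [sq_nonneg ‖B x‖]
    _ ≤ _ := setLIntegral_le_lintegral _ _

lemma rho_half (hk : 1 ≤ k) (hB : ∑ j, ‖B (EuclideanSpace.basisFun (Fin n) ℝ j)‖ ^ 2 = 1)
    (hN2 : ∫⁻ x, ENNReal.ofReal (‖B x‖ ^ 2) ∂μ ≤ 1) (y : ℝ) (hy : y ^ 2 ≤ Real.exp 8) :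
    ENNReal.ofReal (1/2) * rho k μ B y ≤
    (∫⁻ Γ in {Γ | QQ B Γ ≤ (10 + 2 * Real.exp 8) * k}, ZZ μ B Γ y ∂(Measure.pi fun _ : Fin k => gam n)) := by
  set R := 10 + 2 * Real.exp 8 with hR
  have hZm := fun y => ZZ_meas (k := k) μ B y
  have hK : MeasurableSet {Γ : Fin k → EE n | QQ B Γ ≤ R * k} := by
    apply measurableSet_le _ measurable_const
    unfold QQ
    fun_prop
  have h1 := lintegral_add_compl (μ := Measure.pi fun _ : Fin k => gam n) (fun Γ => ZZ μ B Γ y) hK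
  have h2 : ∫⁻ Γ in {Γ | QQ B Γ ≤ R * k}ᶜ, ZZ μ B Γ y ∂(Measure.pi fun _ : Fin k => gam n) ≤
      ENNReal.ofReal (1/2) * rho k μ B y := by
    calc _ ≤ ∫⁻ Γ in {Γ | QQ B Γ ≤ R * k}ᶜ, 1 ∂(Measure.pi fun _ : Fin k => gam n) :=
          lintegral_mono fun Γ => ZZ_le_one μ B Γ y
      _ = (Measure.pi fun _ : Fin k => gam n) {Γ | R * k < ∑ i, ‖ContinuousLinearMap.adjoint B (Γ i)‖ ^ 2} := by
          rw [setLIntegral_one]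
          congr 1
          ext Γ
          simp [QQ]
      _ ≤ _ := gam_pi_tail B hB k R
      _ ≤ ENNReal.ofReal (1/2 * (1 / 2 * Real.exp (-(k * (0.55 + y ^ 2 / 2))))) := by
          apply ENNReal.ofReal_le_ofReal
          have h3 : Real.exp (-(1.4 * k)) ≤ 1/4 := by
            have : Real.exp (-(1.4 * k)) ≤ Real.exp (-1.4) := by
              apply Real.exp_le_exp.2
              have : (1:ℝ) ≤ k := by exact_mod_cast hk
              linarith
            have h5 : 4 ≤ Real.exp 1.4 := by
              have h7 : Real.exp 1.4 = Real.exp 1 * Real.exp 0.4 := by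
                rw [← Real.exp_add]; norm_num
              have h6 := Real.exp_one_gt_d9
              have h9 := Real.quadratic_le_exp_of_nonneg (x := 0.4) (by norm_num)
              rw [h7]; nlinarith
            refine this.trans ?_
            rw [one_div, Real.exp_neg]
            gcongr
          calc _ ≤ Real.exp (-(1.4 * k)) * Real.exp (-(k * (0.55 + y ^ 2 / 2))) := by
                rw [← Real.exp_add]
                apply Real.exp_le_exp.2
                have : (0:ℝ) ≤ k := by positivity
                rw [hR]
                nlinarith
            _ ≤ 1 / 4 * Real.exp (-(k * (0.55 + y ^ 2 / 2))) := by gcongr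
            _ = _ := by ring
      _ ≤ _ := by
          rw [ENNReal.ofReal_mul (by norm_num)]
          exact mul_le_mul_right (rho_lower μ B hN2 y) _
  have h0 : rho k μ B y ≠ ⊤ := by
    have : rho k μ B y ≤ 1 := by
      calc _ ≤ ∫⁻ Γ, 1 ∂(Measure.pi fun _ : Fin k => gam n) := lintegral_mono fun Γ => ZZ_le_one μ B Γ y
        _ = 1 := by simp
    exact (this.trans_lt ENNReal.one_lt_top).ne
  have h3 : ENNReal.ofReal (1/2) * rho k μ B y + ENNReal.ofReal (1/2) * rho k μ B y ≤
      (∫⁻ Γ in {Γ | QQ B Γ ≤ R * k}, ZZ μ B Γ y ∂(Measure.pi fun _ : Fin k => gam n)) +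
       ENNReal.ofReal (1/2) * rho k μ B y := by
    calc _ = rho k μ B y := by
          rw [← add_mul, ← ENNReal.ofReal_add (by norm_num) (by norm_num)]; norm_num
      _ = _ := h1.symm
      _ ≤ _ := add_le_add le_rfl h2
  exact (ENNReal.add_le_add_iff_right (ENNReal.mul_ne_top ENNReal.ofReal_ne_top h0)).1 h3

/-- The hypothesis bundle. -/
structure Hyp (α b : ℝ) : Prop where
  hb : 0 < b
  hpl : PLmeas μ
  hiso : ∀ θ : EE n, ∫⁻ x, ENNReal.ofReal (⟪x, θ⟫ ^ 2) ∂μ = ENNReal.ofReal (‖θ‖ ^ 2)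
  hpsi : ∀ p : ℝ, 2 ≤ p → ∀ θ : EE n, ∫⁻ x, ENNReal.ofReal (|⟪x, θ⟫| ^ p) ∂μ ≤
      ENNReal.ofReal ((b * p ^ (1 / α) * ‖θ‖) ^ p)
  hB : ∑ j, ‖B (EuclideanSpace.basisFun (Fin n) ℝ j)‖ ^ 2 = 1
  hN2 : ∫⁻ x, ENNReal.ofReal (‖B x‖ ^ 2) ∂μ = 1

lemma S6 {α b : ℝ} (H : Hyp μ B α b) (hk : 1 ≤ k) (y1 y2 ε : ℝ) (h1 : y1 ^ 2 ≤ Real.exp 8) (h2 : y2 ^ 2 ≤ Real.exp 8)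
    (hε0 : 0 < ε) (hε1 : ε ≤ 1)
    (hL : 4 * (Real.exp 1 * (b * (2 * (MM * k)) ^ (1 / α) * ‖B‖)) ^ 2 ≤ ε) :
    rho k μ B y1 * rho k μ B y2 ≤ ENNReal.ofReal (4 * Real.exp (6 * (MM * k) * ε)) * rho k μ B ((y1 + y2) / 2) ^ 2 := by
  have hk' : (1:ℝ) ≤ k := by exact_mod_cast hk
  have hMk : 1 ≤ MM * k := by nlinarith [MM_ge]
  have h := S3 (k := k) μ B H.hb H.hpl H.hiso H.hpsi y1 y2 (MM * k) ε ((10 + 2 * Real.exp 8) * k) hMk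
    (by unfold MM; nlinarith) (by unfold MM; nlinarith) hε0 hε1 hL
  have r1 := rho_half μ B hk H.hB H.hN2.le y1 h1
  have r2 := rho_half μ B hk H.hB H.hN2.le y2 h2
  set a1 := (∫⁻ Γ in {Γ | QQ B Γ ≤ (10 + 2 * Real.exp 8) * k}, ZZ μ B Γ y1 ∂(Measure.pi fun _ : Fin k => gam n))
  set a2 := (∫⁻ Γ in {Γ | QQ B Γ ≤ (10 + 2 * Real.exp 8) * k}, ZZ μ B Γ y2 ∂(Measure.pi fun _ : Fin k => gam n))
  have hsq : a1 * a2 ≤ (ENNReal.ofReal (Real.exp (3 * (MM * k) * ε)) * rho k μ B ((y1 + y2) / 2)) ^ 2 := by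
    calc a1 * a2 = (a1 ^ (1/2:ℝ) * a2 ^ (1/2:ℝ)) ^ 2 := by
          rw [mul_pow, ← ENNReal.rpow_natCast, ← ENNReal.rpow_natCast, ← ENNReal.rpow_mul, ← ENNReal.rpow_mul]
          norm_num
      _ ≤ _ := by gcongr
  calc _ = ENNReal.ofReal 4 * ((ENNReal.ofReal (1/2) * rho k μ B y1) * (ENNReal.ofReal (1/2) * rho k μ B y2)) := by
        rw [mul_mul_mul_comm, ← ENNReal.ofReal_mul (by norm_num), ← mul_assoc, ← ENNReal.ofReal_mul (by norm_num)]
        norm_num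
    _ ≤ ENNReal.ofReal 4 * (a1 * a2) := mul_le_mul_right (mul_le_mul' r1 r2) _
    _ ≤ ENNReal.ofReal 4 * (ENNReal.ofReal (Real.exp (3 * (MM * k) * ε)) * rho k μ B ((y1 + y2) / 2)) ^ 2 :=
        mul_le_mul_right hsq _
    _ = _ := by
        rw [mul_pow, ← mul_assoc, ← ENNReal.ofReal_pow (by positivity), ← Real.exp_nat_mul,
          ← ENNReal.ofReal_mul (by norm_num)]
        congr 4
        push_cast; ring

/-- The auxiliary function zeta. -/
def zeta0 (u : ℝ) : ℝ := (Real.exp (2 * u) - 1) / 2 - u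

lemma zeta0_nonneg (u : ℝ) : 0 ≤ zeta0 u := by
  unfold zeta0; linarith [Real.add_one_le_exp (2 * u)]

lemma zeta0_le (u : ℝ) (hu : |u| ≤ 1 / 2) : zeta0 u ≤ 2 * u ^ 2 := by
  have := Real.abs_exp_sub_one_sub_id_le (x := 2 * u) (by rw [abs_mul]; norm_num; linarith)
  have := (abs_le.1 this).2
  unfold zeta0; nlinarith

/-- `τ(x) = log(1+|Bx|²)/2`. -/
def tau (x : EE n) : ℝ := Real.log (1 + ‖B x‖ ^ 2) / 2

lemma tau_meas : Measurable (tau B) := by unfold tau; fun_prop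

lemma tau_nonneg (x : EE n) : 0 ≤ tau B x := by
  unfold tau
  have := Real.log_nonneg (x := 1 + ‖B x‖ ^ 2) (by nlinarith [sq_nonneg ‖B x‖])
  linarith

/-- The profile `q`. -/
def qq (k : ℕ) (v : ℝ) : ℝ≥0∞ := ∫⁻ x, ENNReal.ofReal (Real.exp (-(k * zeta0 (v - tau B x)))) ∂μ

lemma qq_eq (v : ℝ) : qq μ B k v = ENNReal.ofReal (Real.exp (k * (1 / 2 + v))) * rho k μ B (Real.exp v) := by
  rw [rho_eq, ← lintegral_const_mul _ (by fun_prop), qq]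
  apply lintegral_congr
  intro x
  rw [← ENNReal.ofReal_mul (by positivity)]
  congr 1
  have hs : 0 < 1 + ‖B x‖ ^ 2 := by positivity
  have e1 : √(1 + ‖B x‖ ^ 2) = Real.exp (tau B x) := by
    rw [Real.sqrt_eq_rpow, Real.rpow_def_of_pos hs, tau]; congr 1; ring
  have e2 : 1 + ‖B x‖ ^ 2 = Real.exp (2 * tau B x) := by
    rw [tau, mul_div_cancel₀ _ (by norm_num), Real.exp_log hs]
  rw [e1, e2, ← Real.exp_neg, ← Real.exp_add, ← Real.exp_nat_mul, ← Real.exp_add]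
  congr 1
  have e3 : -Real.exp v ^ 2 / (2 * Real.exp (2 * tau B x)) = -Real.exp (2 * (v - tau B x)) / 2 := by
    rw [← Real.exp_nat_mul, mul_sub, Real.exp_sub]; push_cast; field_simp
  rw [e3, zeta0]; ring

lemma qq_le_one (v : ℝ) : qq μ B k v ≤ 1 := by
  calc _ ≤ ∫⁻ _, 1 ∂μ := by
        apply lintegral_mono
        intro x
        have := zeta0_nonneg (v - tau B x)
        have : 0 ≤ k * zeta0 (v - tau B x) := by positivity
        simp only [ENNReal.ofReal_le_one, Real.exp_le_one_iff]
        linarith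
    _ = 1 := by simp

lemma cosh_lower (x : ℝ) (hx : |x| ≤ 5 / 2) : Real.exp (x ^ 2 / 10) ≤ Real.cosh x := by
  have h1 : 1 + x ^ 2 / 2 ≤ Real.cosh x := by
    have h : |x| / 2 ≤ Real.sinh (|x| / 2) := Real.self_le_sinh_iff.2 (by positivity)
    have e : Real.cosh x = 1 + 2 * Real.sinh (|x| / 2) ^ 2 := by
      rw [← Real.cosh_abs, show |x| = 2 * (|x| / 2) by ring, Real.cosh_two_mul, Real.cosh_sq]; ring_nf
    rw [e, ← sq_abs x]
    nlinarith [abs_nonneg x]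
  refine le_trans ?_ h1
  have hx2 : x ^ 2 ≤ 25 / 4 := by
    rw [← sq_abs]; nlinarith [abs_nonneg x]
  have : Real.exp (-(x ^ 2 / 10)) ≥ 1 - x ^ 2 / 10 := by linarith [Real.add_one_le_exp (-(x ^ 2 / 10))]
  have h3 : 0 < 1 - x ^ 2 / 10 := by linarith
  have h4 : Real.exp (x ^ 2 / 10) ≤ 1 / (1 - x ^ 2 / 10) := by
    rw [Real.exp_neg] at this
    rw [le_div_iff₀ h3]
    have hp := Real.exp_pos (x ^ 2 / 10)
    calc _ ≤ Real.exp (x ^ 2 / 10) * (Real.exp (x ^ 2 / 10))⁻¹ := by gcongr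
      _ = 1 := by field_simp
  refine h4.trans ?_
  rw [div_le_iff₀ h3]
  nlinarith [sq_nonneg x]

lemma S7 {α b : ℝ} (H : Hyp μ B α b) (hk : 1 ≤ k) (v1 v2 ε : ℝ) (h1 : v1 ≤ 4) (h2 : v2 ≤ 4) (h1' : -1 ≤ v1)
    (h2' : -1 ≤ v2) (hε0 : 0 < ε) (hε1 : ε ≤ 1)
    (hL : 4 * (Real.exp 1 * (b * (2 * (MM * k)) ^ (1 / α) * ‖B‖)) ^ 2 ≤ ε) :
    qq μ B k v1 * qq μ B k v2 ≤ ENNReal.ofReal (4 * Real.exp (6 * (MM * k) * ε) * Real.exp (-(k * (v2 - v1) ^ 2 / 20))) := by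
  have hy : ∀ v : ℝ, v ≤ 4 → (Real.exp v) ^ 2 ≤ Real.exp 8 := by
    intro v hv
    rw [← Real.exp_nat_mul]; apply Real.exp_le_exp.2; push_cast; linarith
  have h6 := S6 μ B H hk (Real.exp v1) (Real.exp v2) ε (hy _ h1) (hy _ h2) hε0 hε1 hL
  set c := Real.cosh ((v2 - v1) / 2) with hc
  have hc1 : 1 ≤ c := Real.one_le_cosh _
  have hc0 : 0 < c := by linarith
  set vm := Real.log ((Real.exp v1 + Real.exp v2) / 2) with hvm
  have hym : Real.exp vm = (Real.exp v1 + Real.exp v2) / 2 := by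
    rw [hvm, Real.exp_log (by positivity)]
  have hvm2 : Real.exp vm = Real.exp ((v1 + v2) / 2) * c := by
    rw [hym, hc, Real.cosh_eq, mul_div_assoc', mul_add, ← Real.exp_add, ← Real.exp_add, add_comm (Real.exp v1)]
    congr 3 <;> ring
  have h7 := qq_eq (k := k) μ B vm
  have h8 := qq_le_one (k := k) μ B vm
  rw [← hym] at h6
  rw [qq_eq, qq_eq, mul_mul_mul_comm]
  calc _ ≤ (ENNReal.ofReal (Real.exp (k * (1 / 2 + v1))) * ENNReal.ofReal (Real.exp (k * (1 / 2 + v2)))) *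
        (ENNReal.ofReal (4 * Real.exp (6 * (MM * k) * ε)) * rho k μ B (Real.exp vm) ^ 2) := mul_le_mul_right h6 _
    _ = ENNReal.ofReal (4 * Real.exp (6 * (MM * k) * ε) * (c ^ (2 * k))⁻¹) * (qq μ B k vm) ^ 2 := by
        rw [h7, mul_pow, ← mul_assoc, ← ENNReal.ofReal_pow (by positivity),
          ← ENNReal.ofReal_mul (by positivity), ← ENNReal.ofReal_mul (by positivity)]
        conv_rhs => rw [← mul_assoc, ← ENNReal.ofReal_mul (by positivity)]
        congr 2
        have e : ∀ v : ℝ, Real.exp (k * (1 / 2 + v)) = Real.exp (k / 2) * Real.exp v ^ k := by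
          intro v
          rw [← Real.exp_nat_mul, ← Real.exp_add]; congr 1; ring
        have e2 : Real.exp v1 ^ k * Real.exp v2 ^ k = (Real.exp ((v1 + v2) / 2)) ^ (2 * k) := by
          rw [← Real.exp_nat_mul, ← Real.exp_nat_mul, ← Real.exp_nat_mul, ← Real.exp_add]; congr 1; push_cast; ring
        rw [e, e, e, hvm2, mul_pow, mul_pow]
        field_simp
        rw [e2]; ring
    _ ≤ ENNReal.ofReal (4 * Real.exp (6 * (MM * k) * ε) * (c ^ (2 * k))⁻¹) * 1 := by
        refine mul_le_mul_right ?_ _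
        calc _ ≤ (1:ℝ≥0∞) ^ 2 := by gcongr
          _ = 1 := one_pow _
    _ ≤ _ := by
        rw [mul_one]
        apply ENNReal.ofReal_le_ofReal
        gcongr
        have hcl := cosh_lower ((v2 - v1) / 2) (by rw [abs_le]; constructor <;> linarith)
        rw [Real.exp_neg]
        gcongr
        calc _ = Real.exp (((v2 - v1) / 2) ^ 2 / 10) ^ (2 * k) := by
              rw [← Real.exp_nat_mul]; congr 1; push_cast; ring
          _ ≤ _ := by gcongr

end S8


section S8b
set_option linter.unusedSectionVars false
variable {n k : ℕ} (μ : Measure (EE n)) [IsProbabilityMeasure μ] (B : EE n →L[ℝ] EE n)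

lemma zeta0_meas : Measurable zeta0 := by unfold zeta0; fun_prop

lemma qq_meas : Measurable (qq μ B k) := by
  have h1 := tau_meas B
  have h2 := zeta0_meas
  apply Measurable.lintegral_prod_right'
    (f := fun p : ℝ × EE n => ENNReal.ofReal (Real.exp (-(k * zeta0 (p.1 - tau B p.2)))))
  fun_prop

lemma window (hk : 1 ≤ k) (S : Set (EE n)) (hS : MeasurableSet S) (J : Set ℝ) (c : EE n → ℝ)
    (hc : ∀ x ∈ S, Set.Icc (c x) (c x + 1 / (2 * √k)) ⊆ J)
    (hc2 : ∀ x ∈ S, ∀ v ∈ Set.Icc (c x) (c x + 1 / (2 * √k)), |v - tau B x| ≤ 1 / (2 * √k)) :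
    ENNReal.ofReal (Real.exp (-(1/2)) * (1 / (2 * √k))) * μ S ≤ ∫⁻ v in J, qq μ B k v := by
  have h1 := tau_meas B
  have h2 := zeta0_meas
  have hk' : (1:ℝ) ≤ k := by exact_mod_cast hk
  have hsk : 0 < √(k:ℝ) := by positivity
  have hsk1 : 1 ≤ √(k:ℝ) := by rw [Real.one_le_sqrt]; exact hk'
  unfold qq
  rw [lintegral_lintegral_swap (by
    have : Measurable fun p : ℝ × EE n => ENNReal.ofReal (Real.exp (-(k * zeta0 (p.1 - tau B p.2)))) := by
      fun_prop
    exact this.aemeasurable)]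
  rw [← setLIntegral_const]
  refine le_trans ?_ (setLIntegral_le_lintegral S _)
  apply setLIntegral_mono' hS
  intro x hx
  calc _ = ∫⁻ v in Set.Icc (c x) (c x + 1 / (2 * √k)), ENNReal.ofReal (Real.exp (-(1/2))) := by
        rw [setLIntegral_const, Real.volume_Icc, ← ENNReal.ofReal_mul (by positivity)]
        congr 2; ring
    _ ≤ ∫⁻ v in Set.Icc (c x) (c x + 1 / (2 * √k)), ENNReal.ofReal (Real.exp (-(k * zeta0 (v - tau B x)))) := by
        apply setLIntegral_mono' measurableSet_Icc
        intro v hv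
        apply ENNReal.ofReal_le_ofReal
        apply Real.exp_le_exp.2
        have h3 := hc2 x hx v hv
        have h4 : 1 / (2 * √(k:ℝ)) ≤ 1 / 2 := by
          apply one_div_le_one_div_of_le (by norm_num); linarith
        have h5 := zeta0_le (v - tau B x) (h3.trans h4)
        have h6 : (v - tau B x) ^ 2 ≤ (1 / (2 * √(k:ℝ))) ^ 2 := by
          rw [← sq_abs]; gcongr
        have h7 : (1 / (2 * √(k:ℝ))) ^ 2 = 1 / (4 * k) := by
          rw [div_pow, mul_pow, Real.sq_sqrt (by positivity)]; norm_num
        rw [h7] at h6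
        have h8 : (k:ℝ) * zeta0 (v - tau B x) ≤ k * (2 * (1 / (4 * k))) := by
          gcongr; linarith
        have h9 : (k:ℝ) * (2 * (1 / (4 * k))) = 1 / 2 := by field_simp; norm_num
        linarith
    _ ≤ _ := lintegral_mono_set (hc x hx)

lemma lint_gauss (hk : 1 ≤ k) (m : ℝ) : ∫⁻ v, ENNReal.ofReal (Real.exp (-(k * (v - m) ^ 2 / 20))) =
    ENNReal.ofReal (√(20 * π / k)) := by
  have hk' : (1:ℝ) ≤ k := by exact_mod_cast hk
  rw [lintegral_sub_right_eq_self (fun v => ENNReal.ofReal (Real.exp (-(k * v ^ 2 / 20)))) m]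
  have h := integral_gaussian ((k:ℝ) / 20)
  have hi := integrable_exp_neg_mul_sq (b := (k:ℝ) / 20) (by positivity)
  have e : ∀ v : ℝ, Real.exp (-(k * v ^ 2 / 20)) = Real.exp (-(k / 20) * v ^ 2) := by
    intro v; congr 1; ring
  simp_rw [e]
  rw [← ofReal_integral_eq_lintegral_ofReal hi (Filter.Eventually.of_forall fun _ => (Real.exp_pos _).le), h]
  congr 2; field_simp

lemma S8 {α b : ℝ} (H : Hyp μ B α b) (hk : 1 ≤ k) (m t ε : ℝ) (ht : 0 ≤ t) (hε0 : 0 < ε) (hε1 : ε ≤ 1)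
    (hL : 4 * (Real.exp 1 * (b * (2 * (MM * k)) ^ (1 / α) * ‖B‖)) ^ 2 ≤ ε) :
    μ {x | tau B x ≤ m} * μ {x | m + t ≤ tau B x ∧ tau B x ≤ 3} ≤
      ENNReal.ofReal (3000 * Real.exp (6 * (MM * k) * ε) * Real.exp (-(k * t ^ 2 / 20))) := by
  have hτ := tau_meas B
  have hk' : (1:ℝ) ≤ k := by exact_mod_cast hk
  have hsk : 0 < √(k:ℝ) := by positivity
  have hsk1 : 1 ≤ √(k:ℝ) := by rw [Real.one_le_sqrt]; exact hk'
  have h4 : 1 / (2 * √(k:ℝ)) ≤ 1 / 2 := by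
    apply one_div_le_one_div_of_le (by norm_num); linarith
  have h40 : 0 < 1 / (2 * √(k:ℝ)) := by positivity
  by_cases hm : m < 0
  · have : {x | tau B x ≤ m} = ∅ := by
      ext x
      simp only [Set.mem_ofPred_eq, Set.mem_empty_iff_false, iff_false, not_le]
      exact hm.trans_le (tau_nonneg B x)
    rw [this]; simp
  push Not at hm
  by_cases hmt : 3 < m + t
  · have : {x | m + t ≤ tau B x ∧ tau B x ≤ 3} = ∅ := by
      ext x
      simp only [Set.mem_ofPred_eq, Set.mem_empty_iff_false, iff_false, not_and, not_le]
      intro h; linarith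
    rw [this]; simp
  push Not at hmt
  have w1 := window (k := k) μ B hk {x | tau B x ≤ m} (measurableSet_le hτ measurable_const) (Set.Icc (-1) m)
    (fun x => tau B x - 1 / (2 * √k))
    (by
      intro x hx v hv
      simp only [Set.mem_ofPred_eq] at hx
      have := tau_nonneg B x
      exact ⟨by linarith [hv.1], by linarith [hv.2]⟩)
    (by
      intro x hx v hv
      rw [abs_le]
      exact ⟨by linarith [hv.1], by linarith [hv.2]⟩)
  have w2 := window (k := k) μ B hk {x | m + t ≤ tau B x ∧ tau B x ≤ 3}
    ((measurableSet_le measurable_const hτ).inter (measurableSet_le hτ measurable_const)) (Set.Icc (m + t) 4)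
    (fun x => tau B x)
    (by
      intro x hx v hv
      simp only [Set.mem_ofPred_eq] at hx
      exact ⟨by linarith [hv.1], by linarith [hv.2]⟩)
    (by
      intro x hx v hv
      rw [abs_le]
      exact ⟨by linarith [hv.1], by linarith [hv.2]⟩)
  have hq := qq_meas (k := k) μ B
  set K := 4 * Real.exp (6 * (MM * k) * ε) * Real.exp (-(k * t ^ 2 / 20)) with hK
  have hK0 : 0 < K := by positivity
  have up : (∫⁻ v in Set.Icc (-1) m, qq μ B k v) * (∫⁻ v in Set.Icc (m + t) 4, qq μ B k v) ≤
      ENNReal.ofReal (K * (20 * π / k)) := by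
    calc _ = ∫⁻ v1 in Set.Icc (-1) m, ∫⁻ v2 in Set.Icc (m + t) 4, qq μ B k v1 * qq μ B k v2 := by
          rw [← lintegral_mul_const _ hq]
          apply lintegral_congr
          intro v1
          rw [lintegral_const_mul _ hq]
      _ ≤ ∫⁻ v1 in Set.Icc (-1) m, ∫⁻ v2 in Set.Icc (m + t) 4, ENNReal.ofReal K *
          ENNReal.ofReal (Real.exp (-(k * (v1 - m) ^ 2 / 20))) *
          ENNReal.ofReal (Real.exp (-(k * (v2 - (m + t)) ^ 2 / 20))) := by
          apply setLIntegral_mono' measurableSet_Icc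
          intro v1 hv1
          apply setLIntegral_mono' measurableSet_Icc
          intro v2 hv2
          refine (S7 μ B H hk v1 v2 ε (by linarith [hv1.2]) hv2.2 hv1.1 (by linarith [hv2.1]) hε0 hε1 hL).trans ?_
          rw [← ENNReal.ofReal_mul (by positivity), ← ENNReal.ofReal_mul (by positivity)]
          apply ENNReal.ofReal_le_ofReal
          have h1 := hv1.2
          have h2 := hv2.1
          have h3 : (v1 - m) ^ 2 + (v2 - (m + t)) ^ 2 + t ^ 2 ≤ (v2 - v1) ^ 2 := by
            have e : v2 - v1 = (m - v1) + (v2 - (m + t)) + t := by ring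
            rw [e]
            nlinarith [mul_nonneg (sub_nonneg.2 h1) (sub_nonneg.2 h2), mul_nonneg (sub_nonneg.2 h1) ht,
              mul_nonneg ht (sub_nonneg.2 h2)]
          have h5 : Real.exp (-(k * (v2 - v1) ^ 2 / 20)) ≤ Real.exp (-(k * t ^ 2 / 20)) *
              Real.exp (-(k * (v1 - m) ^ 2 / 20)) * Real.exp (-(k * (v2 - (m + t)) ^ 2 / 20)) := by
            rw [← Real.exp_add, ← Real.exp_add]
            apply Real.exp_le_exp.2
            nlinarith
          have h6 := mul_le_mul_of_nonneg_left h5 (show 0 ≤ 4 * Real.exp (6 * (MM * k) * ε) by positivity)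
          rw [hK]
          linarith
      _ ≤ ∫⁻ v1, ∫⁻ v2, ENNReal.ofReal K *
          ENNReal.ofReal (Real.exp (-(k * (v1 - m) ^ 2 / 20))) *
          ENNReal.ofReal (Real.exp (-(k * (v2 - (m + t)) ^ 2 / 20))) :=
          (setLIntegral_le_lintegral _ _).trans (lintegral_mono fun v1 => setLIntegral_le_lintegral _ _)
      _ = _ := by
          have : ∀ v1, ∫⁻ v2, ENNReal.ofReal K *
              ENNReal.ofReal (Real.exp (-(k * (v1 - m) ^ 2 / 20))) *
              ENNReal.ofReal (Real.exp (-(k * (v2 - (m + t)) ^ 2 / 20))) =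
              ENNReal.ofReal K * ENNReal.ofReal (√(20 * π / k)) *
                ENNReal.ofReal (Real.exp (-(k * (v1 - m) ^ 2 / 20))) := by
            intro v1
            rw [lintegral_const_mul _ (by fun_prop), lint_gauss hk]; ring
          simp_rw [this]
          rw [lintegral_const_mul _ (by fun_prop), lint_gauss hk, mul_assoc,
            ← ENNReal.ofReal_mul (by positivity), ← ENNReal.ofReal_mul (by positivity),
            Real.mul_self_sqrt (by positivity)]
  have hp := (mul_le_mul' w1 w2).trans up
  rw [mul_mul_mul_comm, ← ENNReal.ofReal_mul (by positivity)] at hp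
  set PP := μ {x | tau B x ≤ m} * μ {x | m + t ≤ tau B x ∧ tau B x ≤ 3}
  set a := Real.exp (-(1/2)) * (1 / (2 * √k)) * (Real.exp (-(1/2)) * (1 / (2 * √k))) with ha
  have ha' : a = Real.exp (-1) / (4 * k) := by
    have e1 : Real.exp (-(1/2)) * Real.exp (-(1/2)) = Real.exp (-1) := by rw [← Real.exp_add]; norm_num
    have e2 : √(k:ℝ) * √(k:ℝ) = k := Real.mul_self_sqrt (by positivity)
    rw [ha, ← e1]
    field_simp
    rw [Real.sq_sqrt (by positivity)]; norm_num
  have ha0 : 0 < a := by positivity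
  calc PP = ENNReal.ofReal (a⁻¹) * (ENNReal.ofReal a * PP) := by
        rw [← mul_assoc, ← ENNReal.ofReal_mul (by positivity), inv_mul_cancel₀ ha0.ne']; simp
    _ ≤ ENNReal.ofReal (a⁻¹) * ENNReal.ofReal (K * (20 * π / k)) := mul_le_mul_right hp _
    _ ≤ _ := by
        rw [← ENNReal.ofReal_mul (by positivity)]
        apply ENNReal.ofReal_le_ofReal
        have e3 : a⁻¹ * (K * (20 * π / k)) = 80 * π * Real.exp 1 * K := by
          rw [ha', Real.exp_neg]; field_simp; norm_num
        rw [e3, hK]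
        have h5 : π ≤ 3.15 := Real.pi_lt_d2.le
        have h6 : Real.exp 1 ≤ 2.72 := by linarith [Real.exp_one_lt_d9]
        have h7 : 80 * π * Real.exp 1 * 4 ≤ 3000 := by
          have : π * Real.exp 1 ≤ 3.15 * 2.72 := by gcongr
          nlinarith
        have h8 : 0 < Real.exp (6 * (MM * k) * ε) * Real.exp (-(k * t ^ 2 / 20)) := by positivity
        nlinarith

end S8b


/-- universal constants -/
def kap : ℝ := 1 / (240 * MM)
def kap2 : ℝ := kap / (16 * Real.exp 1 ^ 2 * MM ^ 2)
def c10 : ℝ := kap2 / 480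

lemma kap_pos : 0 < kap := by have := MM_ge; unfold kap; positivity
lemma kap_le : kap ≤ 1 := by
  have := MM_ge; unfold kap
  rw [div_le_one (by positivity)]; linarith
lemma kap2_pos : 0 < kap2 := by have := MM_ge; have := kap_pos; unfold kap2; positivity
lemma kap2_le : kap2 ≤ 1 := by
  have := MM_ge; unfold kap2
  rw [div_le_one (by positivity)]
  have h1 : 1 ≤ Real.exp 1 := Real.one_le_exp (by norm_num)
  have h2 : (1:ℝ) ≤ Real.exp 1 ^ 2 := one_le_pow₀ h1
  have h3 : (1:ℝ) ≤ MM ^ 2 := one_le_pow₀ (by linarith)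
  nlinarith [kap_le]
lemma c10_pos : 0 < c10 := by have := kap2_pos; unfold c10; positivity
lemma c10_le : c10 ≤ 1 / 480 := by have := kap2_le; unfold c10; linarith

section S9
set_option linter.unusedSectionVars false
variable {n : ℕ} (μ : Measure (EE n)) [IsProbabilityMeasure μ] (B : EE n →L[ℝ] EE n)

/-- effective dimension -/
def DD (α b : ℝ) : ℝ := ((b * ‖B‖)⁻¹) ^ α

lemma Hyp.normB {α b : ℝ} (H : Hyp μ B α b) : 0 < ‖B‖ := by
  rw [norm_pos_iff]
  rintro rfl
  simpa using H.hB

lemma S9 {α b : ℝ} (H : Hyp μ B α b) (hα1 : 1 ≤ α) (hα2 : α ≤ 2) (m t : ℝ) (ht : 0 < t) (ht1 : t ≤ 1) :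
    μ {x | tau B x ≤ m} * μ {x | m + t ≤ tau B x ∧ tau B x ≤ 3} ≤
      ENNReal.ofReal (3000 * Real.exp (-(6 * c10 * DD B α b * t ^ (2 + α)))) := by
  have hBn := H.normB
  have hb := H.hb
  have hM := MM_ge
  have hkap := kap_pos
  have hkap2 := kap2_pos
  set β := b * ‖B‖ with hβ
  have hβ0 : 0 < β := by positivity
  have hD : DD B α b = (β⁻¹) ^ α := rfl
  set D := DD B α b with hDD
  have hD0 : 0 < D := by rw [hD]; positivity
  set r := kap2 * t ^ α * D with hr
  have hr0 : 0 < r := by positivity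
  have htp : t ^ (2 + α) = t ^ 2 * t ^ α := by rw [Real.rpow_add ht]; norm_cast
  by_cases h1 : r < 1
  · refine (mul_le_mul' prob_le_one prob_le_one).trans ?_
    rw [mul_one]
    rw [show (1:ℝ≥0∞) = ENNReal.ofReal 1 by simp]
    apply ENNReal.ofReal_le_ofReal
    have : 6 * c10 * D * t ^ (2 + α) ≤ 1 := by
      rw [htp]
      have e : 6 * c10 * D * (t ^ 2 * t ^ α) = r * t ^ 2 / 80 := by rw [hr, c10]; ring
      rw [e]
      have : t ^ 2 ≤ 1 := by nlinarith
      nlinarith [sq_nonneg t]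
    have h2 : Real.exp (-1) ≤ Real.exp (-(6 * c10 * D * t ^ (2 + α))) := by
      apply Real.exp_le_exp.2; linarith
    have h3 : Real.exp (-1) ≥ 1 / 3 := by
      rw [Real.exp_neg, ge_iff_le, one_div]
      have := Real.exp_one_lt_d9
      gcongr; linarith
    linarith
  push Not at h1
  set k := ⌊r⌋₊ with hk
  have hk1 : 1 ≤ k := by rw [hk, Nat.one_le_floor_iff]; exact h1
  have hk1' : (1:ℝ) ≤ k := by exact_mod_cast hk1
  have hkr : (k:ℝ) ≤ r := Nat.floor_le hr0.le
  have hkr2 : r / 2 ≤ k := by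
    have := Nat.lt_floor_add_one r
    rw [← hk] at this
    linarith
  have h := S8 (k := k) μ B H hk1 m t (kap * t ^ 2) ht.le (by positivity)
    (by
      have : t ^ 2 ≤ 1 := by nlinarith
      nlinarith [kap_le, sq_nonneg t]) ?_
  · refine h.trans (ENNReal.ofReal_le_ofReal ?_)
    rw [mul_assoc, ← Real.exp_add]
    gcongr
    have e1 : 6 * (MM * k) * (kap * t ^ 2) = k * t ^ 2 / 40 := by
      rw [kap]; field_simp; norm_num
    rw [e1, htp]
    have e : 6 * c10 * D * (t ^ 2 * t ^ α) = r * t ^ 2 / 80 := by rw [hr, c10]; ring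
    rw [e]
    nlinarith [sq_nonneg t]
  · have e2 : (Real.exp 1 * (b * (2 * (MM * k)) ^ (1 / α) * ‖B‖)) ^ 2 =
        Real.exp 1 ^ 2 * β ^ 2 * ((2 * MM) ^ (2 / α) * (k:ℝ) ^ (2 / α)) := by
      rw [← Real.mul_rpow (by positivity) (by positivity), hβ]
      have : ((2 * (MM * (k:ℝ))) ^ (1 / α)) ^ 2 = (2 * MM * k) ^ (2 / α) := by
        rw [← Real.rpow_natCast, ← Real.rpow_mul (by positivity)]
        congr 1
        · ring
        · push_cast; ring
      rw [← this]; ring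
    rw [e2]
    have e3 : (2 * MM) ^ (2 / α) ≤ (2 * MM) ^ 2 := by
      rw [← Real.rpow_natCast]
      apply Real.rpow_le_rpow_of_exponent_le (by linarith)
      push_cast
      rw [div_le_iff₀ (by linarith)]; linarith
    have e4 : (k:ℝ) ^ (2 / α) ≤ kap2 * t ^ 2 * (β⁻¹) ^ 2 := by
      calc (k:ℝ) ^ (2 / α) ≤ r ^ (2 / α) := by
            apply Real.rpow_le_rpow (by positivity) hkr (by positivity)
        _ = kap2 ^ (2 / α) * t ^ 2 * (β⁻¹) ^ 2 := by
            have hαα : α * (2 / α) = 2 := by field_simp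
            rw [hr, hD, Real.mul_rpow (by positivity) (by positivity), Real.mul_rpow (by positivity) (by positivity),
              ← Real.rpow_mul ht.le, ← Real.rpow_mul (by positivity), hαα]
            norm_cast
        _ ≤ kap2 * t ^ 2 * (β⁻¹) ^ 2 := by
            gcongr
            apply Real.rpow_le_self_of_le_one hkap2.le kap2_le
            rw [le_div_iff₀ (by linarith)]; linarith
    calc _ ≤ 4 * (Real.exp 1 ^ 2 * β ^ 2 * ((2 * MM) ^ 2 * (kap2 * t ^ 2 * (β⁻¹) ^ 2))) := by gcongr
      _ = kap * t ^ 2 := by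
          rw [kap2]; field_simp; norm_num

end S9


section S10
set_option linter.unusedSectionVars false
variable {n : ℕ} (μ : Measure (EE n)) [IsProbabilityMeasure μ] (B : EE n →L[ℝ] EE n)

/-- the seminorm `|Bx|` -/
def NB : Seminorm ℝ (EE n) := (normSeminorm ℝ (EE n)).comp (B : EE n →ₗ[ℝ] EE n)

lemma NB_apply (x : EE n) : NB B x = ‖B x‖ := rfl

lemma NB_meas : Measurable (NB B) := by
  have : (NB B : EE n → ℝ) = fun x => ‖B x‖ := rfl
  rw [this]; fun_prop

lemma real_le_of {Ω : Type*} [MeasurableSpace Ω] {P : Measure Ω} {s : Set Ω} {r : ℝ} (hr : 0 ≤ r)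
    (h : P s ≤ ENNReal.ofReal r) : P.real s ≤ r := ENNReal.toReal_le_of_le_ofReal hr h

lemma S9r {α b : ℝ} (H : Hyp μ B α b) (hα1 : 1 ≤ α) (hα2 : α ≤ 2) (m t : ℝ) (ht : 0 < t) (ht1 : t ≤ 1) :
    μ.real {x | tau B x ≤ m} * μ.real {x | m + t ≤ tau B x ∧ tau B x ≤ 3} ≤
      3000 * Real.exp (-(6 * c10 * DD B α b * t ^ (2 + α))) := by
  have h := S9 μ B H hα1 hα2 m t ht ht1
  rw [Measure.real, Measure.real, ← ENNReal.toReal_mul]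
  exact ENNReal.toReal_le_of_le_ofReal (by positivity) h

lemma exp6 : 401 < Real.exp 6 := by
  have h : Real.exp 6 = Real.exp 1 ^ 6 := by rw [← Real.exp_nat_mul]; norm_num
  rw [h]
  have h1 := Real.exp_one_gt_d9
  calc (401:ℝ) < 2.718 ^ 6 := by norm_num
    _ ≤ _ := by gcongr; linarith

lemma Hyp.DD_pos {α b : ℝ} (H : Hyp μ B α b) : 0 < DD B α b := by
  have := H.normB; have := H.hb
  unfold DD; positivity

lemma tau_le_iff (x : EE n) (a : ℝ) (ha : 0 < a) : tau B x ≤ Real.log a / 2 ↔ 1 + ‖B x‖ ^ 2 ≤ a := by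
  unfold tau
  rw [div_le_div_iff_of_pos_right (by norm_num), Real.log_le_log_iff (by positivity) ha]

lemma le_tau_iff (x : EE n) (a : ℝ) (ha : 0 < a) : Real.log a / 2 ≤ tau B x ↔ a ≤ 1 + ‖B x‖ ^ 2 := by
  unfold tau
  rw [div_le_div_iff_of_pos_right (by norm_num), Real.log_le_log_iff ha (by positivity)]

lemma S10shell {α b : ℝ} (H : Hyp μ B α b) (hα1 : 1 ≤ α) (hα2 : α ≤ 2) :
    μ {x | 7 ≤ NB B x ∧ NB B x ≤ 20} ≤ ENNReal.ofReal (4000 * Real.exp (-(6 * c10 * DD B α b))) := by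
  have h := S9r μ B H hα1 hα2 (Real.log 5 / 2) 1 one_pos le_rfl
  rw [Real.one_rpow, mul_one] at h
  have h2 : 3 / 4 ≤ μ.real {x | tau B x ≤ Real.log 5 / 2} := by
    have h3 := markov_sq (fun x => NB B x) (NB_meas B) H.hN2.le 2 (by norm_num)
    have h4 : μ.real {x | tau B x ≤ Real.log 5 / 2}ᶜ ≤ 1 / 4 := by
      apply real_le_of (by norm_num)
      refine le_trans (measure_mono ?_) (h3.trans (ENNReal.ofReal_le_ofReal (by norm_num)))
      intro x hx
      simp only [Set.mem_compl_iff, Set.mem_ofPred_eq, tau_le_iff B x 5 (by norm_num), not_le] at hx ⊢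
      rw [NB_apply]
      nlinarith [norm_nonneg (B x)]
    rw [probReal_compl_eq_one_sub (measurableSet_le (tau_meas B) measurable_const)] at h4
    linarith
  have h5 : μ.real {x | 7 ≤ NB B x ∧ NB B x ≤ 20} ≤ μ.real {x | Real.log 5 / 2 + 1 ≤ tau B x ∧ tau B x ≤ 3} := by
    apply measureReal_mono _ (measure_ne_top _ _)
    intro x hx
    simp only [Set.mem_ofPred_eq, NB_apply] at hx ⊢
    constructor
    · have e : Real.log 5 / 2 + 1 ≤ Real.log 50 / 2 := by
        have e1 : Real.log 50 = Real.log 5 + Real.log 10 := by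
          rw [← Real.log_mul (by norm_num) (by norm_num)]; norm_num
        have e2 : 2 ≤ Real.log 10 := by
          rw [Real.le_log_iff_exp_le (by norm_num)]
          have h : Real.exp 2 = Real.exp 1 ^ 2 := by rw [← Real.exp_nat_mul]; norm_num
          rw [h]
          have := Real.exp_one_lt_d9
          nlinarith [Real.exp_pos 1]
        linarith
      refine e.trans ?_
      rw [le_tau_iff B x 50 (by norm_num)]
      nlinarith [hx.1]
    · have := (tau_le_iff B x (Real.exp 6) (Real.exp_pos _)).2 (by nlinarith [hx.2, norm_nonneg (B x), exp6])
      rw [Real.log_exp] at this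
      linarith
  have h6 : μ.real {x | 7 ≤ NB B x ∧ NB B x ≤ 20} ≤ 4000 * Real.exp (-(6 * c10 * DD B α b)) := by
    have h7 : 0 ≤ μ.real {x | Real.log 5 / 2 + 1 ≤ tau B x ∧ tau B x ≤ 3} := measureReal_nonneg
    nlinarith
  rw [← ofReal_measureReal]
  exact ENNReal.ofReal_le_ofReal h6

lemma S10a {α b : ℝ} (H : Hyp μ B α b) (hα1 : 1 ≤ α) (hα2 : α ≤ 2) (u : ℝ) (hu : 1 ≤ u) :
    μ.real {x | 9 * u ≤ ‖B x‖} ≤ 2 * Real.exp (-(c10 * DD B α b * u)) := by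
  have hc := c10_pos
  have hD := H.DD_pos
  set D := DD B α b with hDD
  apply real_le_of (by positivity)
  by_cases hs : 18 ≤ 6 * c10 * D
  · have h1 := seminorm_tail H.hpl (NB B) (NB_meas B) H.hN2.le u hu
    refine h1.trans ?_
    rw [ENNReal.ofReal_mul (by norm_num), ENNReal.ofReal_ofNat]
    refine mul_le_mul_right ?_ _
    have h2 : 2 * μ {x | 7 ≤ NB B x ∧ NB B x ≤ 20} ≤ ENNReal.ofReal (Real.exp (-(3 * c10 * D))) := by
      calc _ ≤ 2 * ENNReal.ofReal (4000 * Real.exp (-(6 * c10 * D))) :=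
            mul_le_mul_right (S10shell μ B H hα1 hα2) _
        _ = ENNReal.ofReal (8000 * Real.exp (-(6 * c10 * D))) := by
            rw [← ENNReal.ofReal_ofNat, ← ENNReal.ofReal_mul (by norm_num)]; congr 1; ring
        _ ≤ _ := by
            apply ENNReal.ofReal_le_ofReal
            have h3 : (8000:ℝ) ≤ Real.exp 9 := by
              have h : Real.exp 9 = Real.exp 1 ^ 9 := by rw [← Real.exp_nat_mul]; norm_num
              rw [h]
              have h1 := Real.exp_one_gt_d9
              calc (8000:ℝ) ≤ 2.718 ^ 9 := by norm_num
                _ ≤ _ := by gcongr; linarith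
            calc _ ≤ Real.exp 9 * Real.exp (-(6 * c10 * D)) := by gcongr
              _ = Real.exp (9 - 6 * c10 * D) := by rw [← Real.exp_add]; congr 1
              _ ≤ _ := by apply Real.exp_le_exp.2; linarith
    calc _ ≤ (ENNReal.ofReal (Real.exp (-(3 * c10 * D)))) ^ u := ENNReal.rpow_le_rpow h2 (by linarith)
      _ = ENNReal.ofReal (Real.exp (-(3 * c10 * D) * u)) := by
          rw [ENNReal.ofReal_rpow_of_pos (Real.exp_pos _), ← Real.exp_mul]
      _ ≤ _ := by
          apply ENNReal.ofReal_le_ofReal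
          apply Real.exp_le_exp.2
          have : 0 < c10 * D * u := by positivity
          nlinarith
  · push Not at hs
    refine (seminorm_tail' H.hpl (NB B) (NB_meas B) H.hN2.le u hu).trans ?_
    apply ENNReal.ofReal_le_ofReal
    gcongr
    have h1 : (2/49 : ℝ) ≤ Real.exp (-3) := by
      rw [Real.exp_neg, show (2/49:ℝ) = (49/2)⁻¹ by norm_num]
      have h : Real.exp 3 = Real.exp 1 ^ 3 := by rw [← Real.exp_nat_mul]; norm_num
      have h2 := Real.exp_one_lt_d9
      have : Real.exp 3 ≤ 49 / 2 := by
        rw [h]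
        calc _ ≤ (2.7183:ℝ) ^ 3 := by gcongr; linarith
          _ ≤ _ := by norm_num
      gcongr
    calc _ ≤ (Real.exp (-3)) ^ u := by gcongr
      _ = Real.exp (-3 * u) := by rw [← Real.exp_mul]
      _ ≤ _ := by
          apply Real.exp_le_exp.2
          nlinarith

lemma S10b {α b : ℝ} (H : Hyp μ B α b) (hα1 : 1 ≤ α) (hα2 : α ≤ 2) (m t : ℝ) (ht : 0 < t) (ht1 : t ≤ 1) :
    μ.real {x | tau B x ≤ m} * μ.real {x | m + t ≤ tau B x} ≤ 3002 * Real.exp (-(c10 * DD B α b * t ^ (2 + α))) := by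
  have hc := c10_pos
  have hD := H.DD_pos
  set D := DD B α b with hDD
  have htp : 0 < t ^ (2 + α) := by positivity
  have htp1 : t ^ (2 + α) ≤ 1 := Real.rpow_le_one ht.le ht1 (by linarith)
  have h1 := S9r μ B H hα1 hα2 m t ht ht1
  have h2 := S10a μ B H hα1 hα2 2 (by norm_num)
  rw [← hDD] at h1 h2
  have h3 : μ.real {x | m + t ≤ tau B x} ≤ μ.real {x | m + t ≤ tau B x ∧ tau B x ≤ 3} + μ.real {x | 9 * 2 ≤ ‖B x‖} := by
    refine le_trans (measureReal_mono ?_ (measure_ne_top _ _)) (measureReal_union_le _ _)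
    intro x hx
    by_cases h : tau B x ≤ 3
    · exact Or.inl ⟨hx, h⟩
    · right
      have := (tau_le_iff B x (Real.exp 6) (Real.exp_pos _)).not
      rw [Real.log_exp] at this
      norm_num at this
      have := this.1 (by linarith)
      simp only [Set.mem_ofPred_eq]
      nlinarith [exp6, norm_nonneg (B x)]
  have h4 : μ.real {x | tau B x ≤ m} ≤ 1 := measureReal_le_one
  have h40 : 0 ≤ μ.real {x | tau B x ≤ m} := measureReal_nonneg
  have h5 : Real.exp (-(6 * c10 * D * t ^ (2 + α))) ≤ Real.exp (-(c10 * D * t ^ (2 + α))) := by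
    apply Real.exp_le_exp.2
    have : 0 < c10 * D * t ^ (2 + α) := by positivity
    linarith
  have h6 : Real.exp (-(c10 * D * 2)) ≤ Real.exp (-(c10 * D * t ^ (2 + α))) := by
    apply Real.exp_le_exp.2
    have : 0 < c10 * D := by positivity
    nlinarith
  have h7 : 0 ≤ μ.real {x | 9 * 2 ≤ ‖B x‖} := measureReal_nonneg
  nlinarith

end S10


section Gau
set_option linter.unusedSectionVars false

lemma chern (n : ℕ) (s a : ℝ) (hs : |s| ≤ 1 / 4) (w : EE n) :
    (gam n) {g | s * a ≤ s * ‖w + g‖ ^ 2} ≤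
      ENNReal.ofReal (Real.exp (n * (s + 4 * s ^ 2) + s * ‖w‖ ^ 2 + 4 * s ^ 2 * ‖w‖ ^ 2 - s * a)) := by
  obtain ⟨hs1, hs2⟩ := abs_le.1 hs
  have h2s : 0 < 1 - 2 * s := by linarith
  have h0 := mul_meas_ge_le_lintegral (μ := gam n) (f := fun g => ENNReal.ofReal (Real.exp (s * ‖w + g‖ ^ 2)))
    (by fun_prop) (ENNReal.ofReal (Real.exp (s * a)))
  have e : {g : EE n | ENNReal.ofReal (Real.exp (s * a)) ≤ ENNReal.ofReal (Real.exp (s * ‖w + g‖ ^ 2))} =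
      {g | s * a ≤ s * ‖w + g‖ ^ 2} := by
    ext g
    simp only [Set.mem_ofPred_eq]
    rw [ENNReal.ofReal_le_ofReal_iff (Real.exp_pos _).le, Real.exp_le_exp]
  rw [e, gam_exp_sq n s (by linarith) w] at h0
  calc _ = ENNReal.ofReal (Real.exp (-(s * a))) * (ENNReal.ofReal (Real.exp (s * a)) *
        (gam n) {g | s * a ≤ s * ‖w + g‖ ^ 2}) := by
        rw [← mul_assoc, ← ENNReal.ofReal_mul (by positivity), ← Real.exp_add]; simp
    _ ≤ _ := mul_le_mul_right h0 _
    _ ≤ _ := by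
        rw [← ENNReal.ofReal_mul (by positivity)]
        apply ENNReal.ofReal_le_ofReal
        rw [Real.rpow_def_of_pos h2s, ← Real.exp_add, ← Real.exp_add]
        apply Real.exp_le_exp.2
        have h1 := Real.one_sub_inv_le_log_of_pos h2s
        have h3 : -(Real.log (1 - 2 * s)) ≤ 2 * s + 8 * s ^ 2 := by
          have : 1 - (1 - 2 * s)⁻¹ = -(2 * s) - (2 * s) ^ 2 * (1 - 2 * s)⁻¹ := by field_simp; ring
          have h4 : (1 - 2 * s)⁻¹ ≤ 2 := by
            rw [inv_le_comm₀ h2s (by norm_num)]; linarith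
          nlinarith [sq_nonneg s]
        have h5 : s * ‖w‖ ^ 2 / (1 - 2 * s) ≤ s * ‖w‖ ^ 2 + 4 * s ^ 2 * ‖w‖ ^ 2 := by
          rw [div_le_iff₀ h2s]
          have : 0 ≤ ‖w‖ ^ 2 * s ^ 2 := by positivity
          nlinarith
        have h6 : Real.log (1 - 2 * s) * (-(n:ℝ) / 2) ≤ n * (s + 4 * s ^ 2) := by
          have : (0:ℝ) ≤ n := by positivity
          nlinarith
        linarith

/-- The normalized squared norm. -/
def ZV {n : ℕ} (B : EE n →L[ℝ] EE n) (z : EE n × EE n) : ℝ := ‖√(n:ℝ) • B z.1 + z.2‖ ^ 2 / (2 * n)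

lemma ZV_meas {n : ℕ} (B : EE n →L[ℝ] EE n) : Measurable (ZV B) := by unfold ZV; fun_prop
lemma ZV_nonneg {n : ℕ} (B : EE n →L[ℝ] EE n) (z) : 0 ≤ ZV B z := by unfold ZV; positivity

lemma dev (n : ℕ) (hn : 1 ≤ n) (B : EE n →L[ℝ] EE n) (x : EE n) (hx : ‖B x‖ < 18) (t σ : ℝ) (ht : 0 < t) (ht1 : t ≤ 1)
    (hσ : σ = 1 ∨ σ = -1) :
    (gam n) {g | σ * ((1 + ‖B x‖ ^ 2) / 2 + σ * t) ≤ σ * ZV B (x, g)} ≤ ENNReal.ofReal (Real.exp (-(n * t ^ 2 / 1300))) := by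
  have hn' : (1:ℝ) ≤ n := by exact_mod_cast hn
  have hw : ‖√(n:ℝ) • B x‖ ^ 2 = n * ‖B x‖ ^ 2 := by
    rw [norm_smul, mul_pow, Real.norm_of_nonneg (by positivity), Real.sq_sqrt (by positivity)]
  have hσ2 : σ ^ 2 = 1 := by rcases hσ with h | h <;> rw [h] <;> norm_num
  have habs : |σ| = 1 := by rcases hσ with h | h <;> rw [h] <;> norm_num
  have h := chern n (σ * t / 1300) (2 * n * ((1 + ‖B x‖ ^ 2) / 2 + σ * t))
    (by rw [abs_div, abs_mul, habs, abs_of_pos ht]; norm_num; linarith) (√(n:ℝ) • B x)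
  refine le_trans (measure_mono ?_) (h.trans (ENNReal.ofReal_le_ofReal (Real.exp_le_exp.2 ?_)))
  · intro g hg
    simp only [Set.mem_ofPred_eq, ZV] at hg ⊢
    have h2 : ‖√(n:ℝ) • B x + g‖ ^ 2 = 2 * n * (‖√(n:ℝ) • B x + g‖ ^ 2 / (2 * n)) := by field_simp
    rw [h2]
    have h3 := mul_le_mul_of_nonneg_left hg (show 0 ≤ t / 1300 * (2 * n) by positivity)
    nlinarith
  · rw [hw]
    have hN : ‖B x‖ ^ 2 ≤ 324 := by nlinarith [norm_nonneg (B x)]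
    have e : (n:ℝ) * (σ * t / 1300 + 4 * (σ * t / 1300) ^ 2) + σ * t / 1300 * (n * ‖B x‖ ^ 2) +
        4 * (σ * t / 1300) ^ 2 * (n * ‖B x‖ ^ 2) - σ * t / 1300 * (2 * n * ((1 + ‖B x‖ ^ 2) / 2 + σ * t)) =
        n * t ^ 2 * σ ^ 2 * ((4 + 4 * ‖B x‖ ^ 2) / 1300 ^ 2 - 2 / 1300) := by ring
    rw [e, hσ2]
    have : 0 ≤ n * t ^ 2 := by positivity
    nlinarith

end Gau


section Conc
set_option linter.unusedSectionVars false
variable {n : ℕ} (μ : Measure (EE n)) [IsProbabilityMeasure μ] (B : EE n →L[ℝ] EE n)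

lemma Hyp.DD_le {α b : ℝ} (H : Hyp μ B α b) (hα1 : 1 ≤ α) (hα2 : α ≤ 2) (hn : 1 ≤ n) : DD B α b ≤ 4 * n := by
  have hn' : (1:ℝ) ≤ n := by exact_mod_cast hn
  have hBp := H.normB
  have hb0 := H.hb
  have hb : 1 / 2 ≤ b := by
    have h1 := H.hpsi 2 le_rfl (EuclideanSpace.basisFun (Fin n) ℝ ⟨0, hn⟩)
    have h2 := H.hiso (EuclideanSpace.basisFun (Fin n) ℝ ⟨0, hn⟩)
    have e : ‖(EuclideanSpace.basisFun (Fin n) ℝ) ⟨0, hn⟩‖ = 1 := by simp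
    rw [e] at h1 h2
    simp only [Real.rpow_two, sq_abs] at h1
    rw [h2, ENNReal.ofReal_le_ofReal_iff (by positivity)] at h1
    have h3 : (2:ℝ) ^ (1 / α) ≤ 2 := by
      calc (2:ℝ) ^ (1 / α) ≤ 2 ^ (1:ℝ) := Real.rpow_le_rpow_of_exponent_le (by norm_num) (by
            rw [div_le_one (by linarith)]; exact hα1)
        _ = 2 := by simp
    have h4 : (0:ℝ) < 2 ^ (1 / α) := by positivity
    have h5 : 1 ≤ b * 2 ^ (1 / α) * 1 := by
      by_contra h; push Not at h
      have : 0 < b * 2 ^ (1 / α) * 1 := by positivity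
      nlinarith
    nlinarith
  have hBn : (√(n:ℝ))⁻¹ ≤ ‖B‖ := by
    have h1 : (1:ℝ) ≤ n * ‖B‖ ^ 2 := by
      calc (1:ℝ) = ∑ j, ‖B (EuclideanSpace.basisFun (Fin n) ℝ j)‖ ^ 2 := H.hB.symm
        _ ≤ ∑ j : Fin n, ‖B‖ ^ 2 := by
            apply Finset.sum_le_sum
            intro j _
            have := B.le_opNorm (EuclideanSpace.basisFun (Fin n) ℝ j)
            have e : ‖(EuclideanSpace.basisFun (Fin n) ℝ) j‖ = 1 := by simp
            rw [e, mul_one] at this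
            gcongr
        _ = _ := by simp
    have hs : 0 < √(n:ℝ) := by positivity
    rw [inv_le_iff_one_le_mul₀ hs]
    have hq : √(n:ℝ) ^ 2 = n := Real.sq_sqrt (by positivity)
    rw [← hq] at h1
    by_contra h; push Not at h
    have : 0 < ‖B‖ * √(n:ℝ) := by positivity
    nlinarith
  have h1 : (b * ‖B‖)⁻¹ ≤ 2 * √(n:ℝ) := by
    have hs : 0 < √(n:ℝ) := by positivity
    calc (b * ‖B‖)⁻¹ ≤ (1 / 2 * (√(n:ℝ))⁻¹)⁻¹ := by gcongr
      _ = _ := by field_simp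
  have h2 : 1 ≤ 2 * √(n:ℝ) := by
    have := Real.one_le_sqrt.2 hn'
    linarith
  unfold DD
  calc ((b * ‖B‖)⁻¹) ^ α ≤ (2 * √(n:ℝ)) ^ α := by gcongr
    _ ≤ (2 * √(n:ℝ)) ^ (2:ℝ) := Real.rpow_le_rpow_of_exponent_le h2 hα2
    _ = 4 * n := by rw [Real.rpow_two, mul_pow, Real.sq_sqrt (by positivity)]; norm_num

lemma prodb (hn : 1 ≤ n) (q s σ : ℝ) (hs : 0 < s) (hs1 : s ≤ 1) (hσ : σ = 1 ∨ σ = -1) :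
    (μ.prod (gam n)).real {z | σ * q ≤ σ * ZV B z} ≤ μ.real {x | σ * q - s ≤ σ * ((1 + ‖B x‖ ^ 2) / 2)} +
      (μ.real {x | 18 ≤ ‖B x‖} + Real.exp (-(n * s ^ 2 / 1300))) := by
  apply real_le_of (by positivity)
  have hσ2 : σ ^ 2 = 1 := by rcases hσ with h | h <;> rw [h] <;> norm_num
  have hm : MeasurableSet {z | σ * q ≤ σ * ZV B z} :=
    measurableSet_le measurable_const ((ZV_meas B).const_mul σ)
  have hm1 : MeasurableSet {x | σ * q - s ≤ σ * ((1 + ‖B x‖ ^ 2) / 2)} := 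
    measurableSet_le measurable_const (by fun_prop)
  have hm2 : MeasurableSet {x | 18 ≤ ‖B x‖} := measurableSet_le measurable_const (by fun_prop)
  rw [Measure.prod_apply hm, ENNReal.ofReal_add (by positivity) (by positivity),
    ENNReal.ofReal_add (by positivity) (by positivity), ofReal_measureReal, ofReal_measureReal]
  calc _ ≤ ∫⁻ x, ({x | σ * q - s ≤ σ * ((1 + ‖B x‖ ^ 2) / 2)}.indicator 1 x + ({x | 18 ≤ ‖B x‖}.indicator 1 x +
          ENNReal.ofReal (Real.exp (-(n * s ^ 2 / 1300))))) ∂μ := by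
        apply lintegral_mono
        intro x
        by_cases h1 : x ∈ {x | σ * q - s ≤ σ * ((1 + ‖B x‖ ^ 2) / 2)}
        · refine le_trans prob_le_one ?_
          beta_reduce
          rw [Set.indicator_of_mem h1]; exact le_self_add
        by_cases h2 : x ∈ {x | 18 ≤ ‖B x‖}
        · refine le_trans prob_le_one ?_
          beta_reduce
          rw [Set.indicator_of_mem h2]
          exact le_trans le_self_add le_add_self
        simp only [Set.mem_ofPred_eq, not_le] at h1 h2
        refine le_trans (le_trans (measure_mono ?_) (dev n hn B x h2 s σ hs hs1 hσ)) (le_trans le_add_self le_add_self)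
        intro g hg
        simp only [Set.mem_preimage, Set.mem_ofPred_eq] at hg ⊢
        nlinarith
    _ = _ := by
        rw [lintegral_add_left (measurable_one.indicator hm1), lintegral_add_left (measurable_one.indicator hm2),
          lintegral_indicator_one hm1, lintegral_indicator_one hm2]
        simp

lemma combo (p p' a a' e : ℝ) (f1 : p ≤ a + e) (f2 : p' ≤ a' + e) (hp0 : 0 ≤ p) (hp0' : 0 ≤ p')
    (hp1 : p ≤ 1) (hp1' : p' ≤ 1) (ha0 : 0 ≤ a) (ha0' : 0 ≤ a') (he : 0 ≤ e) : p * p' ≤ a * a' + 2 * e := by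
  have h0 := mul_nonneg ha0 ha0'
  by_cases hc : p ≤ e
  · nlinarith
  by_cases hc' : p' ≤ e
  · nlinarith
  push Not at hc hc'
  have : (p - e) * (p' - e) ≤ a * a' := mul_le_mul (by linarith) (by linarith) (by linarith) ha0
  nlinarith

def c13 : ℝ := c10 / 2000 ^ 4
lemma c13_pos : 0 < c13 := by have := c10_pos; unfold c13; positivity

set_option maxHeartbeats 800000 in
lemma S13 {α b : ℝ} (H : Hyp μ B α b) (hα1 : 1 ≤ α) (hα2 : α ≤ 2) (hn : 1 ≤ n) (m t : ℝ) (ht : 0 < t) (ht1 : t ≤ 1) :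
    (μ.prod (gam n)).real {z | ZV B z ≤ m} * (μ.prod (gam n)).real {z | m + t ≤ ZV B z} ≤
      4000 * Real.exp (-(c13 * DD B α b * t ^ (2 + α))) := by
  have hD := H.DD_pos
  have hDn := H.DD_le μ B hα1 hα2 hn
  set D := DD B α b with hDdef
  have hc0 := c10_pos
  have hc1 := c10_le
  have hu : (0:ℝ) < t ^ (2 + α) := by positivity
  have hu2 : t ^ (2 + α) ≤ t ^ 2 := by
    rw [← Real.rpow_two]
    exact Real.rpow_le_rpow_of_exponent_ge ht ht1 (by linarith)
  have hu1 : t ^ (2 + α) ≤ 1 := Real.rpow_le_one ht.le ht1 (by linarith)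
  set E := Real.exp (-(c13 * D * t ^ (2 + α))) with hE
  have hE0 : 0 < E := Real.exp_pos _
  have hc13 : c13 ≤ c10 / 1000000 := by unfold c13; norm_num; linarith
  have hc130 := c13_pos
  have e1 : μ.real {x | 18 ≤ ‖B x‖} ≤ 2 * E := by
    have h := S10a μ B H hα1 hα2 2 (by norm_num)
    norm_num at h
    refine h.trans ?_
    rw [hE]
    refine mul_le_mul_of_nonneg_left (Real.exp_le_exp.2 (neg_le_neg ?_)) (by norm_num)
    have : c13 * D * t ^ (2 + α) ≤ c10 * D * t ^ (2 + α) := by gcongr; linarith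
    have : c10 * D * t ^ (2 + α) ≤ c10 * D * 1 := by gcongr
    have : 0 < c10 * D := by positivity
    linarith
  have e2 : Real.exp (-(n * (t / 3) ^ 2 / 1300)) ≤ E := by
    rw [hE]; gcongr
    calc c13 * D * t ^ (2 + α) ≤ (1 / 480 / 1000000) * (4 * n) * t ^ 2 := by
          gcongr; linarith
      _ ≤ _ := by 
          have : 0 ≤ (n:ℝ) * t ^ 2 := by positivity
          nlinarith
  have h1 := prodb μ B hn m (t / 3) (-1) (by linarith) (by linarith) (Or.inr rfl)
  have h2 := prodb μ B hn (m + t) (t / 3) 1 (by linarith) (by linarith) (Or.inl rfl)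
  have s1 : {z | (-1) * m ≤ (-1) * ZV B z} = {z | ZV B z ≤ m} := by ext z; simp
  have s2 : {z | 1 * (m + t) ≤ 1 * ZV B z} = {z | m + t ≤ ZV B z} := by ext z; simp
  rw [s1] at h1
  rw [s2] at h2
  set a := μ.real {x | -1 * m - t / 3 ≤ -1 * ((1 + ‖B x‖ ^ 2) / 2)} with ha
  set a' := μ.real {x | 1 * (m + t) - t / 3 ≤ 1 * ((1 + ‖B x‖ ^ 2) / 2)} with ha'
  set p := (μ.prod (gam n)).real {z | ZV B z ≤ m}
  set p' := (μ.prod (gam n)).real {z | m + t ≤ ZV B z}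
  have hp1 : p ≤ 1 := measureReal_le_one
  have hp1' : p' ≤ 1 := measureReal_le_one
  have ha1 : a ≤ 1 := measureReal_le_one
  have ha1' : a' ≤ 1 := measureReal_le_one
  have hp0 : 0 ≤ p := measureReal_nonneg
  have hp0' : 0 ≤ p' := measureReal_nonneg
  have ha0 : 0 ≤ a := measureReal_nonneg
  have ha0' : 0 ≤ a' := measureReal_nonneg
  have key : a * a' ≤ 3002 * E := by
    by_cases hq : m + t / 3 < 1 / 2
    · have : a = 0 := by
        rw [ha]
        have : {x : EE n | -1 * m - t / 3 ≤ -1 * ((1 + ‖B x‖ ^ 2) / 2)} = ∅ := by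
          ext x; simp only [Set.mem_ofPred_eq, Set.mem_empty_iff_false, iff_false]
          nlinarith [sq_nonneg ‖B x‖]
        rw [this]; simp
      rw [this]; simp; positivity
    by_cases hq2 : 200 ≤ m + t / 3
    · have : a' ≤ μ.real {x | 18 ≤ ‖B x‖} := by
        apply measureReal_mono _ (measure_ne_top _ _)
        intro x hx
        simp only [Set.mem_ofPred_eq] at hx ⊢
        nlinarith [norm_nonneg (B x)]
      nlinarith
    push Not at hq hq2
    set q := m + t / 3 with hqd
    have hb := S10b μ B H hα1 hα2 (Real.log (2 * q) / 2) (t / 2000) (by positivity) (by linarith)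
    have hlog : Real.log (2 * q) / 2 + t / 2000 ≤ Real.log (2 * q + 2 * t / 3) / 2 := by
      have hpos : 0 < (2 * q + 2 * t / 3) / (2 * q) := by positivity
      have h := Real.one_sub_inv_le_log_of_pos hpos
      rw [Real.log_div (by positivity) (by positivity)] at h
      have : t / 1000 ≤ 1 - ((2 * q + 2 * t / 3) / (2 * q))⁻¹ := by
        have e : 1 - ((2 * q + 2 * t / 3) / (2 * q))⁻¹ = t / (3 * q + t) := by field_simp; ring
        rw [e]
        gcongr; linarith
      linarith
    have i1 : a ≤ μ.real {x | tau B x ≤ Real.log (2 * q) / 2} := by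
      apply measureReal_mono _ (measure_ne_top _ _)
      intro x hx
      simp only [Set.mem_ofPred_eq] at hx ⊢
      rw [tau_le_iff _ _ _ (by positivity)]
      linarith
    have i2 : a' ≤ μ.real {x | Real.log (2 * q) / 2 + t / 2000 ≤ tau B x} := by
      apply measureReal_mono _ (measure_ne_top _ _)
      intro x hx
      simp only [Set.mem_ofPred_eq] at hx ⊢
      refine hlog.trans ?_
      rw [le_tau_iff _ _ _ (by positivity)]
      linarith
    calc a * a' ≤ _ := mul_le_mul i1 i2 ha0' measureReal_nonneg
      _ ≤ _ := hb
      _ ≤ _ := by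
        rw [hE]
        refine mul_le_mul_of_nonneg_left (Real.exp_le_exp.2 (neg_le_neg ?_)) (by norm_num)
        rw [Real.div_rpow ht.le (by norm_num)]
        have : (2000:ℝ) ^ (2 + α) ≤ 2000 ^ 4 := by
          rw [← Real.rpow_natCast]
          exact Real.rpow_le_rpow_of_exponent_le (by norm_num) (by norm_num; linarith)
        rw [← hDdef]
        have h3 : c13 * D * t ^ (2 + α) = c10 * D * (t ^ (2 + α) / 2000 ^ 4) := by unfold c13; ring
        rw [h3]
        gcongr
  have f1 : p ≤ a + 3 * E := by linarith
  have f2 : p' ≤ a' + 3 * E := by linarith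
  have k1 := combo p p' a a' (3 * E) f1 f2 hp0 hp0' hp1 hp1' ha0 ha0' (by positivity)
  linarith

end Conc


section Mom
set_option linter.unusedSectionVars false

lemma g1 (w : ℝ) : ∫⁻ x, ENNReal.ofReal ((w + x) ^ 2) ∂(gaussianReal 0 1) = ENNReal.ofReal (w ^ 2 + 1) := by
  have e : ∫⁻ x, ENNReal.ofReal ((w + x) ^ 2) ∂(gaussianReal 0 1) = ∫⁻ x, ENNReal.ofReal (x ^ 2) ∂(gaussianReal w 1) := by
    have h := gaussianReal_map_const_add (μ := 0) (v := 1) w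
    rw [zero_add] at h
    rw [← h, lintegral_map (by fun_prop) (by fun_prop)]
  have hm : MemLp (id : ℝ → ℝ) 2 (gaussianReal w 1) := memLp_id_gaussianReal 2
  have hi : Integrable (fun x : ℝ => x ^ 2) (gaussianReal w 1) := hm.integrable_sq
  rw [e, ← ofReal_integral_eq_lintegral_ofReal hi (ae_of_all _ fun x => sq_nonneg x)]
  have h1 := variance_eq_sub hm
  rw [variance_id_gaussianReal] at h1
  simp only [Pi.pow_apply, id_eq, integral_id_gaussianReal] at h1
  congr 1
  have : ((1:ℝ≥0):ℝ) = 1 := rfl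
  rw [this] at h1
  linarith

lemma gsq (n : ℕ) (w : EE n) : ∫⁻ g, ENNReal.ofReal (‖w + g‖ ^ 2) ∂(gam n) = ENNReal.ofReal (‖w‖ ^ 2 + n) := by
  have h : ∀ g : EE n, ENNReal.ofReal (‖w + g‖ ^ 2) =
      ∑ j, ENNReal.ofReal ((w j + ⟪EuclideanSpace.basisFun (Fin n) ℝ j, g⟫) ^ 2) := by
    intro g
    rw [← ENNReal.ofReal_sum_of_nonneg (fun _ _ => sq_nonneg _), EuclideanSpace.real_norm_sq_eq]
    congr 1
    apply Finset.sum_congr rfl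
    intro j _
    simp [EuclideanSpace.inner_single_left]
  simp_rw [h]
  rw [lintegral_finsetSum _ (fun j _ => by fun_prop)]
  have h2 : ∀ j, ∫⁻ g, ENNReal.ofReal ((w j + ⟪EuclideanSpace.basisFun (Fin n) ℝ j, g⟫) ^ 2) ∂(gam n) =
      ENNReal.ofReal ((w j) ^ 2 + 1) := by
    intro j
    have h3 := gam_lintegral_inner n (EuclideanSpace.basisFun (Fin n) ℝ j) (fun x => ENNReal.ofReal ((w j + x) ^ 2)) (by fun_prop)
    rw [h3, ← g1]
    simp
  simp_rw [h2]
  rw [← ENNReal.ofReal_sum_of_nonneg (fun _ _ => by positivity), EuclideanSpace.real_norm_sq_eq]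
  congr 1
  rw [Finset.sum_add_distrib]; simp

variable {n : ℕ} (μ : Measure (EE n)) [IsProbabilityMeasure μ] (B : EE n →L[ℝ] EE n)

lemma nw (x : EE n) : ‖√(n:ℝ) • B x‖ ^ 2 = n * ‖B x‖ ^ 2 := by
  rw [norm_smul, mul_pow, Real.norm_of_nonneg (by positivity), Real.sq_sqrt (by positivity)]

lemma EZ {α b : ℝ} (H : Hyp μ B α b) (hn : 1 ≤ n) : ∫⁻ z, ENNReal.ofReal (ZV B z) ∂(μ.prod (gam n)) = 1 := by
  have hn' : (1:ℝ) ≤ n := by exact_mod_cast hn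
  have hm := ZV_meas B
  rw [lintegral_prod _ (by fun_prop)]
  have h : ∀ x, ∫⁻ g, ENNReal.ofReal (ZV B (x, g)) ∂(gam n) =
      ENNReal.ofReal (1 / 2) * ENNReal.ofReal (‖B x‖ ^ 2) + ENNReal.ofReal (1 / 2) := by
    intro x
    have e : ∀ g, ENNReal.ofReal (ZV B (x, g)) = ENNReal.ofReal (1 / (2 * n)) * ENNReal.ofReal (‖√(n:ℝ) • B x + g‖ ^ 2) := by
      intro g
      rw [← ENNReal.ofReal_mul (by positivity), ZV]; congr 1; ring
    simp_rw [e]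
    rw [lintegral_const_mul _ (by fun_prop), gsq, nw, ← ENNReal.ofReal_mul (by positivity), ← ENNReal.ofReal_mul (by positivity),
      ← ENNReal.ofReal_add (by positivity) (by positivity)]
    congr 1
    field_simp
  simp_rw [h]
  rw [lintegral_add_left (by fun_prop), lintegral_const_mul _ (by fun_prop), H.hN2]
  simp only [lintegral_const, measure_univ, mul_one]
  rw [← ENNReal.ofReal_add (by positivity) (by positivity)]
  norm_num

def K4 : ℝ := 8 * (40320 * 9 ^ 8) * 100 + 8 * (24 * 4 ^ 4) * 3
lemma K4_pos : 0 < K4 := by unfold K4; positivity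

lemma EZ4 {α b : ℝ} (H : Hyp μ B α b) (hn : 1 ≤ n) :
    ∫⁻ z, ENNReal.ofReal (ZV B z ^ 4) ∂(μ.prod (gam n)) ≤ ENNReal.ofReal K4 := by
  have hn' : (1:ℝ) ≤ n := by exact_mod_cast hn
  have hm := ZV_meas B
  have pt : ∀ z, ENNReal.ofReal (ZV B z ^ 4) ≤ ENNReal.ofReal (8 * (40320 * 9 ^ 8)) * ENNReal.ofReal (Real.exp (NB B z.1 / 9)) +
      ENNReal.ofReal (8 * (24 * 4 ^ 4)) * ENNReal.ofReal (Real.exp (1 / (4 * n) * ‖0 + z.2‖ ^ 2)) := by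
    intro z
    rw [← ENNReal.ofReal_mul (by positivity), ← ENNReal.ofReal_mul (by positivity),
      ← ENNReal.ofReal_add (by positivity) (by positivity)]
    apply ENNReal.ofReal_le_ofReal
    rw [NB_apply, zero_add]
    set a := ‖B z.1‖ with ha
    have ha0 : 0 ≤ a := norm_nonneg _
    set y := ‖z.2‖ ^ 2 / n with hy
    have hy0 : 0 ≤ y := by positivity
    have h1 : ZV B z ≤ a ^ 2 + y := by
      unfold ZV
      rw [div_le_iff₀ (by positivity)]
      have h2 := norm_add_le (√(n:ℝ) • B z.1) z.2
      have h3 : ‖√(n:ℝ) • B z.1 + z.2‖ ^ 2 ≤ (‖√(n:ℝ) • B z.1‖ + ‖z.2‖) ^ 2 := by gcongr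
      have h4 := nw B z.1
      have h5 : (a ^ 2 + y) * (2 * n) = 2 * (n * a ^ 2) + 2 * ‖z.2‖ ^ 2 := by rw [hy]; field_simp
      rw [h5, ha, ← h4]
      nlinarith [sq_nonneg (‖√(n:ℝ) • B z.1‖ - ‖z.2‖)]
    have h6 := Real.pow_div_factorial_le_exp (a / 9) (by positivity) 8
    have h7 := Real.pow_div_factorial_le_exp (y / 4) (by positivity) 4
    have e1 : Nat.factorial 8 = 40320 := rfl
    have e2 : Nat.factorial 4 = 24 := rfl
    rw [e1] at h6
    rw [e2] at h7
    push_cast at h6 h7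
    have h8 : ZV B z ^ 4 ≤ (a ^ 2 + y) ^ 4 := by
      have := ZV_nonneg B z
      gcongr
    have h9 : (a ^ 2 + y) ^ 4 ≤ 8 * ((a ^ 2) ^ 4 + y ^ 4) := by
      have := add_pow_le (sq_nonneg a) hy0 4
      norm_num at this
      linarith
    have e3 : 1 / (4 * (n:ℝ)) * ‖z.2‖ ^ 2 = y / 4 := by rw [hy]; ring
    rw [e3]
    have e4 : (a ^ 2) ^ 4 = 40320 * 9 ^ 8 * ((a / 9) ^ 8 / 40320) := by ring
    have e5 : y ^ 4 = 24 * 4 ^ 4 * ((y / 4) ^ 4 / 24) := by ring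
    nlinarith
  refine (lintegral_mono pt).trans ?_
  have hNm := NB_meas B
  rw [lintegral_prod _ (by fun_prop)]
  have hg : ∫⁻ g : EE n, ENNReal.ofReal (Real.exp (1 / (4 * n) * ‖0 + g‖ ^ 2)) ∂(gam n) ≤ ENNReal.ofReal 3 := by
    have hs : (1:ℝ) / (4 * n) ≤ 1 / 4 := by
      apply one_div_le_one_div_of_le <;> linarith
    rw [gam_exp_sq n _ (by linarith)]
    apply ENNReal.ofReal_le_ofReal
    have e : 1 - 2 * (1 / (4 * (n:ℝ))) = 1 - 1 / (2 * n) := by field_simp; ring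
    have hs2 : (1:ℝ) / (2 * n) ≤ 1 / 2 := by
      apply one_div_le_one_div_of_le <;> linarith
    have h0 : 0 < 1 - 1 / (2 * (n:ℝ)) := by linarith
    have h1 := Real.one_sub_inv_le_log_of_pos h0
    rw [e, Real.rpow_def_of_pos h0]
    simp only [norm_zero, ne_eq, OfNat.ofNat_ne_zero, not_false_eq_true, zero_pow, mul_zero, zero_div, Real.exp_zero, mul_one]
    have h2 : -(2 / (2 * n)) ≤ Real.log (1 - 1 / (2 * (n:ℝ))) := by
      refine le_trans ?_ h1
      have e : 1 - (1 - 1 / (2 * (n:ℝ)))⁻¹ = - ((1 / (2 * n)) * (1 - 1 / (2 * (n:ℝ)))⁻¹) := by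
        generalize 1 / (2 * (n:ℝ)) = r at h0
        field_simp; ring
      rw [e]
      have h4 : (1 - 1 / (2 * (n:ℝ)))⁻¹ ≤ 2 := by
        rw [inv_le_comm₀ h0 (by norm_num)]; linarith
      have : 0 < 1 / (2 * (n:ℝ)) := by positivity
      have e2 : 2 / (2 * (n:ℝ)) = 1 / (2 * n) * 2 := by ring
      rw [e2]
      nlinarith
    have h3 : Real.log (1 - 1 / (2 * (n:ℝ))) * (-n / 2) ≤ 1 := by
      have := mul_le_mul_of_nonneg_right h2 (show (0:ℝ) ≤ n / 2 by positivity)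
      have e3 : -(2 / (2 * (n:ℝ))) * (n / 2) = -(1/2) := by field_simp
      nlinarith
    calc _ ≤ Real.exp 1 := Real.exp_le_exp.2 h3
      _ ≤ 3 := by have := Real.exp_one_lt_d9; linarith
  calc _ ≤ ∫⁻ x, (ENNReal.ofReal (8 * (40320 * 9 ^ 8)) * ENNReal.ofReal (Real.exp (NB B x / 9)) +
      ENNReal.ofReal (8 * (24 * 4 ^ 4)) * ENNReal.ofReal 3) ∂μ := by
        apply lintegral_mono
        intro x
        dsimp only
        rw [lintegral_add_left (by fun_prop), lintegral_const, measure_univ, mul_one, lintegral_const_mul _ (by fun_prop)]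
        exact add_le_add le_rfl (mul_le_mul_right hg _)
    _ = ENNReal.ofReal (8 * (40320 * 9 ^ 8)) * ∫⁻ x, ENNReal.ofReal (Real.exp (NB B x / 9)) ∂μ +
      ENNReal.ofReal (8 * (24 * 4 ^ 4)) * ENNReal.ofReal 3 := by
        rw [lintegral_add_left (by fun_prop), lintegral_const_mul _ (by fun_prop)]
        simp
    _ ≤ ENNReal.ofReal (8 * (40320 * 9 ^ 8)) * ENNReal.ofReal 100 +
      ENNReal.ofReal (8 * (24 * 4 ^ 4)) * ENNReal.ofReal 3 := by
        refine add_le_add (mul_le_mul_right (seminorm_exp H.hpl (NB B) (NB_meas B) ?_) _) le_rfl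
        simp_rw [NB_apply]
        exact H.hN2.le
    _ = ENNReal.ofReal K4 := by
        rw [← ENNReal.ofReal_mul (by positivity), ← ENNReal.ofReal_mul (by positivity),
      ← ENNReal.ofReal_add (by positivity) (by positivity)]; rfl

end Mom


section Abs
set_option linter.unusedSectionVars false

variable {Ω : Type} [MeasurableSpace Ω] (P : Measure Ω) [IsProbabilityMeasure P]

lemma abs_med (Z : Ω → ℝ) (hZm : Measurable Z) (hZ0 : ∀ ω, 0 ≤ Z ω) (h1 : ∫⁻ ω, ENNReal.ofReal (Z ω) ∂P = 1)
    (F : ℝ → ℝ) (hF : ∀ t, 0 < t → 0 ≤ F t)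
    (hc : ∀ m t : ℝ, 0 < t → t ≤ 1 → P.real {ω | Z ω ≤ m} * P.real {ω | m + t ≤ Z ω} ≤ F t) :
    ∃ m0 : ℝ, 0 ≤ m0 ∧ m0 ≤ 2 ∧ ∀ t, 0 < t → t ≤ 1 → P.real {ω | t ≤ |Z ω - m0|} ≤ 4 * F (t / 2) := by
  set S := {m : ℝ | 1 / 2 ≤ P.real {ω | Z ω ≤ m}} with hS
  have hcompl : ∀ m, 1 ≤ P.real {ω | Z ω ≤ m} + P.real {ω | m ≤ Z ω} := by
    intro m
    have e : (Set.univ : Set Ω) = {ω | Z ω ≤ m} ∪ {ω | m ≤ Z ω} := by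
      ext ω; simp [le_total]
    calc (1:ℝ) = P.real Set.univ := by simp
      _ ≤ _ := by rw [e]; exact measureReal_union_le _ _
  have h2S : (2:ℝ) ∈ S := by
    have := mul_meas_ge_le_lintegral (μ := P) (f := fun ω => ENNReal.ofReal (Z ω)) (by fun_prop) (ENNReal.ofReal 2)
    rw [h1] at this
    have e : {ω | ENNReal.ofReal 2 ≤ ENNReal.ofReal (Z ω)} = {ω | 2 ≤ Z ω} := by
      ext ω
      simp only [Set.mem_ofPred_eq]
      rw [ENNReal.ofReal_le_ofReal_iff (hZ0 ω)]
    rw [e, ← ofReal_measureReal, ← ENNReal.ofReal_mul (by norm_num), ENNReal.ofReal_le_one] at this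
    have := hcompl 2
    rw [hS, Set.mem_ofPred_eq]
    linarith
  have hlb : ∀ m ∈ S, 0 ≤ m := by
    intro m hm
    by_contra h
    push Not at h
    have : {ω | Z ω ≤ m} = ∅ := by
      ext ω; simp only [Set.mem_ofPred_eq, Set.mem_empty_iff_false, iff_false, not_le]
      linarith [hZ0 ω]
    rw [hS, Set.mem_ofPred_eq] at hm
    rw [this] at hm; norm_num at hm
  have hbdd : BddBelow S := ⟨0, hlb⟩
  refine ⟨sInf S, le_csInf ⟨2, h2S⟩ hlb, csInf_le hbdd h2S, fun t ht ht1 => ?_⟩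
  set m0 := sInf S
  have hF' := hF (t / 2) (by linarith)
  have a1 : 1 / 2 ≤ P.real {ω | Z ω ≤ m0 + t / 2} := by
    obtain ⟨m, hm, hlt⟩ := exists_lt_of_csInf_lt ⟨2, h2S⟩ (show sInf S < m0 + t / 2 by linarith)
    rw [hS, Set.mem_ofPred_eq] at hm
    refine hm.trans (measureReal_mono (fun ω hω => ?_) (measure_ne_top _ _))
    simp only [Set.mem_ofPred_eq] at hω ⊢
    linarith
  have a2 : 1 / 2 ≤ P.real {ω | m0 - t / 2 ≤ Z ω} := by
    have : m0 - t / 2 ∉ S := fun h => by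
      have := csInf_le hbdd h
      linarith
    have h3 : ¬ (1 / 2 ≤ P.real {ω | Z ω ≤ m0 - t / 2}) := this
    have := hcompl (m0 - t / 2)
    linarith
  have b1 := hc (m0 + t / 2) (t / 2) (by linarith) (by linarith)
  have b2 := hc (m0 - t) (t / 2) (by linarith) (by linarith)
  have e1 : m0 + t / 2 + t / 2 = m0 + t := by ring
  have e2 : m0 - t + t / 2 = m0 - t / 2 := by ring
  rw [e1] at b1
  rw [e2] at b2
  have hsub : {ω | t ≤ |Z ω - m0|} ⊆ {ω | m0 + t ≤ Z ω} ∪ {ω | Z ω ≤ m0 - t} := by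
    intro ω hω
    simp only [Set.mem_ofPred_eq, Set.mem_union] at hω ⊢
    rcases le_abs.1 hω with h | h
    · left; linarith
    · right; linarith
  have c1 := measureReal_mono (μ := P) hsub (measure_ne_top _ _)
  have c2 := measureReal_union_le (μ := P) {ω | m0 + t ≤ Z ω} {ω | Z ω ≤ m0 - t}
  have d1 : 0 ≤ P.real {ω | m0 + t ≤ Z ω} := measureReal_nonneg
  have d2 : 0 ≤ P.real {ω | Z ω ≤ m0 - t} := measureReal_nonneg
  nlinarith

lemma w_facts (D p : ℝ) (hD : 1 ≤ D) (hp : 3 ≤ p) :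
    0 < D ^ (-(1 / p)) ∧ D ^ (-(1 / p)) ≤ 1 ∧ D * (D ^ (-(1 / p))) ^ p = 1 ∧ 1 ≤ D ^ 2 * (D ^ (-(1 / p))) ^ 4 := by
  have hD0 : 0 < D := by linarith
  refine ⟨by positivity, Real.rpow_le_one_of_one_le_of_nonpos hD (by simp; positivity), ?_, ?_⟩
  · rw [← Real.rpow_mul hD0.le]
    have : -(1 / p) * p = -1 := by field_simp
    rw [this, Real.rpow_neg_one]; field_simp
  · rw [← Real.rpow_natCast, ← Real.rpow_natCast, ← Real.rpow_mul hD0.le, ← Real.rpow_add hD0]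
    apply Real.one_le_rpow hD
    push_cast
    have : 1 / p ≤ 1 / 3 := by apply one_div_le_one_div_of_le <;> linarith
    linarith

lemma half_pow (x p : ℝ) (hx : 0 ≤ x) (_hp0 : 0 ≤ p) (hp : p ≤ 4) (a : ℝ) (ha : 1 ≤ a) : x ^ p / a ^ 4 ≤ (x / a) ^ p := by
  rw [Real.div_rpow hx (by linarith)]
  have : a ^ p ≤ a ^ 4 := by
    rw [← Real.rpow_natCast]
    exact Real.rpow_le_rpow_of_exponent_le ha (by norm_num; linarith)
  have h0 : 0 < a ^ p := by positivity
  have := Real.rpow_nonneg hx p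
  gcongr

lemma sum_aux (c : ℝ) (hc : 0 < c) : Summable (fun k : ℕ => (2 * (k:ℝ) ^ 2 + 2) * Real.exp (-(c * k))) := by
  have e : ∀ k : ℕ, Real.exp (-(c * k)) = Real.exp (-c) ^ k := by
    intro k; rw [← Real.exp_nat_mul]; congr 1; ring
  have hr : ‖Real.exp (-c)‖ < 1 := by
    rw [Real.norm_of_nonneg (Real.exp_pos _).le]
    exact Real.exp_lt_one_iff.2 (by linarith)
  have s1 := (summable_pow_mul_geometric_of_norm_lt_one 2 hr).mul_left 2
  have s2 := (summable_geometric_of_norm_lt_one hr).mul_left 2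
  refine (s1.add s2).congr fun k => ?_
  rw [e]; ring

def KK (C0 c K4 : ℝ) : ℝ := 1 + (4 * C0 * ∑' k : ℕ, (2 * (k:ℝ) ^ 2 + 2) * Real.exp (-(c / 16 * k))) + 4 * (K4 + 16) + 1024 * C0 / c ^ 2

set_option maxHeartbeats 800000 in
lemma abs_var (C0 c K4 : ℝ) (hC0 : 1 ≤ C0) (hc0 : 0 < c) (hK4 : 0 < K4) 
    (Z : Ω → ℝ) (hZm : Measurable Z) (hZ0 : ∀ ω, 0 ≤ Z ω) (h4 : ∫⁻ ω, ENNReal.ofReal (Z ω ^ 4) ∂P ≤ ENNReal.ofReal K4)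
    (D p : ℝ) (hD : 1 ≤ D) (hp : 3 ≤ p) (hp4 : p ≤ 4) (m0 : ℝ) (hm0 : 0 ≤ m0) (hm2 : m0 ≤ 2)
    (ht : ∀ t, 0 < t → t ≤ 1 → P.real {ω | t ≤ |Z ω - m0|} ≤ 4 * (C0 * Real.exp (-(c * D * (t / 2) ^ p)))) :
    ∫⁻ ω, ENNReal.ofReal ((Z ω - m0) ^ 2) ∂P ≤ ENNReal.ofReal (KK C0 c K4 * (D ^ (-(1 / p))) ^ 2) := by
  obtain ⟨hw0, hw1, hwD, hw4⟩ := w_facts D p hD hp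
  set w := D ^ (-(1 / p)) with hw
  have hD0 : 0 < D := by linarith
  set A : ℕ → Set Ω := fun k => {ω | k * w ≤ |Z ω - m0| ∧ k * w ≤ 1} with hA
  have hAm : ∀ k, MeasurableSet (A k) := fun k => by
    have h1 : MeasurableSet {ω | k * w ≤ |Z ω - m0|} := measurableSet_le measurable_const (by fun_prop)
    have h2 : MeasurableSet {ω : Ω | k * w ≤ 1} := measurableSet_le measurable_const measurable_const
    exact h1.inter h2
  set A1 : Set Ω := {ω | 1 ≤ |Z ω - m0|} with hA1
  have hA1m : MeasurableSet A1 := measurableSet_le measurable_const (by fun_prop)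
  have pt : ∀ ω, ENNReal.ofReal ((Z ω - m0) ^ 2) ≤
      (∑' k : ℕ, ENNReal.ofReal (w ^ 2 * (2 * (k:ℝ) ^ 2 + 2)) * (A k).indicator 1 ω) +
      (ENNReal.ofReal (w ^ 2 / 2) * ENNReal.ofReal (8 * (Z ω ^ 4 + 16)) + ENNReal.ofReal (1 / (2 * w ^ 2)) * A1.indicator 1 ω) := by
    intro ω
    by_cases hY : |Z ω - m0| ≤ 1
    · refine le_trans (le_trans ?_ (ENNReal.le_tsum ⌊|Z ω - m0| / w⌋₊)) le_self_add
      set k := ⌊|Z ω - m0| / w⌋₊ with hk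
      have f1 : (k:ℝ) * w ≤ |Z ω - m0| := by
        rw [← le_div_iff₀ hw0]; exact Nat.floor_le (by positivity)
      have f2 : |Z ω - m0| ≤ (k + 1) * w := by
        rw [← div_le_iff₀ hw0]; exact (Nat.lt_floor_add_one _).le
      have f3 : ω ∈ A k := ⟨f1, f1.trans hY⟩
      rw [Set.indicator_of_mem f3]
      simp only [Pi.one_apply, mul_one]
      apply ENNReal.ofReal_le_ofReal
      rw [← sq_abs]
      calc |Z ω - m0| ^ 2 ≤ ((k + 1) * w) ^ 2 := by gcongr
        _ = w ^ 2 * ((k:ℝ) + 1) ^ 2 := by ring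
        _ ≤ _ := by gcongr; nlinarith [sq_nonneg ((k:ℝ) - 1)]
    · push Not at hY
      refine le_trans ?_ le_add_self
      have f3 : ω ∈ A1 := hY.le
      rw [Set.indicator_of_mem f3]
      simp only [Pi.one_apply, mul_one]
      have hz := hZ0 ω
      rw [← ENNReal.ofReal_mul (by positivity), ← ENNReal.ofReal_add (by positivity) (by positivity)]
      apply ENNReal.ofReal_le_ofReal
      have g1 : (Z ω - m0) ^ 4 ≤ 8 * (Z ω ^ 4 + 16) := by
        have h := add_pow_le hz hm0 4
        norm_num at h
        have h5 : m0 ^ 4 ≤ 2 ^ 4 := by gcongr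
        have h6 : (Z ω - m0) ^ 4 ≤ (Z ω + m0) ^ 4 := by
          have : |Z ω - m0| ≤ |Z ω + m0| := by
            rw [abs_of_nonneg (by linarith : 0 ≤ Z ω + m0)]
            exact abs_le.2 ⟨by linarith, by linarith⟩
          have := pow_le_pow_left₀ (abs_nonneg _) this 4
          rwa [Even.pow_abs (by decide), Even.pow_abs (by decide)] at this
        linarith
      set y := (Z ω - m0) ^ 2 with hy
      have g2 : y ^ 2 = (Z ω - m0) ^ 4 := by rw [hy]; ring
      have g3 : y ≤ w ^ 2 / 2 * y ^ 2 + 1 / (2 * w ^ 2) := by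
        have : w ^ 2 / 2 * y ^ 2 + 1 / (2 * w ^ 2) - y = (w ^ 2 * y - 1) ^ 2 / (2 * w ^ 2) := by field_simp; ring
        have : 0 ≤ (w ^ 2 * y - 1) ^ 2 / (2 * w ^ 2) := by positivity
        linarith
      have g4 : w ^ 2 / 2 * y ^ 2 ≤ w ^ 2 / 2 * (8 * (Z ω ^ 4 + 16)) := by rw [g2]; gcongr
      linarith
  have hPA : ∀ k, P (A k) ≤ ENNReal.ofReal (4 * C0 * Real.exp (-(c / 16 * k))) := by
    intro k
    by_cases hk : k = 0
    · subst hk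
      refine prob_le_one.trans ?_
      rw [← ENNReal.ofReal_one]
      apply ENNReal.ofReal_le_ofReal
      simp; linarith
    by_cases hk1 : k * w ≤ 1
    · have hk0 : (1:ℝ) ≤ k := by exact_mod_cast Nat.one_le_iff_ne_zero.2 hk
      have h := ht (k * w) (by positivity) hk1
      rw [← ofReal_measureReal]
      apply ENNReal.ofReal_le_ofReal
      refine (measureReal_mono (fun ω hω => hω.1) (measure_ne_top _ _)).trans (h.trans ?_)
      rw [← mul_assoc]
      refine mul_le_mul_of_nonneg_left (Real.exp_le_exp.2 (neg_le_neg ?_)) (by positivity)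
      have h1 := half_pow (k * w) p (by positivity) (by linarith) hp4 2 (by norm_num)
      rw [Real.mul_rpow (by positivity) hw0.le] at h1
      have h2 : (k:ℝ) ≤ (k:ℝ) ^ p := by
        calc (k:ℝ) = (k:ℝ) ^ (1:ℝ) := by simp
          _ ≤ _ := Real.rpow_le_rpow_of_exponent_le hk0 (by linarith)
      calc c / 16 * k ≤ c / 16 * ((k:ℝ) ^ p * (D * w ^ p)) := by rw [hwD, mul_one]; gcongr
        _ = c * D * ((k:ℝ) ^ p * w ^ p / 2 ^ 4) := by ring
        _ ≤ _ := by gcongr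
    · have : A k = ∅ := by
        ext ω; simp [hA, hk1]
      rw [this]; simp
  have hPA1 : P A1 ≤ ENNReal.ofReal (2048 * C0 / c ^ 2 * w ^ 4) := by
    have h := ht 1 one_pos le_rfl
    rw [← ofReal_measureReal]
    apply ENNReal.ofReal_le_ofReal
    refine h.trans ?_
    have h1 := half_pow 1 p (by norm_num) (by linarith) hp4 2 (by norm_num)
    rw [Real.one_rpow] at h1
    have h3 : Real.exp (-(c * D * (1 / 2) ^ p)) ≤ Real.exp (-(c * D / 16)) := by
      apply Real.exp_le_exp.2 (neg_le_neg ?_)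
      calc c * D / 16 = c * D * (1 / 2 ^ 4) := by ring
        _ ≤ _ := by gcongr
    have h4 := Real.pow_div_factorial_le_exp (c * D / 16) (by positivity) 2
    simp only [Nat.factorial, Nat.succ_eq_add_one, Nat.reduceAdd, mul_one, Nat.cast_ofNat] at h4
    have h5 : Real.exp (-(c * D / 16)) ≤ 512 / (c ^ 2 * D ^ 2) := by
      rw [Real.exp_neg, inv_le_comm₀ (Real.exp_pos _) (by positivity)]
      refine le_trans (le_of_eq ?_) h4
      rw [inv_div]; push_cast; ring
    have h6 : 512 / (c ^ 2 * D ^ 2) ≤ 512 / c ^ 2 * w ^ 4 := by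
      rw [div_le_iff₀ (by positivity)]
      calc (512:ℝ) = 512 * 1 := by ring
        _ ≤ 512 * (D ^ 2 * w ^ 4) := by gcongr
        _ = _ := by field_simp
    calc 4 * (C0 * Real.exp (-(c * D * (1 / 2) ^ p))) ≤ 4 * (C0 * (512 / c ^ 2 * w ^ 4)) := by
          gcongr; linarith
      _ = _ := by ring
  have hsum := sum_aux (c / 16) (by positivity)
  set K1 := ∑' k : ℕ, (2 * (k:ℝ) ^ 2 + 2) * Real.exp (-(c / 16 * k)) with hK1
  have hK1p : 0 ≤ K1 := tsum_nonneg fun k => by positivity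
  have i1 : ∫⁻ ω, (∑' k : ℕ, ENNReal.ofReal (w ^ 2 * (2 * (k:ℝ) ^ 2 + 2)) * (A k).indicator 1 ω) ∂P ≤
      ENNReal.ofReal (w ^ 2 * (4 * C0 * K1)) := by
    rw [lintegral_tsum (fun k => (((measurable_one.indicator (hAm k)).const_mul _)).aemeasurable)]
    have : w ^ 2 * (4 * C0 * K1) = ∑' k : ℕ, w ^ 2 * (4 * C0) * ((2 * (k:ℝ) ^ 2 + 2) * Real.exp (-(c / 16 * k))) := by
      rw [tsum_mul_left]; ring
    rw [this, ENNReal.ofReal_tsum_of_nonneg (fun k => by positivity) (hsum.mul_left _)]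
    apply ENNReal.tsum_le_tsum
    intro k
    rw [lintegral_const_mul _ (measurable_one.indicator (hAm k)), lintegral_indicator_one (hAm k)]
    refine (mul_le_mul_right (hPA k) _).trans (le_of_eq ?_)
    rw [← ENNReal.ofReal_mul (by positivity)]
    congr 1; ring
  have i2 : ∫⁻ ω, ENNReal.ofReal (w ^ 2 / 2) * ENNReal.ofReal (8 * (Z ω ^ 4 + 16)) ∂P ≤ ENNReal.ofReal (w ^ 2 / 2 * (8 * (K4 + 16))) := by
    rw [lintegral_const_mul _ (by fun_prop), ENNReal.ofReal_mul (by positivity : 0 ≤ w ^ 2 / 2)]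
    refine mul_le_mul_right ?_ _
    have e : ∀ ω, ENNReal.ofReal (8 * (Z ω ^ 4 + 16)) = ENNReal.ofReal 8 * (ENNReal.ofReal (Z ω ^ 4) + ENNReal.ofReal 16) := by
      intro ω
      have := hZ0 ω
      rw [← ENNReal.ofReal_add (by positivity) (by positivity), ← ENNReal.ofReal_mul (by positivity)]
    simp_rw [e]
    rw [lintegral_const_mul _ (by fun_prop), lintegral_add_left (by fun_prop), lintegral_const, measure_univ, mul_one,
      ENNReal.ofReal_mul (by norm_num : (0:ℝ) ≤ 8), ENNReal.ofReal_add hK4.le (by norm_num)]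
    exact mul_le_mul_right (add_le_add h4 le_rfl) _
  have i3 : ∫⁻ ω, ENNReal.ofReal (1 / (2 * w ^ 2)) * A1.indicator 1 ω ∂P ≤ ENNReal.ofReal (1 / (2 * w ^ 2) * (2048 * C0 / c ^ 2 * w ^ 4)) := by
    rw [lintegral_const_mul _ (measurable_one.indicator hA1m), lintegral_indicator_one hA1m, ENNReal.ofReal_mul (by positivity : 0 ≤ 1 / (2 * w ^ 2))]
    exact mul_le_mul_right hPA1 _
  refine (lintegral_mono pt).trans ?_
  have mm1 : Measurable fun ω => ENNReal.ofReal (w ^ 2 / 2) * ENNReal.ofReal (8 * (Z ω ^ 4 + 16)) := by fun_prop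
  have mm2 : Measurable fun ω => ENNReal.ofReal (1 / (2 * w ^ 2)) * A1.indicator 1 ω :=
    (measurable_one.indicator hA1m).const_mul _
  refine (lintegral_add_right _ (mm1.add mm2)).le.trans ?_
  refine (add_le_add i1 ((lintegral_add_left mm1 _).le.trans (add_le_add i2 i3))).trans ?_
  rw [← ENNReal.ofReal_add (by positivity) (by positivity), ← ENNReal.ofReal_add (by positivity) (by positivity)]
  apply ENNReal.ofReal_le_ofReal
  have e : KK C0 c K4 * w ^ 2 = w ^ 2 + (w ^ 2 * (4 * C0 * K1) + (w ^ 2 / 2 * (8 * (K4 + 16)) + 1 / (2 * w ^ 2) * (2048 * C0 / c ^ 2 * w ^ 4))) := by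
    unfold KK; rw [← hK1]; field_simp; ring
  rw [e]
  have : 0 < w ^ 2 := by positivity
  linarith

lemma KK_ge (C0 c K4 : ℝ) (hC0 : 1 ≤ C0) (hc0 : 0 < c) (hK4 : 0 < K4) : 1 ≤ KK C0 c K4 := by
  have : 0 ≤ ∑' k : ℕ, (2 * (k:ℝ) ^ 2 + 2) * Real.exp (-(c / 16 * k)) := tsum_nonneg fun k => by positivity
  unfold KK
  have h1 : 0 ≤ 4 * C0 * ∑' k : ℕ, (2 * (k:ℝ) ^ 2 + 2) * Real.exp (-(c / 16 * k)) := by positivity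
  have h2 : 0 ≤ 1024 * C0 / c ^ 2 := by positivity
  linarith

end Abs


section Abs2
set_option linter.unusedSectionVars false

lemma pow_bd (x p M : ℝ) (hx : 0 < x) (hp : 3 ≤ p) (hp4 : p ≤ 4) (hM : 1 ≤ M) (h : x ^ 2 ≤ M) : x ^ p ≤ x ^ 2 * M := by
  have e : x ^ p = x ^ 2 * x ^ (p - 2) := by
    rw [← Real.rpow_two, ← Real.rpow_add hx]; congr 1; ring
  rw [e]
  gcongr
  by_cases h1 : x ≤ 1
  · exact (Real.rpow_le_one hx.le h1 (by linarith)).trans hM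
  · push Not at h1
    refine le_trans ?_ h
    rw [← Real.rpow_two]
    exact Real.rpow_le_rpow_of_exponent_le h1.le (by linarith)

variable {Ω : Type} [MeasurableSpace Ω] (P : Measure Ω) [IsProbabilityMeasure P]

lemma cantelli (Z : Ω → ℝ) (hi : Integrable Z P) (h1 : ∫ ω, Z ω ∂P = 1) (hi2 : Integrable (fun ω => (Z ω - 1) ^ 2) P)
    (s t : ℝ) (hs : 0 < s) (ht : 0 < t) (hV : ∫ ω, (Z ω - 1) ^ 2 ∂P ≤ s) :
    P.real {ω | 1 + t ≤ Z ω} * (t ^ 2 + s) ≤ s := by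
  set l := s / t with hl
  have hl0 : 0 < l := by positivity
  have e : ∀ ω, (Z ω - 1 + l) ^ 2 = (Z ω - 1) ^ 2 + (2 * l) * (Z ω - 1) + l ^ 2 := fun ω => by ring
  have hi3 : Integrable (fun ω => (2 * l) * (Z ω - 1)) P := (hi.sub (integrable_const 1)).const_mul _
  have hi4 : Integrable (fun ω => (Z ω - 1) ^ 2 + (2 * l) * (Z ω - 1)) P := hi2.add hi3
  have hf : Integrable (fun ω => (Z ω - 1 + l) ^ 2) P := by
    simp_rw [e]; exact hi4.add (integrable_const _)
  have hI : ∫ ω, (Z ω - 1 + l) ^ 2 ∂P ≤ s + l ^ 2 := by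
    simp_rw [e]
    rw [integral_add hi4 (integrable_const _), integral_add hi2 hi3, integral_const_mul, integral_sub hi (integrable_const _), h1]
    simp; exact hV
  have hM := mul_meas_ge_le_integral_of_nonneg (μ := P) (f := fun ω => (Z ω - 1 + l) ^ 2) (ae_of_all _ fun ω => sq_nonneg _) hf ((t + l) ^ 2)
  have hsub : P.real {ω | 1 + t ≤ Z ω} ≤ P.real {ω | (t + l) ^ 2 ≤ (Z ω - 1 + l) ^ 2} := by
    refine measureReal_mono (fun ω hω => ?_) (measure_ne_top _ _)
    simp only [Set.mem_ofPred_eq] at hω ⊢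
    gcongr; linarith
  have h0 : 0 ≤ P.real {ω | 1 + t ≤ Z ω} := measureReal_nonneg
  have h5 : (t + l) ^ 2 * P.real {ω | 1 + t ≤ Z ω} ≤ s + l ^ 2 :=
    (mul_le_mul_of_nonneg_left hsub (by positivity)).trans (hM.trans hI)
  have e1 : (t + l) ^ 2 = (t ^ 2 + s) ^ 2 / t ^ 2 := by rw [hl]; field_simp
  have e2 : s + l ^ 2 = s * (t ^ 2 + s) / t ^ 2 := by rw [hl]; field_simp
  rw [e1, e2, div_mul_eq_mul_div, div_le_div_iff_of_pos_right (by positivity)] at h5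
  have : 0 < t ^ 2 + s := by positivity
  nlinarith

set_option maxHeartbeats 1000000 in
theorem abs_final (C0 c K4 : ℝ) (hC0 : 1 ≤ C0) (hc0 : 0 < c) (hK4 : 0 < K4) : ∃ c' C' : ℝ, 0 < c' ∧ 1 ≤ C' ∧
    ∀ (Ω : Type) [MeasurableSpace Ω] (P : Measure Ω) [IsProbabilityMeasure P]
    (Z : Ω → ℝ) (_ : Measurable Z) (_ : ∀ ω, 0 ≤ Z ω) (_ : ∫⁻ ω, ENNReal.ofReal (Z ω) ∂P = 1)
    (_ : ∫⁻ ω, ENNReal.ofReal (Z ω ^ 4) ∂P ≤ ENNReal.ofReal K4)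
    (D p : ℝ) (_ : 0 < D) (_ : 3 ≤ p) (_ : p ≤ 4)
    (_ : ∀ m t : ℝ, 0 < t → t ≤ 1 → P.real {ω | Z ω ≤ m} * P.real {ω | m + t ≤ Z ω} ≤ C0 * Real.exp (-(c * D * t ^ p))),
    ∀ t, 0 < t → t ≤ 1 → P.real {ω | Z ω ≤ 1 - t} ≤ C' * Real.exp (-(c' * D * t ^ p)) ∧
      P.real {ω | 1 + t ≤ Z ω} ≤ Real.exp (-(c' * D * t ^ p)) := by
  set K := KK C0 c K4 with hK
  have hK1 : 1 ≤ K := KK_ge C0 c K4 hC0 hc0 hK4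
  set c1 := c / 4 ^ 4 with hc1
  have hc10 : 0 < c1 := by positivity
  set C1 := max (4 * C0) (Real.exp (16 * c1 * K ^ 2)) with hC1
  have hC1a : 4 * C0 ≤ C1 := le_max_left _ _
  have hC1b : Real.exp (16 * c1 * K ^ 2) ≤ C1 := le_max_right _ _
  have hC14 : 4 ≤ C1 := by linarith
  set L := max 1 (2 * Real.log C1 / c1) with hL
  have hL1 : 1 ≤ L := le_max_left _ _
  have hL2 : 2 * Real.log C1 / c1 ≤ L := le_max_right _ _
  set c' := min (min (c1 / 2) (1 / (K * L * (1 + L)))) (1 / 2) with hc'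
  have q1 : c' ≤ c1 / 2 := (min_le_left _ _).trans (min_le_left _ _)
  have q2 : c' ≤ 1 / (K * L * (1 + L)) := (min_le_left _ _).trans (min_le_right _ _)
  have q3 : c' ≤ 1 / 2 := min_le_right _ _
  have q0 : 0 < c' := by
    rw [hc']; refine lt_min (lt_min (by positivity) (by positivity)) (by norm_num)
  refine ⟨c', C1, q0, by linarith, ?_⟩
  intro Ω _ P _ Z hZm hZ0 h1 h4 D p hD0 hp hp4 hc t ht ht1
  have htp : 0 < t ^ p := by positivity
  have htp1 : t ^ p ≤ t := by
    calc t ^ p ≤ t ^ (1:ℝ) := Real.rpow_le_rpow_of_exponent_ge ht ht1 (by linarith)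
      _ = t := by simp
  have hi : Integrable Z P := by
    refine ⟨hZm.aestronglyMeasurable, ?_⟩
    rw [hasFiniteIntegral_iff_ofReal (ae_of_all _ hZ0), h1]; simp
  have hE : ∫ ω, Z ω ∂P = 1 := by
    rw [integral_eq_lintegral_of_nonneg_ae (ae_of_all _ hZ0) hZm.aestronglyMeasurable, h1]; simp
  by_cases hD : D < 1
  · have hDt : D * t ^ p ≤ t := by nlinarith
    have hDt0 : 0 < D * t ^ p := by positivity
    constructor
    · refine le_trans measureReal_le_one ?_
      have : Real.exp (-1) ≤ Real.exp (-(c' * D * t ^ p)) := by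
        apply Real.exp_le_exp.2; nlinarith
      have h2 : 1 / 3 ≤ Real.exp (-1) := by
        have := Real.exp_one_lt_d9
        rw [Real.exp_neg, ← one_div]
        apply one_div_le_one_div_of_le (Real.exp_pos _); linarith
      nlinarith
    · have hM := mul_meas_ge_le_integral_of_nonneg (μ := P) (f := Z) (ae_of_all _ hZ0) hi (1 + t)
      rw [hE] at hM
      have h2 := Real.one_sub_inv_le_log_of_pos (show 0 < 1 + t by linarith)
      have h3 : t / 2 ≤ 1 - (1 + t)⁻¹ := by
        have e : 1 - (1 + t)⁻¹ = t / (1 + t) := by field_simp; ring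
        rw [e]
        gcongr; linarith
      calc P.real {ω | 1 + t ≤ Z ω} ≤ (1 + t)⁻¹ := by
            rw [← one_div, le_div_iff₀ (by positivity)]; linarith
        _ = Real.exp (-Real.log (1 + t)) := by rw [Real.exp_neg, Real.exp_log (by positivity)]
        _ ≤ _ := by apply Real.exp_le_exp.2; nlinarith
  push Not at hD
  obtain ⟨m0, hm0, hm2, hm⟩ := abs_med P Z hZm hZ0 h1 (fun t => C0 * Real.exp (-(c * D * t ^ p)))
    (fun t _ => by positivity) hc
  have hvar := abs_var P C0 c K4 hC0 hc0 hK4 Z hZm hZ0 h4 D p hD hp hp4 m0 hm0 hm2 hm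
  obtain ⟨hw0, hw1, hwD, -⟩ := w_facts D p hD hp
  set w := D ^ (-(1 / p)) with hw
  set s := K * w ^ 2 with hs
  have hs0 : 0 < s := by positivity
  have him : Integrable (fun ω => (Z ω - m0) ^ 2) P := by
    refine ⟨by fun_prop, ?_⟩
    rw [hasFiniteIntegral_iff_ofReal (ae_of_all _ fun ω => sq_nonneg _)]
    exact hvar.trans_lt ENNReal.ofReal_lt_top
  have hIm : ∫ ω, (Z ω - m0) ^ 2 ∂P ≤ s := by
    rw [integral_eq_lintegral_of_nonneg_ae (ae_of_all _ fun ω => sq_nonneg _) (by fun_prop)]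
    exact ENNReal.toReal_le_of_le_ofReal hs0.le hvar
  have e : ∀ ω, (Z ω - 1) ^ 2 = (Z ω - m0) ^ 2 + (2 * (m0 - 1)) * (Z ω - m0) + (m0 - 1) ^ 2 := fun ω => by ring
  have hi3 : Integrable (fun ω => (2 * (m0 - 1)) * (Z ω - m0)) P := (hi.sub (integrable_const _)).const_mul _
  have hi4 : Integrable (fun ω => (Z ω - m0) ^ 2 + (2 * (m0 - 1)) * (Z ω - m0)) P := him.add hi3
  have hi1 : Integrable (fun ω => (Z ω - 1) ^ 2) P := by
    simp_rw [e]; exact hi4.add (integrable_const _)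
  have hI1 : ∫ ω, (Z ω - 1) ^ 2 ∂P = ∫ ω, (Z ω - m0) ^ 2 ∂P - (m0 - 1) ^ 2 := by
    simp_rw [e]
    rw [integral_add hi4 (integrable_const _), integral_add him hi3, integral_const_mul, integral_sub hi (integrable_const _), hE]
    simp; ring
  have hI1n : 0 ≤ ∫ ω, (Z ω - 1) ^ 2 ∂P := integral_nonneg fun ω => sq_nonneg _
  have hms : (m0 - 1) ^ 2 ≤ s := by linarith
  have hV : ∫ ω, (Z ω - 1) ^ 2 ∂P ≤ s := by nlinarith [sq_nonneg (m0 - 1)]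
  set x := t / w with hx
  have hx0 : 0 < x := by positivity
  have hxw : t = x * w := by rw [hx]; field_simp
  have hDx : D * t ^ p = x ^ p := by
    rw [hxw, Real.mul_rpow hx0.le hw0.le]
    calc D * (x ^ p * w ^ p) = x ^ p * (D * w ^ p) := by ring
      _ = x ^ p := by rw [hwD, mul_one]
  have hxp : 0 < x ^ p := by positivity
  have two : P.real {ω | t ≤ |Z ω - 1|} ≤ C1 * Real.exp (-(c1 * x ^ p)) := by
    by_cases hcase : 4 * s ≤ t ^ 2
    · have hab : |m0 - 1| ≤ t / 2 := abs_le_of_sq_le_sq (by nlinarith) (by positivity)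
      have h2 := hm (t / 2) (by linarith) (by linarith)
      have h3 : P.real {ω | t ≤ |Z ω - 1|} ≤ P.real {ω | t / 2 ≤ |Z ω - m0|} := by
        refine measureReal_mono (fun ω hω => ?_) (measure_ne_top _ _)
        simp only [Set.mem_ofPred_eq] at hω ⊢
        have := abs_add_le (Z ω - m0) (m0 - 1)
        have e : Z ω - m0 + (m0 - 1) = Z ω - 1 := by ring
        rw [e] at this
        linarith
      refine h3.trans (h2.trans ?_)
      rw [← mul_assoc]
      refine mul_le_mul hC1a (Real.exp_le_exp.2 (neg_le_neg ?_)) (by positivity) (by linarith)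
      have h5 := half_pow t p ht.le (by linarith) hp4 4 (by norm_num)
      have e4 : t / 2 / 2 = t / 4 := by ring
      rw [e4, ← hDx]
      calc c1 * (D * t ^ p) = c * D * (t ^ p / 4 ^ 4) := by rw [hc1]; ring
        _ ≤ _ := by gcongr
    · push Not at hcase
      have h5 : x ^ 2 ≤ 4 * K := by
        rw [hx, div_pow, div_le_iff₀ (by positivity)]; rw [hs] at hcase; linarith
      have h6 := pow_bd x p (4 * K) hx0 hp hp4 (by linarith) h5
      have h7 : x ^ p ≤ 16 * K ^ 2 := by nlinarith
      refine le_trans measureReal_le_one ?_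
      calc (1:ℝ) = Real.exp (16 * c1 * K ^ 2) * Real.exp (-(16 * c1 * K ^ 2)) := by
            rw [← Real.exp_add]; simp
        _ ≤ C1 * Real.exp (-(c1 * x ^ p)) := by
            refine mul_le_mul hC1b (Real.exp_le_exp.2 (neg_le_neg ?_)) (by positivity) (by linarith)
            nlinarith
  have eD : c' * D * t ^ p = c' * x ^ p := by rw [mul_assoc, hDx]
  rw [eD]
  constructor
  · have h2 : P.real {ω | Z ω ≤ 1 - t} ≤ P.real {ω | t ≤ |Z ω - 1|} := by
      refine measureReal_mono (fun ω hω => ?_) (measure_ne_top _ _)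
      simp only [Set.mem_ofPred_eq] at hω ⊢
      exact le_abs.2 (Or.inr (by linarith))
    refine h2.trans (two.trans ?_)
    refine mul_le_mul_of_nonneg_left (Real.exp_le_exp.2 (neg_le_neg ?_)) (by linarith)
    nlinarith
  · have h2 : P.real {ω | 1 + t ≤ Z ω} ≤ P.real {ω | t ≤ |Z ω - 1|} := by
      refine measureReal_mono (fun ω hω => ?_) (measure_ne_top _ _)
      simp only [Set.mem_ofPred_eq] at hω ⊢
      exact le_abs.2 (Or.inl (by linarith))
    by_cases hcase : 2 * Real.log C1 ≤ c1 * x ^ p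
    · refine h2.trans (two.trans ?_)
      rw [← Real.exp_log (show 0 < C1 by linarith), ← Real.exp_add]
      apply Real.exp_le_exp.2
      nlinarith
    · push Not at hcase
      have h5 : x ^ p < L := by
        refine lt_of_lt_of_le ?_ hL2
        rw [lt_div_iff₀ hc10]; linarith
      have h6 : x ^ 2 ≤ L := by
        by_cases h : x ≤ 1
        · nlinarith
        · push Not at h
          refine le_trans ?_ h5.le
          rw [← Real.rpow_two]
          exact Real.rpow_le_rpow_of_exponent_le h.le (by linarith)
      have h7 := pow_bd x p L hx0 hp hp4 hL1 h6
      have h8 := cantelli P Z hi hE hi1 s t hs0 ht hV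
      set y := x ^ 2 / K with hy
      have hy0 : 0 < y := by positivity
      have hyL : y ≤ L := by
        refine le_trans ?_ h6
        rw [hy]; exact div_le_self (by positivity) hK1
      have h9 : t ^ 2 + s = s * (1 + y) := by
        rw [hy, hs, hxw]; field_simp; ring
      rw [h9] at h8
      have h10 : P.real {ω | 1 + t ≤ Z ω} ≤ (1 + y)⁻¹ := by
        rw [← one_div, le_div_iff₀ (by positivity)]
        nlinarith
      have h11 := Real.one_sub_inv_le_log_of_pos (show 0 < 1 + y by linarith)
      have h12 : c' * x ^ p ≤ 1 - (1 + y)⁻¹ := by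
        have e : 1 - (1 + y)⁻¹ = y / (1 + y) := by field_simp; ring
        rw [e]
        calc c' * x ^ p ≤ 1 / (K * L * (1 + L)) * (x ^ 2 * L) := by gcongr
          _ = y / (1 + L) := by rw [hy]; field_simp
          _ ≤ _ := by gcongr
      refine h10.trans ?_
      calc (1 + y)⁻¹ = Real.exp (-Real.log (1 + y)) := by rw [Real.exp_neg, Real.exp_log (by positivity)]
        _ ≤ _ := by apply Real.exp_le_exp.2; linarith

end Abs2


section Core
set_option linter.unusedSectionVars false
variable {n : ℕ} (μ : Measure (EE n)) [IsProbabilityMeasure μ] (B : EE n →L[ℝ] EE n)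

lemma ZV_le (hn : 1 ≤ n) (z : EE n × EE n) : ZV B z ≤ ‖B z.1‖ ^ 2 + ‖z.2‖ ^ 2 / n := by
  have hn' : (1:ℝ) ≤ n := by exact_mod_cast hn
  unfold ZV
  rw [div_le_iff₀ (by positivity)]
  have h2 := norm_add_le (√(n:ℝ) • B z.1) z.2
  have h3 : ‖√(n:ℝ) • B z.1 + z.2‖ ^ 2 ≤ (‖√(n:ℝ) • B z.1‖ + ‖z.2‖) ^ 2 := by gcongr
  have h4 := nw B z.1
  have h5 : (‖B z.1‖ ^ 2 + ‖z.2‖ ^ 2 / n) * (2 * n) = 2 * (n * ‖B z.1‖ ^ 2) + 2 * ‖z.2‖ ^ 2 := by field_simp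
  rw [h5, ← h4]
  nlinarith [sq_nonneg (‖√(n:ℝ) • B z.1‖ - ‖z.2‖)]

lemma big_t {α b : ℝ} (H : Hyp μ B α b) (hα1 : 1 ≤ α) (hα2 : α ≤ 2) (hn : 1 ≤ n) (t : ℝ) (ht : 12 ≤ t) :
    (μ.prod (gam n)).real {z | (1 + t) ^ 2 ≤ ZV B z} ≤ Real.exp (-(c10 / 36 * DD B α b * t)) := by
  have hn' : (1:ℝ) ≤ n := by exact_mod_cast hn
  have hD := H.DD_pos
  have hDn := H.DD_le μ B hα1 hα2 hn
  have hc0 := c10_pos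
  have hc1 := c10_le
  set D := DD B α b with hDdef
  have h3 : (μ.prod (gam n)).real {z | (1 + t) ^ 2 ≤ ZV B z} ≤ 3 * Real.exp (-(c10 / 18 * D * t)) := by
    have hsub : {z | (1 + t) ^ 2 ≤ ZV B z} ⊆ ({x | 9 * ((1 + t) * (7 / 90)) ≤ ‖B x‖} ×ˢ Set.univ) ∪
        (Set.univ ×ˢ {g : EE n | 1 / 4 * (n * (1 + t) ^ 2 / 2) ≤ 1 / 4 * ‖0 + g‖ ^ 2}) := by
      intro z hz
      simp only [Set.mem_ofPred_eq, Set.mem_union, Set.mem_prod, Set.mem_univ, and_true, true_and] at hz ⊢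
      have h := ZV_le B hn z
      by_contra hcon
      push Not at hcon
      obtain ⟨h1, h2⟩ := hcon
      rw [zero_add] at h2
      have h4 : ‖z.2‖ ^ 2 / n ≤ (1 + t) ^ 2 / 2 := by
        rw [div_le_iff₀ (by positivity)]; linarith
      have h5 : ‖B z.1‖ ^ 2 < (9 * ((1 + t) * (7 / 90))) ^ 2 := by
        have := norm_nonneg (B z.1)
        gcongr
      nlinarith [sq_nonneg (1 + t)]
    have m1 : (μ.prod (gam n)).real ({x | 9 * ((1 + t) * (7 / 90)) ≤ ‖B x‖} ×ˢ Set.univ) ≤ 2 * Real.exp (-(c10 / 18 * D * t)) := by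
      rw [measureReal_prod_prod]
      simp only [probReal_univ, mul_one]
      refine (S10a μ B H hα1 hα2 ((1 + t) * (7 / 90)) (by linarith)).trans ?_
      refine mul_le_mul_of_nonneg_left (Real.exp_le_exp.2 (neg_le_neg ?_)) (by norm_num)
      rw [← hDdef]
      have : 0 < c10 * D := by positivity
      nlinarith
    have m2 : (μ.prod (gam n)).real (Set.univ ×ˢ {g : EE n | 1 / 4 * (n * (1 + t) ^ 2 / 2) ≤ 1 / 4 * ‖0 + g‖ ^ 2}) ≤ Real.exp (-(c10 / 18 * D * t)) := by
      rw [measureReal_prod_prod]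
      simp only [probReal_univ, one_mul]
      have h := chern n (1 / 4) (n * (1 + t) ^ 2 / 2) (by norm_num) 0
      refine (real_le_of (Real.exp_pos _).le h).trans (Real.exp_le_exp.2 ?_)
      simp only [norm_zero]
      have a1 : c10 / 18 * D * t ≤ n * t := by
        have : c10 / 18 * D ≤ n := by nlinarith
        gcongr
      have a2 : t ≤ (1 + t) ^ 2 / 8 - 1 / 2 := by nlinarith
      nlinarith
    calc _ ≤ _ := measureReal_mono hsub (measure_ne_top _ _)
      _ ≤ _ := measureReal_union_le _ _
      _ ≤ _ := by linarith
  by_cases hcase : 2 * Real.log 3 ≤ c10 / 18 * D * t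
  · refine h3.trans ?_
    calc 3 * Real.exp (-(c10 / 18 * D * t)) = Real.exp (Real.log 3 + -(c10 / 18 * D * t)) := by
          rw [Real.exp_add, Real.exp_log (by norm_num)]
      _ ≤ _ := by apply Real.exp_le_exp.2; linarith
  · push Not at hcase
    have hM := mul_meas_ge_le_lintegral (μ := μ.prod (gam n)) (f := fun z => ENNReal.ofReal (ZV B z))
      (by have := ZV_meas B; fun_prop) (ENNReal.ofReal 4)
    rw [EZ μ B H hn] at hM
    have e : {z | ENNReal.ofReal 4 ≤ ENNReal.ofReal (ZV B z)} = {z | 4 ≤ ZV B z} := by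
      ext z
      simp only [Set.mem_ofPred_eq]
      rw [ENNReal.ofReal_le_ofReal_iff (ZV_nonneg B z)]
    rw [e, ← ofReal_measureReal, ← ENNReal.ofReal_mul (by norm_num), ENNReal.ofReal_le_one] at hM
    have h5 : (μ.prod (gam n)).real {z | (1 + t) ^ 2 ≤ ZV B z} ≤ (μ.prod (gam n)).real {z | 4 ≤ ZV B z} := by
      refine measureReal_mono (fun z hz => ?_) (measure_ne_top _ _)
      simp only [Set.mem_ofPred_eq] at hz ⊢
      nlinarith
    have h6 : (1:ℝ) / 3 ≤ Real.exp (-(c10 / 36 * D * t)) := by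
      calc (1:ℝ) / 3 = Real.exp (-Real.log 3) := by rw [Real.exp_neg, Real.exp_log (by norm_num)]; norm_num
        _ ≤ _ := by apply Real.exp_le_exp.2; linarith
    linarith

lemma small_ball (hn : 1 ≤ n) (ε : ℝ) (hε : 0 < ε) :
    (μ.prod (gam n)).real {z | ZV B z ≤ ε ^ 2} ≤ Real.exp (-(n * Real.log (1 / 3 / ε))) := by
  have hn' : (1:ℝ) ≤ n := by exact_mod_cast hn
  apply real_le_of (by positivity)
  have hm : MeasurableSet {z | ZV B z ≤ ε ^ 2} := measurableSet_le (ZV_meas B) measurable_const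
  rw [Measure.prod_apply hm]
  have key : ∀ x, (gam n) (Prod.mk x ⁻¹' {z | ZV B z ≤ ε ^ 2}) ≤ ENNReal.ofReal (Real.exp (-(n * Real.log (1 / 3 / ε)))) := by
    intro x
    set w := √(n:ℝ) • B x with hw
    set s : ℝ := -(1 / (4 * ε ^ 2)) with hs
    have hs0 : s < 0 := by rw [hs]; simp; positivity
    have h0 := mul_meas_ge_le_lintegral (μ := gam n) (f := fun g => ENNReal.ofReal (Real.exp (s * ‖w + g‖ ^ 2)))
      (by fun_prop) (ENNReal.ofReal (Real.exp (-(n / 2))))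
    rw [gam_exp_sq n s (by linarith) w] at h0
    have hsub : Prod.mk x ⁻¹' {z | ZV B z ≤ ε ^ 2} ⊆
        {g | ENNReal.ofReal (Real.exp (-(n / 2))) ≤ ENNReal.ofReal (Real.exp (s * ‖w + g‖ ^ 2))} := by
      intro g hg
      simp only [Set.mem_preimage, Set.mem_ofPred_eq, ZV] at hg ⊢
      apply ENNReal.ofReal_le_ofReal
      apply Real.exp_le_exp.2
      rw [div_le_iff₀ (by positivity)] at hg
      rw [hs]
      have : 1 / (4 * ε ^ 2) * ‖w + g‖ ^ 2 ≤ n / 2 := by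
        calc 1 / (4 * ε ^ 2) * ‖w + g‖ ^ 2 ≤ 1 / (4 * ε ^ 2) * (ε ^ 2 * (2 * n)) := by gcongr
          _ = (n:ℝ) / 2 := by field_simp; ring
      linarith
    refine (measure_mono hsub).trans ?_
    calc _ = ENNReal.ofReal (Real.exp (n / 2)) * (ENNReal.ofReal (Real.exp (-(n / 2))) *
          (gam n) {g | ENNReal.ofReal (Real.exp (-(n / 2))) ≤ ENNReal.ofReal (Real.exp (s * ‖w + g‖ ^ 2))}) := by
          rw [← mul_assoc, ← ENNReal.ofReal_mul (by positivity), ← Real.exp_add]; simp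
      _ ≤ _ := mul_le_mul_right h0 _
      _ ≤ _ := by
          rw [← ENNReal.ofReal_mul (by positivity)]
          apply ENNReal.ofReal_le_ofReal
          have h2s : 0 < 1 - 2 * s := by linarith
          rw [Real.rpow_def_of_pos h2s, ← Real.exp_add, ← Real.exp_add]
          apply Real.exp_le_exp.2
          have h1 : s * ‖w‖ ^ 2 / (1 - 2 * s) ≤ 0 := by
            apply div_nonpos_of_nonpos_of_nonneg _ h2s.le
            nlinarith [sq_nonneg ‖w‖]
          have h2 : Real.log (1 / (2 * ε ^ 2)) ≤ Real.log (1 - 2 * s) := by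
            apply Real.log_le_log (by positivity)
            rw [hs]
            have : 2 * -(1 / (4 * ε ^ 2)) = -(1 / (2 * ε ^ 2)) := by field_simp; norm_num
            rw [this]; linarith
          rw [Real.log_div (by norm_num) (by positivity), Real.log_mul (by norm_num) (by positivity), Real.log_pow,
            Real.log_one] at h2
          rw [Real.log_div (by norm_num) (by positivity), Real.log_div (by norm_num) (by norm_num), Real.log_one]
          push_cast at h2
          have h3 : 1 + Real.log 2 ≤ 2 * Real.log 3 := by
            have a : Real.log 9 = 2 * Real.log 3 := by
              rw [show (9:ℝ) = 3 ^ 2 by norm_num, Real.log_pow]; norm_num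
            have b : 1 + Real.log 2 = Real.log (Real.exp 1 * 2) := by
              rw [Real.log_mul (Real.exp_pos _).ne' (by norm_num), Real.log_exp]
            rw [b, ← a]
            apply Real.log_le_log (by positivity)
            have := Real.exp_one_lt_d9
            linarith
          nlinarith
  calc _ ≤ ∫⁻ _, ENNReal.ofReal (Real.exp (-(n * Real.log (1 / 3 / ε)))) ∂μ := lintegral_mono key
    _ = _ := by simp

theorem core : ∃ c C : ℝ, 0 < c ∧ 1 ≤ C ∧
    ∀ (n : ℕ) (_ : 1 ≤ n) (μ : Measure (EE n)) [IsProbabilityMeasure μ] (B : EE n →L[ℝ] EE n) (α b : ℝ)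
      (_ : Hyp μ B α b) (_ : 1 ≤ α) (_ : α ≤ 2),
    (∀ t : ℝ, 0 ≤ t → (μ.prod (gam n)).real {z | (1 + t) ^ 2 ≤ ZV B z} ≤
      Real.exp (-(c * DD B α b * min (t ^ (2 + α)) t))) ∧
    (∀ t : ℝ, 0 ≤ t → t < 1 → (μ.prod (gam n)).real {z | ZV B z ≤ (1 - t) ^ 2} ≤
      C * Real.exp (-(c * DD B α b * max (t ^ (2 + α)) (Real.log (1 / 3 / (1 - t)))))) := by
  obtain ⟨c', C', hc', hC', h⟩ := abs_final 4000 c13 K4 (by norm_num) c13_pos K4_pos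
  have hc0 := c10_pos
  set c := min (min (c' / 12) (c10 / 36)) (1 / 4) with hc
  have q1 : c ≤ c' / 12 := (min_le_left _ _).trans (min_le_left _ _)
  have q2 : c ≤ c10 / 36 := (min_le_left _ _).trans (min_le_right _ _)
  have q3 : c ≤ 1 / 4 := min_le_right _ _
  have q0 : 0 < c := by
    rw [hc]; refine lt_min (lt_min (by positivity) (by positivity)) (by norm_num)
  refine ⟨c, C', q0, hC', ?_⟩
  intro n hn μ _ B α b H hα1 hα2
  have hD := H.DD_pos
  have hDn := H.DD_le μ B hα1 hα2 hn
  have h' := h (EE n × EE n) (μ.prod (gam n)) (ZV B) (ZV_meas B) (ZV_nonneg B) (EZ μ B H hn) (EZ4 μ B H hn)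
    (DD B α b) (2 + α) hD (by linarith) (by linarith) (S13 μ B H hα1 hα2 hn)
  set D := DD B α b with hDdef
  constructor
  · intro t ht
    rcases ht.eq_or_lt with h0 | h0
    · subst h0
      refine measureReal_le_one.trans ?_
      rw [Real.zero_rpow (by linarith)]; simp
    by_cases h1 : t ≤ 1
    · have hb : t ^ (2 + α) ≤ t := by
        calc t ^ (2 + α) ≤ t ^ (1:ℝ) := Real.rpow_le_rpow_of_exponent_ge h0 h1 (by linarith)
          _ = t := by simp
      rw [min_eq_left hb]
      have htp : 0 < t ^ (2 + α) := by positivity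
      have h2 : (μ.prod (gam n)).real {z | (1 + t) ^ 2 ≤ ZV B z} ≤ (μ.prod (gam n)).real {z | 1 + t ≤ ZV B z} := by
        refine measureReal_mono (fun z hz => ?_) (measure_ne_top _ _)
        simp only [Set.mem_ofPred_eq] at hz ⊢
        nlinarith
      refine h2.trans ((h' t h0 h1).2.trans (Real.exp_le_exp.2 (neg_le_neg ?_)))
      gcongr; linarith
    push Not at h1
    have hb : t ≤ t ^ (2 + α) := by
      calc t = t ^ (1:ℝ) := by simp
        _ ≤ _ := Real.rpow_le_rpow_of_exponent_le h1.le (by linarith)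
    rw [min_eq_right hb]
    by_cases h12 : t ≤ 12
    · have h2 : (μ.prod (gam n)).real {z | (1 + t) ^ 2 ≤ ZV B z} ≤ (μ.prod (gam n)).real {z | 1 + 1 ≤ ZV B z} := by
        refine measureReal_mono (fun z hz => ?_) (measure_ne_top _ _)
        simp only [Set.mem_ofPred_eq] at hz ⊢
        nlinarith
      refine h2.trans ((h' 1 one_pos le_rfl).2.trans (Real.exp_le_exp.2 (neg_le_neg ?_)))
      rw [Real.one_rpow, mul_one]
      calc c * D * t ≤ c' / 12 * D * 12 := by gcongr
        _ = c' * D := by ring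
    · push Not at h12
      refine (big_t μ B H hα1 hα2 hn t h12.le).trans (Real.exp_le_exp.2 (neg_le_neg ?_))
      gcongr
  · intro t ht ht1
    by_cases hmax : Real.log (1 / 3 / (1 - t)) ≤ t ^ (2 + α)
    · rw [max_eq_left hmax]
      rcases ht.eq_or_lt with h0 | h0
      · subst h0
        refine measureReal_le_one.trans ?_
        rw [Real.zero_rpow (by linarith)]; simpa using hC'
      have htp : 0 < t ^ (2 + α) := by positivity
      have h2 : (μ.prod (gam n)).real {z | ZV B z ≤ (1 - t) ^ 2} ≤ (μ.prod (gam n)).real {z | ZV B z ≤ 1 - t} := by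
        refine measureReal_mono (fun z hz => ?_) (measure_ne_top _ _)
        simp only [Set.mem_ofPred_eq] at hz ⊢
        nlinarith
      refine h2.trans ((h' t h0 ht1.le).1.trans ?_)
      refine mul_le_mul_of_nonneg_left (Real.exp_le_exp.2 (neg_le_neg ?_)) (by linarith)
      gcongr; linarith
    · push Not at hmax
      rw [max_eq_right hmax.le]
      have hl : 0 < Real.log (1 / 3 / (1 - t)) := lt_of_le_of_lt (by positivity) hmax
      refine (small_ball μ B hn (1 - t) (by linarith)).trans ?_
      refine le_trans ?_ (le_mul_of_one_le_left (Real.exp_pos _).le hC')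
      apply Real.exp_le_exp.2 (neg_le_neg ?_)
      gcongr
      nlinarith

end Core


lemma mom_fin {n : ℕ} (μ : Measure (EE n)) [IsProbabilityMeasure μ] (hpl : PLmeas μ)
    (hiso : ∀ θ : EE n, ∫⁻ x, ENNReal.ofReal (⟪x, θ⟫ ^ 2) ∂μ = ENNReal.ofReal (‖θ‖ ^ 2))
    (p : ℝ) (hp : 2 ≤ p) (θ : EE n) : ∫⁻ x, ENNReal.ofReal (|⟪x, θ⟫| ^ p) ∂μ < ⊤ := by
  rcases eq_or_ne θ 0 with rfl | hθ
  · have : p ≠ 0 := by linarith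
    simp [Real.zero_rpow this]
  have hθ' : 0 < ‖θ‖ := norm_pos_iff.2 hθ
  set N : Seminorm ℝ (EE n) := (innerSL ℝ (‖θ‖⁻¹ • θ)).toLinearMap.toSeminorm with hN
  have hNa : ∀ x, N x = |⟪x, ‖θ‖⁻¹ • θ⟫| := by
    intro x
    rw [hN, LinearMap.toSeminorm_apply, real_inner_comm]
    rfl
  have hNm : Measurable N := by
    have : (N : EE n → ℝ) = fun x => |⟪x, ‖θ‖⁻¹ • θ⟫| := funext hNa
    rw [this]
    have hc : Continuous fun x : EE n => |⟪x, ‖θ‖⁻¹ • θ⟫| := by fun_prop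
    exact hc.measurable
  have h := seminorm_exp hpl N hNm (by
    simp_rw [hNa, sq_abs]
    rw [hiso, norm_smul, norm_inv, norm_norm, inv_mul_cancel₀ hθ'.ne']
    simp)
  have hp0 : 0 < p := by linarith
  have pt : ∀ x, ENNReal.ofReal (|⟪x, θ⟫| ^ p) ≤
      ENNReal.ofReal ((‖θ‖ * (9 * p)) ^ p) * ENNReal.ofReal (Real.exp (N x / 9)) := by
    intro x
    rw [← ENNReal.ofReal_mul (by positivity)]
    apply ENNReal.ofReal_le_ofReal
    have h1 : |⟪x, θ⟫| = ‖θ‖ * N x := by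
      rw [hNa, real_inner_smul_right, abs_mul, abs_of_pos (inv_pos.2 hθ'), mul_inv_cancel_left₀ hθ'.ne']
    have h2 : N x / (9 * p) ≤ Real.exp (N x / (9 * p)) := by
      linarith [Real.add_one_le_exp (N x / (9 * p))]
    have h3 : Real.exp (N x / 9) = Real.exp (N x / (9 * p)) ^ p := by
      rw [← Real.exp_mul]; congr 1; field_simp
    have hN0 : 0 ≤ N x := apply_nonneg N x
    rw [h1, h3, ← Real.mul_rpow (by positivity) (by positivity)]
    apply Real.rpow_le_rpow (by positivity) _ hp0.le
    rw [mul_assoc]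
    apply mul_le_mul_of_nonneg_left _ hθ'.le
    rwa [div_le_iff₀' (by positivity)] at h2
  calc _ ≤ ∫⁻ x, ENNReal.ofReal ((‖θ‖ * (9 * p)) ^ p) * ENNReal.ofReal (Real.exp (N x / 9)) ∂μ :=
        lintegral_mono pt
    _ = ENNReal.ofReal ((‖θ‖ * (9 * p)) ^ p) * ∫⁻ x, ENNReal.ofReal (Real.exp (N x / 9)) ∂μ := by
        rw [lintegral_const_mul']
        exact ENNReal.ofReal_ne_top
    _ < ⊤ := ENNReal.mul_lt_top ENNReal.ofReal_lt_top (h.trans_lt ENNReal.ofReal_lt_top)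

lemma mk_hyp {n : ℕ} (hn : 1 ≤ n) {Ω : Type} [MeasurableSpace Ω] (P : Measure Ω) [IsProbabilityMeasure P]
    (X : Ω → EE n) (f : EE n → ℝ) (α b : ℝ) (A : Matrix (Fin n) (Fin n) ℝ)
    (hX : HasDensityFn P X f) (hf : IsLogConcaveFn f) (hI : Isotropic P X)
    (hα : 1 ≤ α) (hψ : IsPsiAlpha P X α b) (hA : hsNorm A ^ 2 = n) :
    Hyp (P.map X) ((√(n:ℝ))⁻¹ • LinearMap.toContinuousLinearMap (Matrix.toEuclideanLin A)) α b := by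
  have hXm := hX.1
  have : IsProbabilityMeasure (P.map X) := Measure.isProbabilityMeasure_map hXm.aemeasurable
  have hn0 : (0:ℝ) < n := by exact_mod_cast hn
  have hmi : ∀ θ : EE n, Measurable fun x : EE n => ⟪x, θ⟫ := by
    intro θ
    have hc : Continuous fun x : EE n => ⟪x, θ⟫ := by fun_prop
    exact hc.measurable
  have hint2 : ∀ θ : EE n, ∫ ω, ⟪X ω, θ⟫ ^ 2 ∂P = ‖θ‖ ^ 2 := by
    intro θ
    have := hI.2 θ θ
    rw [real_inner_self_eq_norm_sq] at this
    rw [← this]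
    congr 1; ext ω; ring
  have hiso : ∀ θ : EE n, ∫⁻ x, ENNReal.ofReal (⟪x, θ⟫ ^ 2) ∂(P.map X) = ENNReal.ofReal (‖θ‖ ^ 2) := by
    intro θ
    rw [lintegral_map ((hmi θ).pow_const 2).ennreal_ofReal hXm]
    rcases eq_or_ne θ 0 with rfl | hθ
    · simp
    · have hi : Integrable (fun ω => ⟪X ω, θ⟫ ^ 2) P := by
        by_contra h
        have h1 := integral_undef h
        rw [hint2] at h1
        exact hθ (norm_eq_zero.1 (pow_eq_zero_iff (two_ne_zero) |>.1 h1))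
      rw [← hint2 θ, ofReal_integral_eq_lintegral_ofReal hi (Filter.Eventually.of_forall fun _ => sq_nonneg _)]
  have hpl : PLmeas (P.map X) := by rw [hX.2]; exact plmeas_of_logconcave hf
  have hsq : ∀ θ : EE n, (‖θ‖ ^ 2) ^ ((1:ℝ)/2) = ‖θ‖ := by
    intro θ
    rw [← Real.sqrt_eq_rpow, Real.sqrt_sq (norm_nonneg _)]
  have hB0 : ∑ i, ∑ j, (A i j) ^ 2 = (n:ℝ) := by
    rw [← hA, hsNorm, Real.sq_sqrt]
    exact Finset.sum_nonneg fun _ _ => Finset.sum_nonneg fun _ _ => sq_nonneg _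
  have hrow : ∀ (x : EE n) i, (Matrix.toEuclideanLin A x) i = ⟪x, WithLp.toLp 2 (A i)⟫ := by
    intro x i
    rw [Matrix.toEuclideanLin_apply]
    simp [Matrix.mulVec, dotProduct, PiLp.inner_apply]
  have hsn : (√(n:ℝ))⁻¹ ^ 2 = (n:ℝ)⁻¹ := by rw [inv_pow, Real.sq_sqrt hn0.le]
  refine ⟨?_, hpl, hiso, ?_, ?_, ?_⟩
  · have h := hψ 2 le_rfl (EuclideanSpace.basisFun (Fin n) ℝ ⟨0, hn⟩)
    rw [hint2, hsq, (EuclideanSpace.basisFun (Fin n) ℝ).norm_eq_one, mul_one] at h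
    have h2 : ∫ ω, |⟪X ω, EuclideanSpace.basisFun (Fin n) ℝ ⟨0, hn⟩⟫| ^ (2:ℝ) ∂P = 1 := by
      simp_rw [Real.rpow_two, sq_abs]
      rw [hint2, (EuclideanSpace.basisFun (Fin n) ℝ).norm_eq_one]; norm_num
    rw [h2, Real.one_rpow] at h
    by_contra hb
    push Not at hb
    have : 0 < (2:ℝ) ^ (1 / α) := by positivity
    nlinarith
  · intro p hp θ
    have hp0 : 0 < p := by linarith
    have hfin := mom_fin (P.map X) hpl hiso p hp θ
    have hm : Measurable fun x : EE n => |⟪x, θ⟫| ^ p := (hmi θ).abs.pow_const p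
    rw [lintegral_map hm.ennreal_ofReal hXm] at hfin ⊢
    have hnn : 0 ≤ᵐ[P] fun ω => |⟪X ω, θ⟫| ^ p := Filter.Eventually.of_forall fun _ => by positivity
    have hi : Integrable (fun ω => |⟪X ω, θ⟫| ^ p) P := by
      refine ⟨(hm.comp hXm).aestronglyMeasurable, ?_⟩
      rw [hasFiniteIntegral_iff_ofReal hnn]
      exact hfin
    rw [← ofReal_integral_eq_lintegral_ofReal hi hnn]
    apply ENNReal.ofReal_le_ofReal
    have h := hψ p hp θ
    rw [hint2, hsq] at h
    have h0 : 0 ≤ ∫ ω, |⟪X ω, θ⟫| ^ p ∂P := integral_nonneg fun _ => by positivity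
    have h1 := Real.rpow_le_rpow (by positivity) h hp0.le
    rwa [← Real.rpow_mul h0, one_div_mul_cancel hp0.ne', Real.rpow_one] at h1
  · have : ∀ j, ‖((√(n:ℝ))⁻¹ • LinearMap.toContinuousLinearMap (Matrix.toEuclideanLin A))
        (EuclideanSpace.basisFun (Fin n) ℝ j)‖ ^ 2 = (n:ℝ)⁻¹ * ∑ i, (A i j) ^ 2 := by
      intro j
      rw [ContinuousLinearMap.smul_apply, norm_smul, mul_pow, norm_inv, Real.norm_eq_abs,
        abs_of_nonneg (Real.sqrt_nonneg _), hsn, EuclideanSpace.norm_sq_eq]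
      congr 1
      apply Finset.sum_congr rfl
      intro i _
      rw [LinearMap.coe_toContinuousLinearMap', hrow, Real.norm_eq_abs, sq_abs,
        EuclideanSpace.basisFun_apply, EuclideanSpace.inner_single_left]
      simp
    simp_rw [this]
    rw [← Finset.mul_sum, Finset.sum_comm, hB0, inv_mul_cancel₀ hn0.ne']
  · have : ∀ x : EE n, ENNReal.ofReal (‖((√(n:ℝ))⁻¹ • LinearMap.toContinuousLinearMap (Matrix.toEuclideanLin A)) x‖ ^ 2)
        = ENNReal.ofReal (n:ℝ)⁻¹ * ∑ i, ENNReal.ofReal (⟪x, (WithLp.toLp 2 (A i) : EE n)⟫ ^ 2) := by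
      intro x
      rw [ContinuousLinearMap.smul_apply, norm_smul, mul_pow, norm_inv, Real.norm_eq_abs,
        abs_of_nonneg (Real.sqrt_nonneg _), hsn, EuclideanSpace.norm_sq_eq,
        ENNReal.ofReal_mul (by positivity), ← ENNReal.ofReal_sum_of_nonneg (fun _ _ => sq_nonneg _)]
      congr 2
      apply Finset.sum_congr rfl
      intro i _
      rw [LinearMap.coe_toContinuousLinearMap', hrow, Real.norm_eq_abs, sq_abs]
    simp_rw [this]
    rw [lintegral_const_mul' _ _ ENNReal.ofReal_ne_top,
      lintegral_finsetSum _ (fun i _ => ((hmi _).pow_const 2).ennreal_ofReal)]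
    simp_rw [hiso]
    rw [← ENNReal.ofReal_sum_of_nonneg (fun _ _ => sq_nonneg _), ← ENNReal.ofReal_mul (by positivity)]
    simp_rw [EuclideanSpace.norm_sq_eq, Real.norm_eq_abs, sq_abs]
    rw [hB0, inv_mul_cancel₀ hn0.ne', ENNReal.ofReal_one]

theorem statement15 :
    ∃ c C c₂ : ℝ, 0 < c ∧ 0 < C ∧ 0 < c₂ ∧ c₂ < 1 ∧
      ∀ (n : ℕ) (Ω : Type) (_mΩ : MeasurableSpace Ω) (P : Measure Ω),
        IsProbabilityMeasure P →
        ∀ (X G : Ω → EuclideanSpace ℝ (Fin n)) (f : EuclideanSpace ℝ (Fin n) → ℝ)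
          (α b : ℝ) (A : Matrix (Fin n) (Fin n) ℝ),
          HasDensityFn P X f → IsLogConcaveFn f → Isotropic P X →
          1 ≤ α → α ≤ 2 → IsPsiAlpha P X α b →
          IsStdGaussian P G → IndepFun X G P →
          hsNorm A ^ 2 = n →
          (∀ t : ℝ, 0 ≤ t →
            P {ω | (1 + t) * Real.sqrt n ≤ ‖(Real.sqrt 2)⁻¹ • (mApp A (X ω) + G ω)‖} ≤
              ENNReal.ofReal (Real.exp
                (-(c * ((n : ℝ) / (opNorm A ^ 2 * b ^ 2)) ^ (α/2) *
                  min (t ^ (2 + α)) t)))) ∧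
          ∀ t : ℝ, 0 ≤ t → t < 1 →
            P {ω | ‖(Real.sqrt 2)⁻¹ • (mApp A (X ω) + G ω)‖ ≤ (1 - t) * Real.sqrt n} ≤
              ENNReal.ofReal (C * Real.exp
                (-(c * ((n : ℝ) / (opNorm A ^ 2 * b ^ 2)) ^ (α/2) *
                  max (t ^ (2 + α)) (Real.log (c₂ / (1 - t)))))) := by
  obtain ⟨c, C, hc, hC, hcore⟩ := core
  refine ⟨c, C, 1 / 3, hc, by linarith, by norm_num, by norm_num, ?_⟩
  intro n Ω _mΩ P hP X G f α b A hX hf hI hα1 hα2 hψ hG hind hA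
  rcases Nat.eq_zero_or_pos n with rfl | hn
  · have h0 : (((0:ℕ) : ℝ) / (opNorm A ^ 2 * b ^ 2)) ^ (α / 2) = 0 := by
      rw [Nat.cast_zero, zero_div, Real.zero_rpow (by linarith)]
    rw [h0]
    refine ⟨fun t ht => ?_, fun t ht ht1 => ?_⟩
    · simp
    · simp only [mul_zero, zero_mul, neg_zero, Real.exp_zero, mul_one]
      exact prob_le_one.trans (by rw [← ENNReal.ofReal_one]; exact ENNReal.ofReal_le_ofReal hC)
  have hn0 : (0:ℝ) < n := by exact_mod_cast hn
  have hsn0 : 0 < √(n:ℝ) := Real.sqrt_pos.2 hn0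
  have H := mk_hyp hn P X f α b A hX hf hI hα1 hψ hA
  set L := LinearMap.toContinuousLinearMap (Matrix.toEuclideanLin A) with hL
  set B : EE n →L[ℝ] EE n := (√(n:ℝ))⁻¹ • L with hB
  have : IsProbabilityMeasure (P.map X) := Measure.isProbabilityMeasure_map hX.1.aemeasurable
  obtain ⟨hup, hlo⟩ := hcore n hn (P.map X) B α b H hα1 hα2
  have hlaw : P.map (fun ω => (X ω, G ω)) = (P.map X).prod (gam n) := by
    rw [(indepFun_iff_map_prod_eq_prod_map_map hX.1.aemeasurable hG.1.aemeasurable).1 hind, hG.2]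
    rfl
  have hpair : Measurable fun ω => (X ω, G ω) := hX.1.prodMk hG.1
  have hLpos : 0 < opNorm A := by
    have := H.normB
    rw [hB, norm_smul] at this
    exact pos_of_mul_pos_right this (norm_nonneg _)
  have hDD : ((n : ℝ) / (opNorm A ^ 2 * b ^ 2)) ^ (α/2) = DD B α b := by
    have hnB : ‖B‖ = (√(n:ℝ))⁻¹ * opNorm A := by
      rw [hB, norm_smul, norm_inv, Real.norm_eq_abs, abs_of_pos hsn0]; rfl
    have hb := H.hb
    have h1 : (n : ℝ) / (opNorm A ^ 2 * b ^ 2) = ((b * ‖B‖)⁻¹) ^ (2:ℝ) := by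
      rw [hnB, Real.rpow_two]
      field_simp
      rw [Real.sq_sqrt hn0.le]
    rw [h1, DD, ← Real.rpow_mul (by positivity)]
    congr 1; ring
  rw [hDD]
  have hZ : ∀ ω, ‖(Real.sqrt 2)⁻¹ • (mApp A (X ω) + G ω)‖ ^ 2 = n * ZV B (X ω, G ω) := by
    intro ω
    have : √(n:ℝ) • B (X ω) = mApp A (X ω) := by
      rw [hB, ContinuousLinearMap.smul_apply, smul_inv_smul₀ hsn0.ne']; rfl
    rw [ZV]
    dsimp only
    rw [this, norm_smul, mul_pow, norm_inv, Real.norm_eq_abs, abs_of_nonneg (Real.sqrt_nonneg _), inv_pow,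
      Real.sq_sqrt (by norm_num)]
    field_simp
  have hsq : ∀ s : ℝ, (s * √(n:ℝ)) ^ 2 = n * s ^ 2 := by
    intro s; rw [mul_pow, Real.sq_sqrt hn0.le, mul_comm]
  refine ⟨fun t ht => ?_, fun t ht ht1 => ?_⟩
  · have hset : {ω | (1 + t) * Real.sqrt n ≤ ‖(Real.sqrt 2)⁻¹ • (mApp A (X ω) + G ω)‖} =
        (fun ω => (X ω, G ω)) ⁻¹' {z | (1 + t) ^ 2 ≤ ZV B z} := by
      ext ω
      rw [Set.mem_preimage, Set.mem_ofPred_eq, Set.mem_ofPred_eq,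
        ← pow_le_pow_iff_left₀ (by positivity) (norm_nonneg _) two_ne_zero, hZ, hsq, mul_le_mul_iff_right₀ hn0]
    rw [hset, ← Measure.map_apply hpair (measurableSet_le measurable_const (ZV_meas B)), hlaw,
      ← ofReal_measureReal]
    exact ENNReal.ofReal_le_ofReal (hup t ht)
  · have hset : {ω | ‖(Real.sqrt 2)⁻¹ • (mApp A (X ω) + G ω)‖ ≤ (1 - t) * Real.sqrt n} =
        (fun ω => (X ω, G ω)) ⁻¹' {z | ZV B z ≤ (1 - t) ^ 2} := by
      ext ω
      have : 0 ≤ 1 - t := by linarith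
      rw [Set.mem_preimage, Set.mem_ofPred_eq, Set.mem_ofPred_eq,
        ← pow_le_pow_iff_left₀ (norm_nonneg _) (by positivity) two_ne_zero, hZ, hsq, mul_le_mul_iff_right₀ hn0]
    rw [hset, ← Measure.map_apply hpair (measurableSet_le (ZV_meas B) measurable_const), hlaw,
      ← ofReal_measureReal]
    exact ENNReal.ofReal_le_ofReal (hlo t ht ht1)
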